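/- arXiv:0906.2664 — 2 statements merged into one kernel-verified Lean document; each statement's English description precedes it below -/
import Mathlib

section
/- Let n ≤ d be positive integers, let A : ℝ^n → ℝ^{d−n} be a compactly supported Lipschitz function with graph Γ, let μ₀ be the measure on Γ with Π_♯μ₀ equal to Lebesgue measure on ℝ^n, and let μ = h dμ₀ for a bounded nonnegative Borel function h on Γ. Then | ‖S^⊥μ₀‖_{L²(μ₀)} − ‖S^⊥μ‖_{L²(μ₀)} | ≤ ‖S^⊥((h−1) dμ₀)‖_{L²(μ₀)} ≤ C‖∇A‖_∞ ‖h − 1‖_{L²(μ₀)}, where C depends only on n and d. -/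
open MeasureTheory Metric Set
open scoped ENNReal NNReal

noncomputable section

/-- The `s`-Riesz kernel in `ℝ^d`. -/
def rieszKernel (d : ℕ) (s : ℝ) (x y : EuclideanSpace ℝ (Fin d)) : EuclideanSpace ℝ (Fin d) :=
  ‖x - y‖ ^ (-(s + 1)) • (x - y)

/-- Doubly truncated Riesz transform `R^s_{t,u} μ (x)`. -/
def truncRiesz (d : ℕ) (s : ℝ) (μ : Measure (EuclideanSpace ℝ (Fin d)))
    (x : EuclideanSpace ℝ (Fin d)) (t u : ℝ) : EuclideanSpace ℝ (Fin d) :=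
  ∫ y in {y | t < dist x y ∧ dist x y ≤ u}, rieszKernel d s x y ∂μ

/-- The square function `Sμ(x)`, as a value in `ℝ≥0∞`. -/
def sqFn (d : ℕ) (s : ℝ) (μ : Measure (EuclideanSpace ℝ (Fin d)))
    (x : EuclideanSpace ℝ (Fin d)) : ℝ≥0∞ :=
  (∫⁻ t in Ioi (0:ℝ), ENNReal.ofReal (‖truncRiesz d s μ x t (2*t)‖^2 / t)) ^ (1/2 : ℝ)

/-- The map `Ã : x ↦ (x, A(x))` from `ℝ^n` to `ℝ^d`. -/
def graphMap (n d : ℕ) (hnd : n ≤ d)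
    (A : EuclideanSpace ℝ (Fin n) → EuclideanSpace ℝ (Fin (d - n)))
    (x : EuclideanSpace ℝ (Fin n)) : EuclideanSpace ℝ (Fin d) :=
  (WithLp.equiv 2 (Fin d → ℝ)).symm fun i =>
    if h : (i : ℕ) < n then x ⟨i, h⟩
    else A x ⟨(i : ℕ) - n, by have := i.isLt; omega⟩

/-- The graph `Γ = {(x, A(x)) : x ∈ ℝ^n} ⊂ ℝ^d`. -/
def graphSet (n d : ℕ) (hnd : n ≤ d)
    (A : EuclideanSpace ℝ (Fin n) → EuclideanSpace ℝ (Fin (d - n)))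
    : Set (EuclideanSpace ℝ (Fin d)) :=
  Set.range (graphMap n d hnd A)

/-- Orthogonal projection `Π^⊥` of `ℝ^d` onto the last `d - n` coordinates. -/
def projPerp (n d : ℕ) (x : EuclideanSpace ℝ (Fin d)) : EuclideanSpace ℝ (Fin d) :=
  (WithLp.equiv 2 (Fin d → ℝ)).symm fun i => if (i : ℕ) < n then 0 else x i

/-- The transversal square function `S^⊥μ(x)`. -/
def sqFnPerp (n d : ℕ) (μ : Measure (EuclideanSpace ℝ (Fin d)))
    (x : EuclideanSpace ℝ (Fin d)) : ℝ≥0∞ :=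
  (∫⁻ t in Ioi (0:ℝ),
    ENNReal.ofReal (‖projPerp n d (truncRiesz d n μ x t (2*t))‖^2 / t)) ^ (1/2 : ℝ)

/-- `L²(μ)`-norm of an `ℝ≥0∞`-valued function. -/
def l2Norm {α : Type*} [MeasurableSpace α] (μ : Measure α) (F : α → ℝ≥0∞) : ℝ≥0∞ :=
  (∫⁻ x, (F x) ^ 2 ∂μ) ^ (1/2 : ℝ)

/-- `‖∇A‖_{L²}` for a Lipschitz map `A : ℝ^n → ℝ^m` (the gradient is defined a.e.). -/
def gradL2 (n m : ℕ) (A : EuclideanSpace ℝ (Fin n) → EuclideanSpace ℝ (Fin m)) : ℝ≥0∞ :=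
  eLpNorm (fun x => fderiv ℝ A x) 2 volume

/-- The measure `g dH^n|_Γ`. -/
def graphMeasure (n d : ℕ) (hnd : n ≤ d)
    (A : EuclideanSpace ℝ (Fin n) → EuclideanSpace ℝ (Fin (d - n)))
    (g : EuclideanSpace ℝ (Fin d) → ℝ) : Measure (EuclideanSpace ℝ (Fin d)) :=
  (μH[(n:ℝ)].restrict (graphSet n d hnd A)).withDensity fun z => ENNReal.ofReal (g z)

/-- Doubly truncated Riesz transform of the (signed) measure `f dμ`. -/
def truncRieszF (d : ℕ) (s : ℝ) (μ : Measure (EuclideanSpace ℝ (Fin d)))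
    (f : EuclideanSpace ℝ (Fin d) → ℝ)
    (x : EuclideanSpace ℝ (Fin d)) (t u : ℝ) : EuclideanSpace ℝ (Fin d) :=
  ∫ y in {y | t < dist x y ∧ dist x y ≤ u}, f y • rieszKernel d s x y ∂μ

/-- The transversal square function `S^⊥(f dμ)(x)`. -/
def sqFnPerpF (n d : ℕ) (μ : Measure (EuclideanSpace ℝ (Fin d)))
    (f : EuclideanSpace ℝ (Fin d) → ℝ) (x : EuclideanSpace ℝ (Fin d)) : ℝ≥0∞ :=
  (∫⁻ t in Ioi (0:ℝ),
    ENNReal.ofReal (‖projPerp n d (truncRieszF d n μ f x t (2*t))‖^2 / t)) ^ (1/2 : ℝ)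

set_option linter.unusedSectionVars false

/-- generic summation lemma -/
lemma geo_sum (W c : ℕ → ℝ≥0∞) (h : ∀ i, W (i+1) ≤ ENNReal.ofReal (3/4) * W i + c i) (I : ℕ) :
    (∑ i ∈ Finset.range I, W i) + 4 * W I ≤ 4 * W 0 + 4 * ∑ i ∈ Finset.range I, c i := by
  induction I with
  | zero => simp
  | succ I ih =>
    have h34 : (4:ℝ≥0∞) * ENNReal.ofReal (3/4) = 3 := by
      rw [show (4:ℝ≥0∞) = ENNReal.ofReal 4 by simp, ← ENNReal.ofReal_mul (by norm_num)]
      norm_num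
    rw [Finset.sum_range_succ, Finset.sum_range_succ]
    calc (∑ i ∈ Finset.range I, W i) + W I + 4 * W (I+1)
        ≤ (∑ i ∈ Finset.range I, W i) + W I + 4 * (ENNReal.ofReal (3/4) * W I + c I) := by
          gcongr; exact h I
      _ = ((∑ i ∈ Finset.range I, W i) + 4 * W I) + 4 * c I := by
          rw [mul_add, ← mul_assoc, h34, show (4:ℝ≥0∞) = 3 + 1 by norm_num, add_mul 3 1 (W I)]; ring
      _ ≤ _ := by rw [mul_add, ← add_assoc]; gcongr

section para
variable {E V : Type*} [NormedAddCommGroup E] [MeasurableSpace E] [BorelSpace E]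
  [SecondCountableTopology E]
  [NormedAddCommGroup V] [InnerProductSpace ℝ V]
  (μ : Measure E) [μ.IsAddRightInvariant]

lemma lint_half (F : E → ℝ) (hF : Measurable F) (h0 : ∀ x, 0 ≤ F x) (v : E) :
    ∫⁻ x, ENNReal.ofReal ((F x + F (x + v)) / 2) ∂μ = ∫⁻ x, ENNReal.ofReal (F x) ∂μ := by
  have h1 : ∀ x, ENNReal.ofReal ((F x + F (x + v)) / 2)
      = ENNReal.ofReal (1/2) * ENNReal.ofReal (F x) + ENNReal.ofReal (1/2) * ENNReal.ofReal (F (x+v)) := by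
    intro x
    rw [← ENNReal.ofReal_mul (by norm_num), ← ENNReal.ofReal_mul (by norm_num),
      ← ENNReal.ofReal_add (by have := h0 x; positivity) (by have := h0 (x+v); positivity)]
    congr 1; ring
  simp_rw [h1]
  rw [lintegral_add_left (by fun_prop), lintegral_const_mul _ (by fun_prop),
    lintegral_const_mul _ (by fun_prop),
    lintegral_add_right_eq_self (fun x => ENNReal.ofReal (F x)) v, ← add_mul,
    ← ENNReal.ofReal_add (by norm_num) (by norm_num)]
  norm_num

lemma sum_d (f : ℕ → E → ℝ) (v : ℕ → E) (hf : ∀ i, Measurable (f i))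
    (hrec : ∀ i x, f (i+1) x = (f i x + f i (x + v i)) / 2) (I : ℕ) :
    ∑ i ∈ Finset.range I, ∫⁻ x, ENNReal.ofReal ((f i (x + v i) - f i x)^2) ∂μ
      ≤ 4 * ∫⁻ x, ENNReal.ofReal ((f 0 x)^2) ∂μ := by
  have step : ∀ i, ∫⁻ x, ENNReal.ofReal ((f i (x + v i) - f i x)^2) ∂μ
      + 4 * ∫⁻ x, ENNReal.ofReal ((f (i+1) x)^2) ∂μ = 4 * ∫⁻ x, ENNReal.ofReal ((f i x)^2) ∂μ := by
    intro i
    have := hf i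
    have := hf (i+1)
    rw [← lint_half μ (fun x => (f i x)^2) (by fun_prop) (fun x => sq_nonneg _) (v i),
      ← lintegral_const_mul _ (by fun_prop), ← lintegral_const_mul _ (by fun_prop),
      ← lintegral_add_left (by fun_prop)]
    refine lintegral_congr fun x => ?_
    rw [show (4:ℝ≥0∞) = ENNReal.ofReal 4 by simp, ← ENNReal.ofReal_mul (by norm_num),
      ← ENNReal.ofReal_mul (by norm_num), ← ENNReal.ofReal_add (by positivity) (by positivity), hrec]
    congr 1; ring
  have key : ∑ i ∈ Finset.range I, ∫⁻ x, ENNReal.ofReal ((f i (x + v i) - f i x)^2) ∂μ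
      + 4 * ∫⁻ x, ENNReal.ofReal ((f I x)^2) ∂μ = 4 * ∫⁻ x, ENNReal.ofReal ((f 0 x)^2) ∂μ := by
    induction I with
    | zero => simp
    | succ I ih => rw [Finset.sum_range_succ, add_assoc, step, ih]
  rw [← key]; exact le_self_add

lemma para_pt (L g g' : ℝ) (b b' : V) (hL : 0 ≤ L) (hb : ‖b‖ ≤ L) (hb' : ‖b'‖ ≤ L) :
    1/8 * (‖b' - b‖^2 * ((g+g')/2)^2) + ‖(1/2:ℝ) • (b + b')‖^2 * ((g+g')/2)^2
      ≤ (‖b‖^2 * g^2 + ‖b'‖^2 * g'^2)/2 + 2 * L^2 * (g'-g)^2 := by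
  have e1 : ‖(1/2:ℝ) • (b + b')‖^2 = (‖b‖^2+‖b'‖^2)/2 - ‖b'-b‖^2/4 := by
    have := parallelogram_law_with_norm ℝ b' b
    rw [norm_smul, mul_pow, add_comm b b']
    norm_num
    nlinarith
  have e2 : |‖b'‖ - ‖b‖| ≤ ‖b' - b‖ := abs_norm_sub_norm_le b' b
  rw [e1]
  set p := ‖b‖; set q := ‖b'‖; set B := ‖b'-b‖
  have hB : 0 ≤ B := norm_nonneg _
  have hp : 0 ≤ p := norm_nonneg _
  have hq : 0 ≤ q := norm_nonneg _
  set f := (g+g')/2 with hf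
  set d := g' - g with hd
  have hg : g = f - d/2 := by rw [hf, hd]; ring
  have hg' : g' = f + d/2 := by rw [hf, hd]; ring
  rw [hg, hg']
  have e3 : |q^2-p^2| ≤ 2*L*B := by
    rw [show q^2-p^2 = (q+p)*(q-p) by ring, abs_mul, abs_of_nonneg (by positivity)]
    have : 0 ≤ |q-p| := abs_nonneg _
    nlinarith
  have e4 : |(q^2-p^2)*(f*d)| ≤ 2*L*B*( |f| * |d|) := by
    rw [abs_mul, abs_mul f d]; gcongr
  have e5 := neg_le_of_abs_le e4
  have e6 : 0 ≤ (B*|f| - 4*L*|d|)^2 := sq_nonneg _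
  have e7 := sq_abs f
  have e8 := sq_abs d
  have e9 : (B*|f| - 4*L*|d|)^2 = B^2*f^2 - 8*L*B*( |f| * |d|) + 16*L^2*d^2 := by
    rw [← e7, ← e8]; ring
  have e10 : 0 ≤ (p^2+q^2)*d^2 := by positivity
  nlinarith

lemma sum_X [MeasurableSpace V] [BorelSpace V] [SecondCountableTopology V] (f : ℕ → E → ℝ) (b : ℕ → E → V) (v : ℕ → E) (L : ℝ) (hL : 0 ≤ L)
    (hf : ∀ i, Measurable (f i)) (hb : ∀ i, Measurable (b i))
    (hrec : ∀ i x, f (i+1) x = (f i x + f i (x + v i)) / 2)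
    (hbrec : ∀ i x, b (i+1) x = (1/2:ℝ) • (b i x + b i (x + v i)))
    (hbL : ∀ i x, ‖b i x‖ ≤ L) (I : ℕ) :
    ∑ i ∈ Finset.range I, ∫⁻ x, ENNReal.ofReal (‖b i (x + v i) - b i x‖^2 * (f (i+1) x)^2) ∂μ
      ≤ 72 * (ENNReal.ofReal (L^2) * ∫⁻ x, ENNReal.ofReal ((f 0 x)^2) ∂μ) := by
  set X : ℕ → ℝ≥0∞ := fun i => ∫⁻ x, ENNReal.ofReal (‖b i (x + v i) - b i x‖^2 * (f (i+1) x)^2) ∂μ with hX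
  set Y : ℕ → ℝ≥0∞ := fun i => ∫⁻ x, ENNReal.ofReal (‖b i x‖^2 * (f i x)^2) ∂μ with hY
  set D : ℕ → ℝ≥0∞ := fun i => ∫⁻ x, ENNReal.ofReal ((f i (x + v i) - f i x)^2) ∂μ with hD
  have step : ∀ i, X i + 8 * Y (i+1) ≤ 8 * Y i + 16 * ENNReal.ofReal (L^2) * D i := by
    intro i
    have := hf i
    have := hf (i+1)
    have := hb i
    have := hb (i+1)
    simp only [hX, hY, hD]
    rw [← lint_half μ (fun x => ‖b i x‖^2 * (f i x)^2) (by fun_prop) (fun x => by positivity) (v i),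
      ← lintegral_const_mul _ (by fun_prop), ← lintegral_const_mul _ (by fun_prop),
      ← lintegral_const_mul _ (by fun_prop),
      ← lintegral_add_left (by fun_prop), ← lintegral_add_left (by fun_prop)]
    refine lintegral_mono fun x => ?_
    rw [show (8:ℝ≥0∞) = ENNReal.ofReal 8 by simp, show (16:ℝ≥0∞) = ENNReal.ofReal 16 by simp,
      ← ENNReal.ofReal_mul (by norm_num), ← ENNReal.ofReal_mul (by norm_num),
      ← ENNReal.ofReal_mul (by norm_num), ← ENNReal.ofReal_mul (by positivity),
      ← ENNReal.ofReal_add (by positivity) (by positivity),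
      ← ENNReal.ofReal_add (by positivity) (by positivity), hrec, hbrec]
    apply ENNReal.ofReal_le_ofReal
    have := para_pt L (f i x) (f i (x + v i)) (b i x) (b i (x + v i)) hL (hbL _ _) (hbL _ _)
    nlinarith
  have key : ∑ i ∈ Finset.range I, X i + 8 * Y I
      ≤ 8 * Y 0 + 16 * ENNReal.ofReal (L^2) * ∑ i ∈ Finset.range I, D i := by
    induction I with
    | zero => simp
    | succ I ih =>
      rw [Finset.sum_range_succ, Finset.sum_range_succ, add_assoc]
      calc _ ≤ ∑ i ∈ Finset.range I, X i + (8 * Y I + 16 * ENNReal.ofReal (L^2) * D I) := by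
            exact add_le_add le_rfl (step I)
        _ = (∑ i ∈ Finset.range I, X i + 8 * Y I) + 16 * ENNReal.ofReal (L^2) * D I := by ring
        _ ≤ _ := by
          rw [mul_add, ← add_assoc]; gcongr
  have hY0 : Y 0 ≤ ENNReal.ofReal (L^2) * ∫⁻ x, ENNReal.ofReal ((f 0 x)^2) ∂μ := by
    have := hf 0
    rw [← lintegral_const_mul _ (by fun_prop)]
    refine lintegral_mono fun x => ?_
    rw [← ENNReal.ofReal_mul (by positivity)]
    apply ENNReal.ofReal_le_ofReal
    gcongr; exact hbL _ _
  have hDs := sum_d μ f v hf hrec I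
  calc ∑ i ∈ Finset.range I, X i ≤ _ := le_self_add
    _ ≤ _ := key
    _ ≤ 8 * (ENNReal.ofReal (L^2) * ∫⁻ x, ENNReal.ofReal ((f 0 x)^2) ∂μ) +
        16 * ENNReal.ofReal (L^2) * (4 * ∫⁻ x, ENNReal.ofReal ((f 0 x)^2) ∂μ) := by gcongr
    _ = _ := by ring
end para

lemma cs_vec {α V : Type*} [MeasurableSpace α] [NormedAddCommGroup V] [NormedSpace ℝ V]
    [MeasurableSpace V] [BorelSpace V] (μ : Measure α) (g : α → ℝ) (k : α → V)
    (hg : Measurable g) (hk : Measurable k) :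
    ENNReal.ofReal (‖∫ a, g a • k a ∂μ‖^2)
      ≤ (∫⁻ a, ENNReal.ofReal ((g a)^2) ∂μ) * (∫⁻ a, ENNReal.ofReal (‖k a‖^2) ∂μ) := by
  have h1 : ENNReal.ofReal (‖∫ a, g a • k a ∂μ‖) ≤ ∫⁻ a, ((fun a => ‖g a‖ₑ) * (fun a => ‖k a‖ₑ)) a ∂μ := by
    rw [ofReal_norm]
    refine (enorm_integral_le_lintegral_enorm _).trans (lintegral_mono fun a => ?_)
    simp [enorm_smul]
  have h2 := ENNReal.lintegral_mul_le_Lp_mul_Lq μ (p := 2) (q := 2)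
    (by constructor <;> norm_num) (f := fun a => ‖g a‖ₑ) (g := fun a => ‖k a‖ₑ)
    (by fun_prop) (by fun_prop)
  have h3 := h1.trans h2
  have e1 : ∀ a, ‖g a‖ₑ ^ (2:ℝ) = ENNReal.ofReal ((g a)^2) := by
    intro a
    rw [← ofReal_norm, ENNReal.ofReal_rpow_of_nonneg (norm_nonneg _) (by norm_num)]
    simp
  have e2 : ∀ a, ‖k a‖ₑ ^ (2:ℝ) = ENNReal.ofReal (‖k a‖^2) := by
    intro a
    rw [← ofReal_norm, ENNReal.ofReal_rpow_of_nonneg (norm_nonneg _) (by norm_num)]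
    simp
  simp_rw [e1, e2] at h3
  rw [ENNReal.ofReal_pow (norm_nonneg _)]
  calc _ ≤ _ := pow_le_pow_left' h3 2
    _ = _ := by
      rw [mul_pow, ← ENNReal.rpow_natCast, ← ENNReal.rpow_natCast, ← ENNReal.rpow_mul, ← ENNReal.rpow_mul]
      norm_num

section av
variable {E V : Type*} [NormedAddCommGroup E] [NormedSpace ℝ E] [MeasurableSpace E] [BorelSpace E]
  [SecondCountableTopology E]
  [NormedAddCommGroup V] [InnerProductSpace ℝ V] [MeasurableSpace V] [BorelSpace V]
  [SecondCountableTopology V] [CompleteSpace V]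

def av (f : E → ℝ) (w : E) (l : ℝ) (x : E) : ℝ := l⁻¹ * ∫ r in (0:ℝ)..l, f (x + r • w)

lemma bdd_ii {F : ℝ → V} (hF : Measurable F) {B : ℝ} (hB : ∀ r, ‖F r‖ ≤ B) (a b : ℝ) :
    IntervalIntegrable F volume a b := by
  refine (intervalIntegrable_const (c := B)).mono_fun hF.aestronglyMeasurable ?_
  filter_upwards with r
  exact (hB r).trans (le_abs_self B)

lemma meas_ii {X : Type*} [MeasurableSpace X] (F : X → ℝ → V) (hF : Measurable (Function.uncurry F)) (a b : ℝ) :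
    Measurable (fun x => ∫ r in a..b, F x r) := by
  unfold intervalIntegral
  have h : ∀ s : Set ℝ, Measurable (fun x => ∫ r in s, F x r) := fun s =>
    (hF.stronglyMeasurable.integral_prod_right (ν := volume.restrict s)).measurable
  exact (h _).sub (h _)

lemma meas_av {f : E → ℝ} (hf : Measurable f) (w : E) (l : ℝ) : Measurable (av f w l) := by
  unfold av
  apply Measurable.const_mul
  exact meas_ii _ (by simp only [Function.uncurry_def]; fun_prop) _ _

lemma av_double {f : E → ℝ} (hf : Measurable f) {M : ℝ} (hM : ∀ x, |f x| ≤ M) (w : E) (l : ℝ) (x : E) :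
    av f w (l*2) x = (av f w l x + av f w l (x + l • w)) / 2 := by
  unfold av
  have h1 : ∫ r in (0:ℝ)..(l*2), f (x + r • w)
      = (∫ r in (0:ℝ)..l, f (x + r • w)) + ∫ r in l..(l*2), f (x + r • w) := by
    rw [intervalIntegral.integral_add_adjacent_intervals] <;>
    exact bdd_ii (by fun_prop) (fun r => hM _) _ _
  have h2 : ∫ r in l..(l*2), f (x + r • w) = ∫ r in (0:ℝ)..l, f (x + l • w + r • w) := by
    have := intervalIntegral.integral_comp_add_right (a := 0) (b := l) (fun r => f (x + r • w)) l
    rw [zero_add, ← mul_two] at this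
    rw [← this]
    congr 1; ext r; congr 1; rw [add_smul]; abel
  rw [h1, h2, mul_inv]; ring

lemma av_neg (f : E → ℝ) (w : E) (l : ℝ) (x : E) :
    av f (-w) l x = av f w l (x - l • w) := by
  unfold av
  congr 1
  have := intervalIntegral.integral_comp_sub_left (a := 0) (b := l) (fun r => f (x - l • w + r • w)) l
  rw [sub_zero, sub_self] at this
  rw [← this]
  congr 1; ext r; congr 1; rw [sub_smul, smul_neg]; abel

lemma av_var {f : E → ℝ} (hf : Measurable f) {M : ℝ} (hM : ∀ x, |f x| ≤ M) (w : E) {l : ℝ} (hl : 0 < l) (x : E) :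
    ∫ r in (0:ℝ)..l, (f (x + r • w) - av f w l x)^2
      = (∫ r in (0:ℝ)..l, (f (x + r • w))^2) - l * (av f w l x)^2 := by
  have h0 : ∫ r in (0:ℝ)..l, f (x + r • w) = l * av f w l x := by unfold av; field_simp
  set c := av f w l x
  have hM2 : ∀ x, ‖f x ^ 2‖ ≤ M^2 := by
    intro x; rw [norm_pow]; exact pow_le_pow_left₀ (norm_nonneg _) (hM x) 2
  have i1 : IntervalIntegrable (fun r => (f (x + r • w))^2) volume 0 l :=
    bdd_ii (by fun_prop) (fun r => hM2 _) _ _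
  have i2 : IntervalIntegrable (fun r => f (x + r • w)) volume 0 l :=
    bdd_ii (by fun_prop) (fun r => hM _) _ _
  have : ∀ r : ℝ, (f (x + r • w) - c)^2 = (f (x + r • w))^2 - (2*c) * f (x + r • w) + c^2 := by intro r; ring
  simp_rw [this]
  rw [intervalIntegral.integral_add (i1.sub (i2.const_mul _)) (by simp),
    intervalIntegral.integral_sub i1 (i2.const_mul _), intervalIntegral.integral_const_mul, h0]
  simp; ring

def NN (f : E → ℝ) (w : E) (l0 : ℝ) : ℕ → E → ℝ≥0∞
  | 0, x => ENNReal.ofReal (l0⁻¹ * ∫ r in (0:ℝ)..l0, (f (x + r • w))^2)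
  | i+1, x => ENNReal.ofReal (3/8) * (NN f w l0 i x + NN f w l0 i (x + (l0*2^i) • w)) +
      ENNReal.ofReal ((av f w (l0*2^i) (x + (l0*2^i) • w) - av f w (l0*2^i) x)^2)

lemma meas_NN {f : E → ℝ} (hf : Measurable f) (w : E) (l0 : ℝ) (i : ℕ) : Measurable (NN f w l0 i) := by
  induction i with
  | zero =>
    show Measurable (fun x => ENNReal.ofReal (l0⁻¹ * ∫ r in (0:ℝ)..l0, (f (x + r • w))^2))
    have := meas_ii (fun x r => (f (x + r • w))^2) (by simp only [Function.uncurry_def]; fun_prop) 0 l0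
    fun_prop
  | succ i ih =>
    show Measurable (fun x => ENNReal.ofReal (3/8) * (NN f w l0 i x + NN f w l0 i (x + (l0*2^i) • w)) +
      ENNReal.ofReal ((av f w (l0*2^i) (x + (l0*2^i) • w) - av f w (l0*2^i) x)^2))
    have := meas_av hf w (l0*2^i)
    fun_prop

lemma ii_lint {F : ℝ → ℝ} (hF : Measurable F) {B : ℝ} (hB : ∀ r, |F r| ≤ B) (h0 : ∀ r, 0 ≤ F r) {l : ℝ} (hl : 0 ≤ l) :
    ENNReal.ofReal (∫ r in (0:ℝ)..l, F r) = ∫⁻ r in Ioc 0 l, ENNReal.ofReal (F r) := by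
  rw [intervalIntegral.integral_of_le hl, ofReal_integral_eq_lintegral_ofReal]
  · exact (bdd_ii hF hB 0 l).1
  · filter_upwards with r using h0 r

variable (μ : Measure E) [μ.IsAddRightInvariant] [SFinite μ]

lemma lint_NN0 {f : E → ℝ} (hf : Measurable f) {M : ℝ} (hM : ∀ x, |f x| ≤ M) (w : E) {l : ℝ} (hl : 0 < l) :
    ∫⁻ x, ENNReal.ofReal (l⁻¹ * ∫ r in (0:ℝ)..l, (f (x + r • w))^2) ∂μ
      = ∫⁻ x, ENNReal.ofReal ((f x)^2) ∂μ := by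
  have hM2 : ∀ x, |f x ^ 2| ≤ M^2 := by
    intro x; rw [abs_pow]; exact pow_le_pow_left₀ (abs_nonneg _) (hM x) 2
  have h1 : ∀ x, ENNReal.ofReal (l⁻¹ * ∫ r in (0:ℝ)..l, (f (x + r • w))^2)
      = ENNReal.ofReal l⁻¹ * ∫⁻ r in Ioc 0 l, ENNReal.ofReal ((f (x + r • w))^2) := by
    intro x
    rw [ENNReal.ofReal_mul (by positivity), ii_lint (by fun_prop) (fun r => hM2 _) (fun r => sq_nonneg _) hl.le]
  simp_rw [h1]
  rw [lintegral_const_mul _ (by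
    apply Measurable.lintegral_prod_right'
      (f := fun p : E × ℝ => ENNReal.ofReal ((f (p.1 + p.2 • w))^2)); fun_prop)]
  rw [lintegral_lintegral_swap (by simp only [Function.uncurry_def]; fun_prop)]
  have : ∀ r : ℝ, ∫⁻ x, ENNReal.ofReal ((f (x + r • w))^2) ∂μ = ∫⁻ x, ENNReal.ofReal ((f x)^2) ∂μ :=
    fun r => lintegral_add_right_eq_self (fun x => ENNReal.ofReal ((f x)^2)) _
  simp_rw [this]
  simp only [lintegral_const, Measure.restrict_apply, MeasurableSet.univ, univ_inter, Real.volume_Ioc, sub_zero]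
  rw [mul_comm, mul_assoc, ← ENNReal.ofReal_mul hl.le, mul_inv_cancel₀ hl.ne']; simp

lemma av_sq_le {f : E → ℝ} (hf : Measurable f) {M : ℝ} (hM : ∀ x, |f x| ≤ M) (w : E) {l : ℝ} (hl : 0 < l) (x : E) :
    (av f w l x)^2 ≤ l⁻¹ * ∫ r in (0:ℝ)..l, (f (x + r • w))^2 := by
  have h1 := av_var hf hM w hl x
  have h2 : 0 ≤ ∫ r in (0:ℝ)..l, (f (x + r • w) - av f w l x)^2 :=
    intervalIntegral.integral_nonneg hl.le (fun r _ => sq_nonneg _)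
  rw [inv_mul_eq_div, le_div_iff₀ hl]; linarith

lemma lint_av_le {f : E → ℝ} (hf : Measurable f) {M : ℝ} (hM : ∀ x, |f x| ≤ M) (w : E) {l : ℝ} (hl : 0 < l) :
    ∫⁻ x, ENNReal.ofReal ((av f w l x)^2) ∂μ ≤ ∫⁻ x, ENNReal.ofReal ((f x)^2) ∂μ := by
  rw [← lint_NN0 μ hf hM w hl]
  exact lintegral_mono fun x => ENNReal.ofReal_le_ofReal (av_sq_le hf hM w hl x)

lemma sum_dav {f : E → ℝ} (hf : Measurable f) {M : ℝ} (hM : ∀ x, |f x| ≤ M) (w : E) {l0 : ℝ} (hl : 0 < l0) (I : ℕ) :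
    ∑ i ∈ Finset.range I, ∫⁻ x, ENNReal.ofReal ((av f w (l0*2^i) (x + (l0*2^i) • w) - av f w (l0*2^i) x)^2) ∂μ
      ≤ 4 * ∫⁻ x, ENNReal.ofReal ((f x)^2) ∂μ := by
  refine (sum_d μ (fun i => av f w (l0*2^i)) (fun i => (l0*2^i) • w) (fun i => meas_av hf _ _) ?_ I).trans ?_
  · intro i x
    rw [pow_succ, ← mul_assoc]
    exact av_double hf hM w _ x
  · gcongr 4 * ?_
    exact lint_av_le μ hf hM w (by positivity)

lemma sum_NN {f : E → ℝ} (hf : Measurable f) {M : ℝ} (hM : ∀ x, |f x| ≤ M) (w : E) {l0 : ℝ} (hl : 0 < l0) (I : ℕ) :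
    ∑ i ∈ Finset.range I, ∫⁻ x, NN f w l0 i x ∂μ ≤ 20 * ∫⁻ x, ENNReal.ofReal ((f x)^2) ∂μ := by
  have h := geo_sum (fun i => ∫⁻ x, NN f w l0 i x ∂μ)
    (fun i => ∫⁻ x, ENNReal.ofReal ((av f w (l0*2^i) (x + (l0*2^i) • w) - av f w (l0*2^i) x)^2) ∂μ) ?_ I
  · refine (le_self_add.trans h).trans ?_
    have h0 : ∫⁻ x, NN f w l0 0 x ∂μ = ∫⁻ x, ENNReal.ofReal ((f x)^2) ∂μ := lint_NN0 μ hf hM w hl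
    rw [h0]
    calc _ ≤ 4 * ∫⁻ x, ENNReal.ofReal ((f x)^2) ∂μ + 4 * (4 * ∫⁻ x, ENNReal.ofReal ((f x)^2) ∂μ) := by
          gcongr; exact sum_dav μ hf hM w hl I
      _ = _ := by ring
  · intro i
    have hm := meas_NN hf w l0 i
    have := meas_av hf w (l0*2^i)
    simp only [NN]
    rw [lintegral_add_left (by fun_prop), lintegral_const_mul _ (by fun_prop), lintegral_add_left hm,
      lintegral_add_right_eq_self (fun x => NN f w l0 i x), ← two_mul, ← mul_assoc,
      show ENNReal.ofReal (3/8) * 2 = ENNReal.ofReal (3/4) by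
        rw [show (2:ℝ≥0∞) = ENNReal.ofReal 2 by simp, ← ENNReal.ofReal_mul (by norm_num)]; norm_num]

end av

section Rb
variable {E V : Type*} [NormedAddCommGroup E] [NormedSpace ℝ E] [MeasurableSpace E] [BorelSpace E]
  [SecondCountableTopology E]
  [NormedAddCommGroup V] [InnerProductSpace ℝ V] [MeasurableSpace V] [BorelSpace V]
  [SecondCountableTopology V] [CompleteSpace V]

/-- Cauchy-Schwarz plus Tonelli. -/
lemma cs_t (ν : Measure ℝ) [SFinite ν] (g : ℝ → ℝ) (hg : Measurable g) {B : ℝ} (hB : ∀ r, |g r| ≤ B)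
    (k : ℝ → ℝ → V) (hk : Measurable (Function.uncurry k)) {l K : ℝ} (hl : 0 ≤ l) (hK : 0 ≤ K)
    (hb : ∀ r ∈ Ioc 0 l, ∫⁻ t, ENNReal.ofReal (‖k r t‖^2) ∂ν ≤ ENNReal.ofReal K) :
    ∫⁻ t, ENNReal.ofReal (‖∫ r in (0:ℝ)..l, g r • k r t‖^2) ∂ν
      ≤ ENNReal.ofReal (l * K * ∫ r in (0:ℝ)..l, (g r)^2) := by
  have hM2 : ∀ x, |g x ^ 2| ≤ B^2 := by
    intro x; rw [abs_pow]; exact pow_le_pow_left₀ (abs_nonneg _) (hB x) 2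
  have h1 : ∀ t, ENNReal.ofReal (‖∫ r in (0:ℝ)..l, g r • k r t‖^2)
      ≤ ENNReal.ofReal (∫ r in (0:ℝ)..l, (g r)^2) * ∫⁻ r in Ioc 0 l, ENNReal.ofReal (‖k r t‖^2) := by
    intro t
    rw [ii_lint (by fun_prop) hM2 (fun r => sq_nonneg _) hl, intervalIntegral.integral_of_le hl]
    exact cs_vec _ g (fun r => k r t) hg (hk.comp (measurable_id.prodMk measurable_const))
  refine (lintegral_mono h1).trans ?_
  have hm : Measurable (fun p : ℝ × ℝ => ENNReal.ofReal (‖k p.2 p.1‖^2)) := by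
    have : Measurable (fun p : ℝ × ℝ => k p.2 p.1) := hk.comp measurable_swap
    fun_prop
  rw [lintegral_const_mul _ (Measurable.lintegral_prod_right' (f := fun p : ℝ × ℝ => ENNReal.ofReal (‖k p.2 p.1‖^2)) hm)]
  rw [lintegral_lintegral_swap hm.aemeasurable]
  calc _ ≤ ENNReal.ofReal (∫ r in (0:ℝ)..l, (g r)^2) * ∫⁻ r in Ioc 0 l, ENNReal.ofReal K := by
        gcongr 1
        apply setLIntegral_mono measurable_const
        intro r hr; exact hb r hr
    _ = _ := by
      rw [lintegral_const, Measure.restrict_apply MeasurableSet.univ, univ_inter, Real.volume_Ioc, sub_zero,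
        ← ENNReal.ofReal_mul hK, ← ENNReal.ofReal_mul
          (intervalIntegral.integral_nonneg hl (fun r _ => sq_nonneg _))]
      congr 1; ring

lemma three_sq {a b c : V} : ‖a + b + c‖^2 ≤ 3 * (‖a‖^2 + ‖b‖^2 + ‖c‖^2) := by
  have h := norm_add₃_le (a := a) (b := b) (c := c)
  have h2 : ‖a+b+c‖^2 ≤ (‖a‖+‖b‖+‖c‖)^2 := pow_le_pow_left₀ (norm_nonneg _) h 2
  nlinarith [sq_nonneg (‖a‖-‖b‖), sq_nonneg (‖b‖-‖c‖), sq_nonneg (‖a‖-‖c‖)]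

lemma R_bound {f : E → ℝ} (hf : Measurable f) {M : ℝ} (hM : ∀ x, |f x| ≤ M) (w : E) {l0 : ℝ} (hl0 : 0 < l0)
    (ν : Measure ℝ) [SFinite ν] {H B : ℝ} (hH : 0 ≤ H) (i : ℕ) :
    ∀ (k : ℝ → ℝ → V), Measurable (Function.uncurry k) → (∀ r t, ‖k r t‖ ≤ B) →
    (∀ r ∈ Icc 0 (l0*2^i), ∀ r' ∈ Icc 0 (l0*2^i),
      ∫⁻ t, ENNReal.ofReal (‖k r t - k r' t‖^2) ∂ν ≤ ENNReal.ofReal (H * |r - r'|)) → ∀ x,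
    ∫⁻ t, ENNReal.ofReal (‖∫ r in (0:ℝ)..(l0*2^i), (f (x + r • w) - av f w (l0*2^i) x) • k r t‖^2) ∂ν
      ≤ ENNReal.ofReal (H * (l0*2^i)^3) * NN f w l0 i x := by
  have hM0 : 0 ≤ M := (abs_nonneg _).trans (hM 0)
  have bd : ∀ (g : ℝ → ℝ) (k : ℝ → ℝ → V) (C : ℝ), (∀ r, |g r| ≤ C) → Measurable g →
      Measurable (Function.uncurry k) → (∀ r t, ‖k r t‖ ≤ B) → ∀ t a b,
      IntervalIntegrable (fun r => g r • k r t) volume a b := by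
    intro g k C hg hgm hk hB t a b
    have hk' : Measurable (fun r => k r t) := hk.comp (measurable_id.prodMk measurable_const)
    refine bdd_ii (hgm.smul hk') (B := C * B) (fun r => ?_) a b
    change ‖g r • k r t‖ ≤ C * B
    rw [norm_smul]
    exact mul_le_mul (hg r) (hB r t) (norm_nonneg _) ((abs_nonneg _).trans (hg r))
  induction i with
  | zero =>
    intro k hk hB hH' x
    simp only [pow_zero, mul_one] at hH' ⊢
    set c := av f w l0 x with hc
    have hg : Measurable (fun r : ℝ => f (x + r • w) - c) := by fun_prop
    have hgb : ∀ r : ℝ, |f (x + r • w) - c| ≤ M + |c| := fun r => (abs_sub _ _).trans (by gcongr; exact hM _)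
    have hk0 : Measurable (Function.uncurry (fun (_:ℝ) t => k 0 t)) :=
      hk.comp (measurable_const.prodMk measurable_snd)
    have e : ∀ t, ∫ r in (0:ℝ)..l0, (f (x + r • w) - c) • k r t
        = ∫ r in (0:ℝ)..l0, (f (x + r • w) - c) • (k r t - k 0 t) := by
      intro t
      simp_rw [smul_sub]
      rw [intervalIntegral.integral_sub (bd _ k _ hgb hg hk hB t _ _)
        (bd _ (fun _ t => k 0 t) _ hgb hg hk0 (fun r t => hB 0 t) t _ _),
        intervalIntegral.integral_smul_const]
      have : ∫ r in (0:ℝ)..l0, (f (x + r • w) - c) = 0 := by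
        rw [intervalIntegral.integral_sub (bdd_ii (by fun_prop) (fun r => hM _) _ _) (by simp)]
        simp [hc, av]; field_simp; simp
      rw [this]; simp
    simp_rw [e]
    refine (cs_t ν _ hg hgb (fun r t => k r t - k 0 t) (hk.sub hk0) hl0.le (K := H * l0) (by positivity) ?_).trans ?_
    · intro r hr
      refine (hH' r ⟨hr.1.le, hr.2⟩ 0 ⟨le_rfl, hl0.le⟩).trans (ENNReal.ofReal_le_ofReal ?_)
      rw [sub_zero, abs_of_pos hr.1]; gcongr; exact hr.2
    · simp only [NN]
      rw [← ENNReal.ofReal_mul (by positivity)]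
      apply ENNReal.ofReal_le_ofReal
      rw [av_var hf hM w hl0 x]
      have : H * l0 ^ 3 * (l0⁻¹ * ∫ r in (0:ℝ)..l0, f (x + r • w) ^ 2)
        = l0 * (H * l0) * ∫ r in (0:ℝ)..l0, f (x + r • w) ^ 2 := by field_simp
      rw [this]
      gcongr
      have : 0 ≤ l0 * av f w l0 x ^ 2 := by positivity
      linarith
  | succ i ih =>
    intro k hk hB hH' x
    set l := l0 * 2^i with hl
    have hlp : 0 < l := by positivity
    have hll : l0 * 2^(i+1) = l * 2 := by rw [hl]; ring
    rw [hll] at hH' ⊢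
    set k2 : ℝ → ℝ → V := fun r t => k (r + l) t with hk2
    have hk2m : Measurable (Function.uncurry k2) :=
      hk.comp ((measurable_fst.add_const l).prodMk measurable_snd)
    have ih1 := ih k hk hB (fun r hr r' hr' => hH' r ⟨hr.1, by linarith [hr.2]⟩ r' ⟨hr'.1, by linarith [hr'.2]⟩) x
    have ih2 := ih k2 hk2m (fun r t => hB _ _) (fun r hr r' hr' => by
      have := hH' (r + l) ⟨by linarith [hr.1], by linarith [hr.2]⟩ (r'+l) ⟨by linarith [hr'.1], by linarith [hr'.2]⟩
      rwa [add_sub_add_right_eq_sub] at this) (x + l • w)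
    set c := av f w (l*2) x with hc
    set c1 := av f w l x with hc1
    set c2 := av f w l (x + l • w) with hc2
    have hcc : c = (c1 + c2)/2 := av_double hf hM w l x
    have hgm : ∀ (x : E) (c : ℝ), Measurable (fun r : ℝ => f (x + r • w) - c) := by intro x c; fun_prop
    have hgb : ∀ (x : E) (c : ℝ) (r : ℝ), |f (x + r • w) - c| ≤ M + |c| :=
      fun x c r => (abs_sub _ _).trans (by gcongr; exact hM _)
    have hdm : Measurable (Function.uncurry (fun r t => k2 r t - k r t)) := hk2m.sub hk
    have e : ∀ t, ∫ r in (0:ℝ)..(l*2), (f (x + r • w) - c) • k r t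
        = (∫ r in (0:ℝ)..l, (f (x + r • w) - c1) • k r t)
        + (∫ r in (0:ℝ)..l, (f (x + l • w + r • w) - c2) • k2 r t)
        + ∫ r in (0:ℝ)..l, ((c2 - c1)/2) • (k2 r t - k r t) := by
      intro t
      rw [← intervalIntegral.integral_add_adjacent_intervals
        (bd _ k _ (hgb x c) (hgm x c) hk hB t 0 l) (bd _ k _ (hgb x c) (hgm x c) hk hB t l (l*2))]
      have s1 : ∫ r in l..(l*2), (f (x + r • w) - c) • k r t
          = ∫ r in (0:ℝ)..l, (f (x + l • w + r • w) - c) • k2 r t := by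
        have := intervalIntegral.integral_comp_add_right (a := 0) (b := l) (fun r => (f (x + r • w) - c) • k r t) l
        rw [zero_add, ← mul_two] at this
        rw [← this]
        congr 1; ext r; simp only [hk2]; congr 3; rw [add_smul]; abel
      have i0 := fun t => bd _ k _ (hgb x c) (hgm x c) hk hB t 0 l
      have i1 := fun t => bd _ k _ (hgb x c1) (hgm x c1) hk hB t 0 l
      have i2 := fun t => bd _ k2 _ (hgb (x + l • w) c) (hgm _ c) hk2m (fun r t => hB _ _) t 0 l
      have i3 := fun t => bd _ k2 _ (hgb (x + l • w) c2) (hgm _ c2) hk2m (fun r t => hB _ _) t 0 l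
      have i4 := bd (fun _ => (c2-c1)/2) k _ (fun _ => le_rfl) measurable_const hk hB t 0 l
      have i5 := bd (fun _ => (c2-c1)/2) k2 _ (fun _ => le_rfl) measurable_const hk2m (fun r t => hB _ _) t 0 l
      rw [s1, ← intervalIntegral.integral_add (i0 t) (i2 t), ← intervalIntegral.integral_add (i1 t) (i3 t),
        ← intervalIntegral.integral_add ((i1 t).add (i3 t)) (by simp_rw [smul_sub]; exact i5.sub i4)]
      congr 1; ext r
      rw [hcc]; module
    have hmeas : ∀ (g : ℝ → ℝ) (k : ℝ → ℝ → V), Measurable g → Measurable (Function.uncurry k) →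
        Measurable (fun t => ENNReal.ofReal (‖∫ r in (0:ℝ)..l, g r • k r t‖^2)) := by
      intro g k hg hk
      have : Measurable (fun t => ∫ r in (0:ℝ)..l, g r • k r t) := by
        apply meas_ii (fun t r => g r • k r t)
        exact (hg.comp measurable_snd).smul (hk.comp measurable_swap)
      fun_prop
    have hc3 := cs_t ν (fun _ => (c2-c1)/2) measurable_const (fun _ => le_rfl) (fun r t => k2 r t - k r t) hdm
      hlp.le (K := H * l) (by positivity) (fun r hr => by
        have := hH' (r + l) ⟨by linarith [hr.1], by linarith [hr.2]⟩ r ⟨by linarith [hr.1], by linarith [hr.2]⟩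
        rwa [add_sub_cancel_left, abs_of_pos hlp] at this)
    simp_rw [e]
    have h8 : ENNReal.ofReal (H * (l*2)^3) = ENNReal.ofReal 8 * ENNReal.ofReal (H * l^3) := by
      rw [← ENNReal.ofReal_mul (by norm_num)]; congr 1; ring
    have h3 : ENNReal.ofReal 8 * ENNReal.ofReal (3/8) = 3 := by
      rw [← ENNReal.ofReal_mul (by norm_num)]; norm_num
    calc _ ≤ ∫⁻ t, 3 * (ENNReal.ofReal (‖∫ r in (0:ℝ)..l, (f (x + r • w) - c1) • k r t‖^2)
        + ENNReal.ofReal (‖∫ r in (0:ℝ)..l, (f (x + l • w + r • w) - c2) • k2 r t‖^2)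
        + ENNReal.ofReal (‖∫ r in (0:ℝ)..l, ((c2 - c1)/2) • (k2 r t - k r t)‖^2)) ∂ν := by
          refine lintegral_mono fun t => ?_
          rw [← ENNReal.ofReal_add (by positivity) (by positivity), ← ENNReal.ofReal_add (by positivity) (by positivity),
            show (3:ℝ≥0∞) = ENNReal.ofReal 3 by simp, ← ENNReal.ofReal_mul (by norm_num)]
          exact ENNReal.ofReal_le_ofReal three_sq
      _ = 3 * (∫⁻ t, ENNReal.ofReal (‖∫ r in (0:ℝ)..l, (f (x + r • w) - c1) • k r t‖^2) ∂ν
        + ∫⁻ t, ENNReal.ofReal (‖∫ r in (0:ℝ)..l, (f (x + l • w + r • w) - c2) • k2 r t‖^2) ∂ν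
        + ∫⁻ t, ENNReal.ofReal (‖∫ r in (0:ℝ)..l, ((c2 - c1)/2) • (k2 r t - k r t)‖^2) ∂ν) := by
          have m1 := hmeas _ _ (hgm x c1) hk
          have m2 := hmeas _ _ (hgm (x + l • w) c2) hk2m
          have m3 := hmeas (fun _ => (c2-c1)/2) _ measurable_const hdm
          rw [lintegral_const_mul _ ((m1.fun_add m2).fun_add m3), lintegral_add_left (m1.fun_add m2), lintegral_add_left m1]
      _ ≤ 3 * (ENNReal.ofReal (H * l^3) * NN f w l0 i x + ENNReal.ofReal (H * l^3) * NN f w l0 i (x + l • w)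
          + ENNReal.ofReal (H * l^3) * ENNReal.ofReal ((c2-c1)^2)) := by
          gcongr
          refine hc3.trans ?_
          rw [← ENNReal.ofReal_mul (by positivity)]
          apply ENNReal.ofReal_le_ofReal
          simp
          have : 0 ≤ H * l^3 * (c2-c1)^2 := by positivity
          nlinarith
      _ = ENNReal.ofReal (H * (l*2)^3) * (ENNReal.ofReal (3/8) * (NN f w l0 i x + NN f w l0 i (x + l • w)))
          + 3 * (ENNReal.ofReal (H * l^3) * ENNReal.ofReal ((c2-c1)^2)) := by
          rw [h8, ← h3]; ring
      _ ≤ ENNReal.ofReal (H * (l*2)^3) * (ENNReal.ofReal (3/8) * (NN f w l0 i x + NN f w l0 i (x + l • w)))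
          + ENNReal.ofReal (H * (l*2)^3) * ENNReal.ofReal ((c2-c1)^2) := by
          refine add_le_add le_rfl ?_
          rw [h8, mul_assoc (ENNReal.ofReal 8)]
          refine mul_le_mul_left ?_ _
          simp; norm_num
      _ = _ := by
          rw [← mul_add]; rfl
end Rb

section Ker
variable {V : Type*} [NormedAddCommGroup V] [InnerProductSpace ℝ V] [MeasurableSpace V] [BorelSpace V]
  [SecondCountableTopology V] [CompleteSpace V]

/-- The smooth part of the kernel. -/
def Gk (k : ℕ) (r : ℝ) (D : V) (m : ℝ) : V := (r^k / m^(k+2)) • D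

lemma Gk_zero (r : ℝ) (D : V) (m : ℝ) : Gk 0 r D m = (m^2)⁻¹ • D := by simp [Gk]

lemma Gk_succ (k : ℕ) (r : ℝ) (D : V) (m : ℝ) : Gk (k+1) r D m = (r/m) • Gk k r D m := by
  unfold Gk; rw [smul_smul]; congr 1
  rw [div_mul_div_comm]; ring_nf

lemma Gk_neg (k : ℕ) (r : ℝ) (D : V) (m : ℝ) : Gk k r (-D) m = - Gk k r D m := by
  simp [Gk]

lemma Gk_norm (k : ℕ) {r m c μ : ℝ} {D : V} (hr : |r| ≤ m) (hD : ‖D‖ ≤ c * m) (hc : 0 ≤ c) (hμ : 0 < μ)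
    (hm : μ ≤ m) : ‖Gk k r D m‖ ≤ c / μ := by
  have hm0 : 0 < m := hμ.trans_le hm
  have h0 : ‖Gk k r D m‖ ≤ c / m := by
    induction k with
    | zero =>
      rw [Gk_zero, norm_smul, norm_inv, norm_pow, Real.norm_of_nonneg hm0.le, inv_mul_le_iff₀ (by positivity)]
      calc ‖D‖ ≤ c * m := hD
        _ = _ := by field_simp
    | succ k ih =>
      rw [Gk_succ, norm_smul]
      have : ‖r/m‖ ≤ 1 := by
        rw [norm_div, Real.norm_of_nonneg hm0.le, Real.norm_eq_abs, div_le_one hm0]; exact hr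
      calc _ ≤ 1 * (c/m) := by gcongr
        _ = _ := one_mul _
  exact h0.trans (by gcongr)

lemma Glip (k : ℕ) {r r' m m' c μ : ℝ} {D D' : V} (hr : |r| ≤ m) (hr' : |r'| ≤ m') (hD : ‖D‖ ≤ c * m)
    (hD' : ‖D'‖ ≤ c * m') (hc : 0 ≤ c) (hμ : 0 < μ) (hm : μ ≤ m) (hm' : μ ≤ m') :
    ‖Gk k r D m - Gk k r' D' m'‖ ≤ (‖D - D'‖ + c * (k * |r-r'| + (k+2) * |m-m'|)) / μ^2 := by
  have hm0 : 0 < m := hμ.trans_le hm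
  have hm0' : 0 < m' := hμ.trans_le hm'
  induction k with
  | zero =>
    rw [Gk_zero, Gk_zero]
    have e : (m^2)⁻¹ • D - (m'^2)⁻¹ • D' = (m^2)⁻¹ • (D - D') + ((m^2)⁻¹ - (m'^2)⁻¹) • D' := by module
    rw [e]
    have h1 : ‖(m^2)⁻¹ • (D - D')‖ ≤ ‖D - D'‖ / μ^2 := by
      rw [norm_smul, norm_inv, norm_pow, Real.norm_of_nonneg hm0.le, inv_mul_eq_div]; gcongr
    have h2 : ‖((m^2)⁻¹ - (m'^2)⁻¹) • D'‖ ≤ c * (2 * |m - m'|) / μ^2 := by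
      have e2 : (m^2)⁻¹ - (m'^2)⁻¹ = (m' - m) * (1/(m^2*m') + 1/(m*m'^2)) := by field_simp; ring
      rw [norm_smul, e2, norm_mul, Real.norm_eq_abs, abs_sub_comm, Real.norm_of_nonneg (by positivity)]
      calc |m-m'| * (1/(m^2*m') + 1/(m*m'^2)) * ‖D'‖ ≤ |m-m'| * (1/(m^2*m') + 1/(m*m'^2)) * (c * m') := by gcongr
        _ = c * |m-m'| * (1/m^2 + 1/(m*m')) := by field_simp
        _ ≤ c * |m-m'| * (1/μ^2 + 1/(μ*μ)) := by gcongr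
        _ = _ := by field_simp; ring
    calc _ ≤ _ := norm_add_le_of_le h1 h2
      _ = _ := by push_cast; ring
  | succ k ih =>
    rw [Gk_succ, Gk_succ]
    have e : (r/m) • Gk k r D m - (r'/m') • Gk k r' D' m'
      = (r/m) • (Gk k r D m - Gk k r' D' m') + (r/m - r'/m') • Gk k r' D' m' := by module
    rw [e]
    have hu : ‖r/m‖ ≤ 1 := by
        rw [norm_div, Real.norm_of_nonneg hm0.le, Real.norm_eq_abs, div_le_one hm0]; exact hr
    have hg := Gk_norm k hr' hD' hc hμ hm'
    have hd : ‖r/m - r'/m'‖ ≤ (|r-r'| + |m-m'|)/μ := by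
      have e2 : r/m - r'/m' = (r-r')/m + (m'-m) * (r'/m') / m := by field_simp; ring
      have hu' : |r'/m'| ≤ 1 := by
        rw [abs_div, abs_of_pos hm0', div_le_one hm0']; exact hr'
      rw [e2, Real.norm_eq_abs]
      calc _ ≤ |(r-r')/m| + |(m'-m) * (r'/m') / m| := abs_add_le _ _
        _ = |r-r'|/m + |m-m'| * |r'/m'| / m := by
          rw [abs_div, abs_div, abs_mul, abs_of_pos hm0, abs_sub_comm m' m]
        _ ≤ |r-r'|/μ + |m-m'| * 1 / μ := by gcongr
        _ = _ := by ring
    calc _ ≤ ‖r/m‖ * ‖Gk k r D m - Gk k r' D' m'‖ + ‖r/m - r'/m'‖ * ‖Gk k r' D' m'‖ := by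
          refine (norm_add_le _ _).trans ?_; rw [norm_smul, norm_smul]
      _ ≤ 1 * ((‖D - D'‖ + c * (k * |r-r'| + (k+2) * |m-m'|)) / μ^2) + (|r-r'| + |m-m'|)/μ * (c/μ) := by
          gcongr
      _ = _ := by push_cast; field_simp; ring

/-- Length of the displacement. -/
def rho (r : ℝ) (D : V) : ℝ := √(r^2 + ‖D‖^2)

lemma rho_r (r : ℝ) (D : V) : |r| ≤ rho r D := by
  rw [rho, ← Real.sqrt_sq_eq_abs]; apply Real.sqrt_le_sqrt; nlinarith [sq_nonneg ‖D‖]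
lemma rho_D (r : ℝ) (D : V) : ‖D‖ ≤ rho r D := by
  apply Real.le_sqrt_of_sq_le; nlinarith [sq_nonneg r]
lemma rho_lip (r r' : ℝ) (D D' : V) : |rho r D - rho r' D'| ≤ |r - r'| + ‖D - D'‖ := by
  have e : ∀ (r : ℝ) (D : V), rho r D = ‖WithLp.toLp 2 (r, D)‖ := by
    intro r D; rw [WithLp.prod_norm_eq_of_L2]; simp [rho]
  rw [e, e]
  refine (abs_norm_sub_norm_le _ _).trans ?_
  rw [WithLp.prod_norm_eq_of_L2]
  simp only [WithLp.sub_fst, WithLp.sub_snd, WithLp.toLp_fst, WithLp.toLp_snd]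
  rw [Real.sqrt_le_left (by positivity), Real.norm_eq_abs]
  nlinarith [mul_nonneg (abs_nonneg (r-r')) (norm_nonneg (D-D'))]
lemma meas_rho {X : Type*} [MeasurableSpace X] {r : X → ℝ} {D : X → V} (hr : Measurable r) (hD : Measurable D) :
    Measurable (fun x => rho (r x) (D x)) := by unfold rho; fun_prop

/-- The truncated kernel. -/
def kap (k : ℕ) (l : ℝ) (D : V) (r t : ℝ) : V :=
  open Classical in if t < rho r D ∧ rho r D ≤ 2*t then Gk k r D (max (rho r D) (l/4)) else 0

lemma kap_eq (k : ℕ) {l : ℝ} (D : V) (r : ℝ) {t : ℝ} (ht : l/4 ≤ t) :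
    kap k l D r t = open Classical in if t < rho r D ∧ rho r D ≤ 2*t then Gk k r D (rho r D) else 0 := by
  unfold kap
  split_ifs with h
  · rw [max_eq_left]; linarith [h.1]
  · rfl

lemma kap_neg (k : ℕ) (l : ℝ) (D : V) (r t : ℝ) : kap k l (-D) r t = - kap k l D r t := by
  unfold kap rho; rw [norm_neg, Gk_neg]; split_ifs <;> simp

lemma kap_norm (k : ℕ) {l : ℝ} (hl : 0 < l) {c : ℝ} (hc : 0 ≤ c) {D : V} {r : ℝ} (hD : ‖D‖ ≤ c * rho r D) (t : ℝ) :
    ‖kap k l D r t‖ ≤ c * (4 / l) := by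
  unfold kap
  split_ifs with h
  · refine (Gk_norm k ((rho_r r D).trans (le_max_left _ _)) (c := c) (μ := l/4)
      (hD.trans ?_) hc (by positivity) (le_max_right _ _)).trans (le_of_eq (by field_simp))
    gcongr; exact le_max_left _ _
  · simp; positivity

lemma meas_kap {X : Type*} [MeasurableSpace X] (k : ℕ) (l : ℝ) {D : X → V} {r t : X → ℝ} (hD : Measurable D)
    (hr : Measurable r) (ht : Measurable t) : Measurable (fun x => kap k l (D x) (r x) (t x)) := by
  have h := meas_rho hr hD
  unfold kap
  refine Measurable.ite ?_ ?_ measurable_const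
  · exact (measurableSet_lt ht h).inter (measurableSet_le h (by fun_prop))
  · unfold Gk; fun_prop

open Classical in
/-- indicator of the mismatch zone -/
def mis (q e t : ℝ) : ℝ := if |t - q| ≤ e then 1 else 0

lemma mis_nonneg (q e t : ℝ) : 0 ≤ mis q e t := by unfold mis; split_ifs <;> norm_num
lemma mis_sq (q e t : ℝ) : (mis q e t)^2 = mis q e t := by unfold mis; split_ifs <;> norm_num
lemma mis_one {q e t : ℝ} (h : |t - q| ≤ e) : mis q e t = 1 := by unfold mis; rw [if_pos h]
lemma mis_le (q e t : ℝ) : mis q e t ≤ 1 := by unfold mis; split_ifs <;> norm_num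
lemma meas_mis {X : Type*} [MeasurableSpace X] {q e t : X → ℝ} (hq : Measurable q) (he : Measurable e)
    (ht : Measurable t) : Measurable (fun x => mis (q x) (e x) (t x)) := by
  unfold mis
  refine Measurable.ite (measurableSet_le ?_ he) measurable_const measurable_const
  exact (continuous_abs.measurable).comp (ht.sub hq)

lemma lint_mis (q : ℝ) {e : ℝ} (he : 0 ≤ e) : ∫⁻ t, ENNReal.ofReal (mis q e t) = ENNReal.ofReal (2*e) := by
  have : ∀ t, ENNReal.ofReal (mis q e t) = (Icc (q-e) (q+e)).indicator (fun _ => 1) t := by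
    intro t; unfold mis indicator
    have : |t - q| ≤ e ↔ t ∈ Icc (q-e) (q+e) := by
      rw [abs_le, mem_Icc]; constructor <;> intro h <;> constructor <;> linarith [h.1, h.2]
    by_cases h : |t - q| ≤ e
    · rw [if_pos h, if_pos (this.1 h)]; simp
    · rw [if_neg h, if_neg (fun h' => h (this.2 h'))]; simp
  simp_rw [this]
  rw [lintegral_indicator measurableSet_Icc]
  rw [setLIntegral_one, Real.volume_Icc]
  congr 1; ring

lemma lint_mis2 (q : ℝ) {e : ℝ} (he : 0 ≤ e) : ∫⁻ t, ENNReal.ofReal (mis q e (2*t)) = ENNReal.ofReal e := by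
  have : ∀ t, mis q e (2*t) = mis (q/2) (e/2) t := by
    intro t; unfold mis
    have : |2*t - q| ≤ e ↔ |t - q/2| ≤ e/2 := by
      rw [abs_le, abs_le]; constructor <;> intro h <;> constructor <;> linarith [h.1, h.2]
    simp only [this]
  simp_rw [this]
  rw [lint_mis _ (by positivity)]; congr 1; ring

lemma kap_diff (k : ℕ) (l : ℝ) {D D' : V} {r r' t e b : ℝ} (he : |rho r D - rho r' D'| ≤ e)
    (h1 : ‖kap k l D r t‖ ≤ b) (h2 : ‖kap k l D' r' t‖ ≤ b) :
    ‖kap k l D r t - kap k l D' r' t‖ ≤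
      ‖Gk k r D (max (rho r D) (l/4)) - Gk k r' D' (max (rho r' D') (l/4))‖
      + b * (mis (rho r' D') e t + mis (rho r' D') e (2*t)) := by
  have hb : 0 ≤ b := (norm_nonneg _).trans h1
  have n1 := mis_nonneg (rho r' D') e t
  have n2 := mis_nonneg (rho r' D') e (2*t)
  have h := abs_le.1 he
  have key : ¬ ((t < rho r D ∧ rho r D ≤ 2*t) ↔ (t < rho r' D' ∧ rho r' D' ≤ 2*t)) →
      1 ≤ mis (rho r' D') e t + mis (rho r' D') e (2*t) := by
    intro hn
    by_cases q1 : |t - rho r' D'| ≤ e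
    · rw [mis_one q1]; linarith
    by_cases q2 : |2*t - rho r' D'| ≤ e
    · rw [mis_one q2]; linarith
    exfalso; apply hn
    rw [abs_le, not_and_or, not_le, not_le] at q1 q2
    constructor
    · rintro ⟨a1, a2⟩
      constructor
      · rcases q1 with q | q <;> linarith
      · rcases q2 with q | q <;> linarith
    · rintro ⟨a1, a2⟩
      constructor
      · rcases q1 with q | q <;> linarith
      · rcases q2 with q | q <;> linarith
  by_cases q : (t < rho r D ∧ rho r D ≤ 2*t) ↔ (t < rho r' D' ∧ rho r' D' ≤ 2*t)
  · have : ‖kap k l D r t - kap k l D' r' t‖ ≤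
      ‖Gk k r D (max (rho r D) (l/4)) - Gk k r' D' (max (rho r' D') (l/4))‖ := by
      unfold kap
      simp only [q]
      split_ifs <;> simp
    nlinarith [mul_nonneg hb (add_nonneg n1 n2)]
  · have hk := key q
    have : ‖kap k l D r t - kap k l D' r' t‖ ≤ b := by
      by_cases p : (t < rho r D ∧ rho r D ≤ 2*t)
      · have p' : ¬ (t < rho r' D' ∧ rho r' D' ≤ 2*t) := fun p' => q ⟨fun _ => p', fun _ => p⟩
        have : kap k l D' r' t = 0 := by unfold kap; rw [if_neg p']
        rw [this, sub_zero]; exact h1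
      · have : kap k l D r t = 0 := by unfold kap; rw [if_neg p]
        rw [this, zero_sub, norm_neg]; exact h2
    have := norm_nonneg (Gk k r D (max (rho r D) (l/4)) - Gk k r' D' (max (rho r' D') (l/4)))
    nlinarith

/-- Hölder bound for the kernel. -/
lemma K1 (k : ℕ) {l L : ℝ} (hl : 0 < l) (hL : 0 ≤ L) (D : ℝ → V) (hD0 : D 0 = 0)
    (hD : ∀ r r', ‖D r - D r'‖ ≤ L * |r - r'|) {r r' : ℝ} (hr : r ∈ Icc 0 l) (hr' : r' ∈ Icc 0 l) :
    ∫⁻ t in Ioc (l/4) (l/2), ENNReal.ofReal (‖kap k l (D r) r t - kap k l (D r') r' t‖^2)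
      ≤ ENNReal.ofReal ((128*(3*k+5)^2 + 384) * L^2 / l^2 * |r - r'|) := by
  set c := min 1 L with hc
  have hc0 : 0 ≤ c := le_min zero_le_one hL
  have hcL : c ≤ L := min_le_right _ _
  have hcL' : c * (1 + L) ≤ 2 * L := by
    have : c ≤ 1 := min_le_left _ _
    nlinarith
  set δ := |r - r'| with hδ
  have hδ0 : 0 ≤ δ := abs_nonneg _
  have hδl : δ ≤ l := by rw [hδ, abs_le]; constructor <;> linarith [hr.1, hr.2, hr'.1, hr'.2]
  have hDc : ∀ r, ‖D r‖ ≤ c * rho r (D r) := by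
    intro r
    have h2 : ‖D r‖ ≤ L * rho r (D r) := by
      have := hD r 0
      rw [hD0, sub_zero, sub_zero] at this
      exact this.trans (by gcongr; exact rho_r _ _)
    have h1 := rho_D r (D r)
    rcases le_total 1 L with q | q
    · rw [hc, min_eq_left q]; linarith
    · rw [hc, min_eq_right q]; exact h2
  have hDm : ∀ r, ‖D r‖ ≤ c * max (rho r (D r)) (l/4) := fun r =>
    (hDc r).trans (by gcongr; exact le_max_left _ _)
  set Δ := |rho r (D r) - rho r' (D r')| with hΔ
  have hΔ1 : Δ ≤ (1+L)*δ := (rho_lip _ _ _ _).trans (by have := hD r r'; linarith)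
  have hG : ‖Gk k r (D r) (max (rho r (D r)) (l/4)) - Gk k r' (D r') (max (rho r' (D r')) (l/4))‖
      ≤ 16*(3*k+5)*L*δ/l^2 := by
    refine (Glip k (c := c) (μ := l/4) ((rho_r _ _).trans (le_max_left _ _)) ((rho_r _ _).trans (le_max_left _ _))
      (hDm r) (hDm r') hc0 (by positivity) (le_max_right _ _) (le_max_right _ _)).trans ?_
    have hm : |max (rho r (D r)) (l/4) - max (rho r' (D r')) (l/4)| ≤ (1+L)*δ :=
      (abs_max_sub_max_le_abs _ _ _).trans hΔ1
    calc _ ≤ (L*δ + (L * (k*δ) + (c*(1+L)) * ((k+2)*δ)))/(l/4)^2 := by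
          gcongr
          · exact hD r r'
          · rw [mul_add]
            have : c * ((k+2) * |max (rho r (D r)) (l/4) - max (rho r' (D r')) (l/4)|)
              ≤ c * ((k+2) * ((1+L)*δ)) := by gcongr
            have h3 : c * (k * δ) ≤ L * (k*δ) := by gcongr
            rw [← hδ]
            linarith
      _ ≤ (L*δ + (L * (k*δ) + (2*L) * ((k+2)*δ)))/(l/4)^2 := by gcongr
      _ = _ := by field_simp; ring
  have hpt : ∀ t, ENNReal.ofReal (‖kap k l (D r) r t - kap k l (D r') r' t‖^2)
      ≤ ENNReal.ofReal (2*(16*(3*k+5)*L*δ/l^2)^2) + ENNReal.ofReal (4*(c*(4/l))^2) *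
        (ENNReal.ofReal (mis (rho r' (D r')) Δ t) + ENNReal.ofReal (mis (rho r' (D r')) Δ (2*t))) := by
    intro t
    have h := kap_diff k l (t := t) (le_of_eq hΔ.symm) (kap_norm k hl hc0 (hDc r) t) (kap_norm k hl hc0 (hDc r') t)
    have m1 := mis_sq (rho r' (D r')) Δ t
    have m2 := mis_sq (rho r' (D r')) Δ (2*t)
    have m1' := mis_nonneg (rho r' (D r')) Δ t
    have m2' := mis_nonneg (rho r' (D r')) Δ (2*t)
    set x1 := mis (rho r' (D r')) Δ t
    set x2 := mis (rho r' (D r')) Δ (2*t)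
    rw [← ENNReal.ofReal_add m1' m2', ← ENNReal.ofReal_mul (by positivity), ← ENNReal.ofReal_add (by positivity) (by positivity)]
    apply ENNReal.ofReal_le_ofReal
    set b := c*(4/l)
    set G := 16*(3*k+5)*L*δ/l^2
    have h' : ‖kap k l (D r) r t - kap k l (D r') r' t‖ ≤ G + b*(x1+x2) := h.trans (by gcongr)
    have h2 := pow_le_pow_left₀ (norm_nonneg _) h' 2
    have h3 : (x1+x2)^2 ≤ 2*(x1+x2) := by nlinarith [sq_nonneg (x1-x2)]
    have h4 : b^2*(x1+x2)^2 ≤ b^2*(2*(x1+x2)) := by gcongr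
    nlinarith [sq_nonneg (G - b*(x1+x2))]
  have hm1 : Measurable (fun t => ENNReal.ofReal (mis (rho r' (D r')) Δ t)) :=
    (meas_mis measurable_const measurable_const measurable_id).ennreal_ofReal
  have hm2 : Measurable (fun t => ENNReal.ofReal (mis (rho r' (D r')) Δ (2*t))) :=
    (meas_mis measurable_const measurable_const (by fun_prop)).ennreal_ofReal
  have hΔ0 : 0 ≤ Δ := abs_nonneg _
  calc _ ≤ _ := lintegral_mono hpt
    _ = ENNReal.ofReal (2*(16*(3*k+5)*L*δ/l^2)^2) * ENNReal.ofReal (l/2 - l/4) + ENNReal.ofReal (4*(c*(4/l))^2) *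
        ((∫⁻ t in Ioc (l/4) (l/2), ENNReal.ofReal (mis (rho r' (D r')) Δ t))
        + ∫⁻ t in Ioc (l/4) (l/2), ENNReal.ofReal (mis (rho r' (D r')) Δ (2*t))) := by
      rw [lintegral_add_left measurable_const, lintegral_const, Measure.restrict_apply MeasurableSet.univ, univ_inter,
        Real.volume_Ioc, lintegral_const_mul _ (hm1.fun_add hm2), lintegral_add_left hm1]
    _ ≤ ENNReal.ofReal (2*(16*(3*k+5)*L*δ/l^2)^2) * ENNReal.ofReal (l/2 - l/4) + ENNReal.ofReal (4*(c*(4/l))^2) *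
        (ENNReal.ofReal (2*Δ) + ENNReal.ofReal Δ) := by
      gcongr
      · exact (setLIntegral_le_lintegral _ _).trans (lint_mis _ hΔ0).le
      · exact (setLIntegral_le_lintegral _ _).trans (lint_mis2 _ hΔ0).le
    _ = ENNReal.ofReal (2*(16*(3*k+5)*L*δ/l^2)^2 * (l/2 - l/4) + 4*(c*(4/l))^2 * (2*Δ + Δ)) := by
      rw [← ENNReal.ofReal_mul (by positivity), ← ENNReal.ofReal_add (by positivity) hΔ0,
        ← ENNReal.ofReal_mul (by positivity), ← ENNReal.ofReal_add]
      · have : 0 ≤ l/2 - l/4 := by linarith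
        positivity
      · positivity
    _ ≤ _ := by
      apply ENNReal.ofReal_le_ofReal
      have e1 : 2*(16*(3*k+5)*L*δ/l^2)^2 * (l/2 - l/4) = (128*(3*k+5)^2*L^2/l^2 * δ) * (δ/l) := by field_simp; ring
      have e2 : (128*(3*(k:ℝ)+5)^2*L^2/l^2 * δ) * (δ/l) ≤ (128*(3*k+5)^2*L^2/l^2 * δ) * 1 := by
        gcongr; rw [div_le_one hl]; exact hδl
      have e3 : 4*(c*(4/l))^2 * (2*Δ + Δ) ≤ 384*L^2/l^2 * δ := by
        have : c^2 * Δ ≤ 2*L^2*δ := by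
          calc c^2 * Δ ≤ c^2*((1+L)*δ) := by gcongr
            _ = c * (c * (1+L)) * δ := by ring
            _ ≤ L * (2*L) * δ := by gcongr
            _ = _ := by ring
        calc _ = 192/l^2 * (c^2*Δ) := by field_simp; ring
          _ ≤ 192/l^2 * (2*L^2*δ) := by gcongr
          _ = _ := by field_simp; ring
      rw [e1]
      calc _ ≤ (128*(3*k+5)^2*L^2/l^2 * δ) * 1 + 384*L^2/l^2 * δ := add_le_add e2 e3
        _ = _ := by ring
end Ker

section Ker2
variable {V : Type*} [NormedAddCommGroup V] [InnerProductSpace ℝ V] [MeasurableSpace V] [BorelSpace V]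
  [SecondCountableTopology V] [CompleteSpace V]

/-- Model kernel average. -/
def lam (k : ℕ) (a : V) : V := Real.log 2 • Gk k 1 a (rho 1 a)

lemma log2_le : ‖Real.log 2‖ ≤ 1 := by
  rw [Real.norm_of_nonneg (Real.log_nonneg (by norm_num))]
  have := Real.log_le_sub_one_of_pos (show (0:ℝ) < 2 by norm_num)
  linarith

lemma rho_one (a : V) : 1 ≤ rho 1 a := by
  have := rho_r 1 a; rwa [abs_one] at this

lemma lam_norm (k : ℕ) (a : V) : ‖lam k a‖ ≤ ‖a‖ := by
  unfold lam
  rw [norm_smul]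
  have h : ‖Gk k 1 a (rho 1 a)‖ ≤ ‖a‖ / 1 :=
    Gk_norm k (rho_r 1 a) (by have := rho_one a; nlinarith [norm_nonneg a]) (norm_nonneg a) one_pos (rho_one a)
  calc _ ≤ 1 * (‖a‖/1) := by gcongr; exact log2_le
    _ = _ := by simp

lemma lam_lip (k : ℕ) (a a' : V) : ‖lam k a - lam k a'‖ ≤ (k+3) * ‖a - a'‖ := by
  unfold lam
  rw [← smul_sub, norm_smul]
  have h := Glip k (c := 1) (μ := 1) (rho_r 1 a) (rho_r 1 a') (by simpa using rho_D 1 a) (by simpa using rho_D 1 a')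
    zero_le_one one_pos (rho_one a) (rho_one a')
  have h2 := rho_lip 1 1 a a'
  simp only [sub_self, abs_zero, zero_add, mul_zero, one_mul, one_pow, div_one] at h h2
  calc _ ≤ 1 * (‖a - a'‖ + (k+2) * ‖a-a'‖) := by
        refine mul_le_mul log2_le (h.trans ?_) (norm_nonneg _) zero_le_one
        gcongr
    _ = _ := by ring

lemma lam_neg (k : ℕ) (a : V) : lam k (-a) = - lam k a := by
  unfold lam rho; rw [norm_neg, Gk_neg, smul_neg]

lemma rho_smul {r : ℝ} (hr : 0 ≤ r) (a : V) : rho r (r • a) = r * rho 1 a := by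
  unfold rho
  rw [norm_smul, Real.norm_of_nonneg hr, show r^2 + (r*‖a‖)^2 = r^2 * (1^2 + ‖a‖^2) by ring,
    Real.sqrt_mul (sq_nonneg r), Real.sqrt_sq hr]

lemma lam_int (k : ℕ) {l t : ℝ} (hl : 0 < l) (ht : t ∈ Ioc (l/4) (l/2)) (a : V) :
    ∫ r in (0:ℝ)..l, kap k l (r • a) r t = lam k a := by
  set s := rho 1 a with hs
  have hs1 : 1 ≤ s := rho_one a
  have hs0 : 0 < s := by linarith
  have ht0 : 0 < t := by linarith [ht.1]
  have hsub : Ioc (t/s) (2*t/s) ⊆ Ioc 0 l := by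
    apply Ioc_subset_Ioc (by positivity)
    rw [div_le_iff₀ hs0]; nlinarith [ht.2]
  have e : ∀ r ∈ Ioc 0 l, kap k l (r • a) r t
      = (Ioc (t/s) (2*t/s)).indicator (fun r => r⁻¹ • Gk k 1 a s) r := by
    intro r hr
    rw [kap_eq k _ _ ht.1.le, rho_smul hr.1.le, ← hs]
    have : (t < r * s ∧ r * s ≤ 2*t) ↔ r ∈ Ioc (t/s) (2*t/s) := by
      rw [mem_Ioc, div_lt_iff₀ hs0, le_div_iff₀ hs0]
    by_cases h : r ∈ Ioc (t/s) (2*t/s)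
    · rw [if_pos (this.2 h), indicator_of_mem h]
      unfold Gk
      rw [smul_smul, smul_smul]; congr 1
      have := hr.1
      field_simp
      rw [mul_pow]; ring
    · rw [if_neg (fun h' => h (this.1 h')), indicator_of_notMem h]
  rw [intervalIntegral.integral_of_le hl.le, setIntegral_congr_fun measurableSet_Ioc e,
    setIntegral_indicator measurableSet_Ioc, inter_eq_self_of_subset_right hsub,
    integral_smul_const, ← intervalIntegral.integral_of_le (by gcongr; linarith),
    integral_inv_of_pos (by positivity) (by positivity)]
  unfold lam
  congr 2
  field_simp

lemma ENNReal_sq3 (a b c : ℝ≥0∞) : (a+b+c)^2 ≤ 3*(a^2+b^2+c^2) := by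
  by_cases h : a = ⊤ ∨ b = ⊤ ∨ c = ⊤
  · rcases h with h | h | h <;> simp [h]
  · push Not at h
    lift a to ℝ≥0 using h.1
    lift b to ℝ≥0 using h.2.1
    lift c to ℝ≥0 using h.2.2
    norm_cast
    rw [← NNReal.coe_le_coe]
    push_cast
    nlinarith [sq_nonneg ((a:ℝ)-b), sq_nonneg ((b:ℝ)-c), sq_nonneg ((a:ℝ)-c)]

lemma lsq {α : Type*} [MeasurableSpace α] (μ : Measure α) {F : α → ℝ≥0∞} (hF : Measurable F) :
    (∫⁻ a, F a ∂μ)^2 ≤ μ univ * ∫⁻ a, (F a)^2 ∂μ := by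
  have h := ENNReal.lintegral_mul_le_Lp_mul_Lq μ (Real.HolderConjugate.two_two) (f := fun _ => 1) (g := F)
    aemeasurable_const hF.aemeasurable
  simp only [Pi.mul_apply, one_mul, ENNReal.one_rpow, lintegral_const, ENNReal.rpow_two] at h
  have h2 := pow_le_pow_left₀ zero_le h 2
  refine h2.trans (le_of_eq ?_)
  have e : ∀ x : ℝ≥0∞, (x ^ (1/2:ℝ))^2 = x := by
    intro x; rw [← ENNReal.rpow_two, ← ENNReal.rpow_mul]; norm_num
  rw [mul_pow, e, e]; simp

lemma sharp {e φ : ℝ → ℝ} (he : Measurable e) (he0 : ∀ r, 0 ≤ e r) (hφ : Measurable φ)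
    (hφ2 : ∀ q ε, 0 ≤ ε → ∫⁻ t, ENNReal.ofReal (mis q ε (φ t)) ≤ ENNReal.ofReal (2*ε))
    {s l : ℝ} (hs : 1 ≤ s) :
    ∫⁻ t, (∫⁻ r in Ioc 0 l, ENNReal.ofReal (mis (r*s) (e r) (φ t)))^2
      ≤ 16 * ∫⁻ r in Ioc 0 l, ENNReal.ofReal ((e r)^2) := by
  have hs0 : 0 < s := by linarith
  have hmm : Measurable (fun p : ℝ × ℝ => ENNReal.ofReal (mis (p.2*s) (e p.2) (φ p.1))) :=
    (meas_mis (by fun_prop) (by fun_prop) (by fun_prop)).ennreal_ofReal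
  have hpt : ∀ t, (∫⁻ r in Ioc 0 l, ENNReal.ofReal (mis (r*s) (e r) (φ t)))^2
      ≤ 8 * ∫⁻ r in Ioc 0 l, ENNReal.ofReal (e r) * ENNReal.ofReal (mis (r*s) (e r) (φ t)) := by
    intro t
    set σ := ∫⁻ r in Ioc 0 l, ENNReal.ofReal (mis (r*s) (e r) (φ t)) with hσ
    set X := ∫⁻ r in Ioc 0 l, ENNReal.ofReal (e r) * ENNReal.ofReal (mis (r*s) (e r) (φ t)) with hX
    have hσt : σ ≠ ⊤ := by
      have : σ ≤ ∫⁻ r in Ioc 0 l, 1 := by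
        refine lintegral_mono fun r => ?_
        rw [← ENNReal.ofReal_one]; exact ENNReal.ofReal_le_ofReal (mis_le _ _ _)
      rw [setLIntegral_one, Real.volume_Ioc] at this
      exact ne_top_of_le_ne_top ENNReal.ofReal_ne_top this
    obtain ⟨τ, hτ0, hτ⟩ : ∃ τ : ℝ, 0 ≤ τ ∧ σ = ENNReal.ofReal τ :=
      ⟨σ.toReal, ENNReal.toReal_nonneg, (ENNReal.ofReal_toReal hσt).symm⟩
    have hp : ∀ r, ENNReal.ofReal (τ/4) * ENNReal.ofReal (mis (r*s) (e r) (φ t))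
        ≤ ENNReal.ofReal (τ/4) * ENNReal.ofReal (mis (φ t/s) (τ/4) r)
          + ENNReal.ofReal (e r) * ENNReal.ofReal (mis (r*s) (e r) (φ t)) := by
      intro r
      by_cases h1 : |φ t - r*s| ≤ e r
      · by_cases h2 : |r - φ t/s| ≤ τ/4
        · rw [mis_one h2]
          refine le_add_right ?_
          gcongr
          exact mis_le _ _ _
        · refine le_add_left ?_
          gcongr
          have : |φ t - r*s| = s * |r - φ t/s| := by
            rw [show φ t - r*s = -(s * (r - φ t/s)) by field_simp; ring, abs_neg, abs_mul, abs_of_pos hs0]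
          have h3 := abs_nonneg (r - φ t/s)
          push Not at h2
          nlinarith
      · have : mis (r*s) (e r) (φ t) = 0 := by unfold mis; rw [if_neg h1]
        rw [this]; simp
    have hm0 : Measurable (fun r => ENNReal.ofReal (mis (φ t/s) (τ/4) r)) :=
      (meas_mis measurable_const measurable_const measurable_id).ennreal_ofReal
    have hm1 : Measurable (fun r => ENNReal.ofReal (mis (r*s) (e r) (φ t))) :=
      hmm.comp (measurable_const.prodMk measurable_id)
    have hI : ENNReal.ofReal (τ/4) * σ ≤ ENNReal.ofReal (τ/4) * ENNReal.ofReal (2*(τ/4)) + X := by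
      calc _ = ∫⁻ r in Ioc 0 l, ENNReal.ofReal (τ/4) * ENNReal.ofReal (mis (r*s) (e r) (φ t)) := by
            rw [lintegral_const_mul _ hm1]
        _ ≤ _ := lintegral_mono hp
        _ = ENNReal.ofReal (τ/4) * (∫⁻ r in Ioc 0 l, ENNReal.ofReal (mis (φ t/s) (τ/4) r)) + X := by
            rw [lintegral_add_left (hm0.const_mul _), lintegral_const_mul _ hm0]
        _ ≤ _ := by
            gcongr
            exact (setLIntegral_le_lintegral _ _).trans (lint_mis _ (by positivity)).le
    rw [hτ, ← ENNReal.ofReal_mul (by positivity), ← ENNReal.ofReal_mul (by positivity),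
      show τ/4*τ = τ^2/8 + τ^2/8 by ring, show τ/4*(2*(τ/4)) = τ^2/8 by ring,
      ENNReal.ofReal_add (by positivity) (by positivity), ENNReal.add_le_add_iff_left ENNReal.ofReal_ne_top] at hI
    calc σ^2 = 8 * ENNReal.ofReal (τ^2/8) := by
          rw [hτ, ← ENNReal.ofReal_pow hτ0, show (8:ℝ≥0∞) = ENNReal.ofReal 8 by simp, ← ENNReal.ofReal_mul (by norm_num)]
          congr 1; ring
      _ ≤ _ := by gcongr
  have hmm2 : Measurable (fun p : ℝ × ℝ => ENNReal.ofReal (e p.2) * ENNReal.ofReal (mis (p.2*s) (e p.2) (φ p.1))) :=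
    (he.comp measurable_snd).ennreal_ofReal.mul hmm
  calc _ ≤ _ := lintegral_mono hpt
    _ = 8 * ∫⁻ r in Ioc 0 l, ∫⁻ t, ENNReal.ofReal (e r) * ENNReal.ofReal (mis (r*s) (e r) (φ t)) := by
      rw [lintegral_const_mul _ (Measurable.lintegral_prod_right' hmm2), lintegral_lintegral_swap hmm2.aemeasurable]
    _ ≤ 8 * ∫⁻ r in Ioc 0 l, 2 * ENNReal.ofReal ((e r)^2) := by
      gcongr with r
      rw [lintegral_const_mul _ (show Measurable (fun t => ENNReal.ofReal (mis (r*s) (e r) (φ t))) from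
        hmm.comp (measurable_id.prodMk measurable_const))]
      calc _ ≤ ENNReal.ofReal (e r) * ENNReal.ofReal (2 * e r) := by
            gcongr; exact hφ2 _ _ (he0 r)
        _ = _ := by
            rw [← ENNReal.ofReal_mul (he0 r), show (2:ℝ≥0∞) = ENNReal.ofReal 2 by simp, ← ENNReal.ofReal_mul (by norm_num)]
            congr 1; ring
    _ = _ := by
      rw [lintegral_const_mul _ (by fun_prop), ← mul_assoc]; norm_num

lemma K2 (k : ℕ) {l : ℝ} (hl : 0 < l) (D : ℝ → V) (hD : Continuous D) (a : V) :
    ∫⁻ t in Ioc (l/4) (l/2), ENNReal.ofReal (‖(∫ r in (0:ℝ)..l, kap k l (D r) r t) - lam k a‖^2)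
      ≤ ENNReal.ofReal ((192*(k+3)^2 + 1536) * l * ((l^3)⁻¹ * ∫ r in (0:ℝ)..l, ‖D r - r • a‖^2)) := by
  set e : ℝ → ℝ := fun r => ‖D r - r • a‖ with he
  have hec : Continuous e := by fun_prop
  have hem : Measurable e := hec.measurable
  have he0 : ∀ r, 0 ≤ e r := fun r => norm_nonneg _
  set s := rho 1 a with hs
  have hs1 : 1 ≤ s := rho_one a
  set α := 16*((k:ℝ)+3)/l^2 with hα
  have hα0 : 0 ≤ α := by positivity
  have hii : ENNReal.ofReal (∫ r in (0:ℝ)..l, (e r)^2) = ∫⁻ r in Ioc 0 l, ENNReal.ofReal ((e r)^2) := by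
    rw [intervalIntegral.integral_of_le hl.le, ofReal_integral_eq_lintegral_ofReal]
    · exact (hec.pow 2).intervalIntegrable 0 l |>.1
    · filter_upwards with r using sq_nonneg _
  set Q := ∫⁻ r in Ioc 0 l, ENNReal.ofReal ((e r)^2) with hQ
  have hN : ∀ (D : V) r t, ‖kap k l D r t‖ ≤ 4/l := by
    intro D r t
    have := kap_norm k hl (c := 1) zero_le_one (D := D) (r := r) (by simpa using rho_D r D) t
    linarith
  set I1 : ℝ → ℝ≥0∞ := fun t => ∫⁻ r in Ioc 0 l, ENNReal.ofReal (mis (r*s) (e r) t) with hI1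
  set I2 : ℝ → ℝ≥0∞ := fun t => ∫⁻ r in Ioc 0 l, ENNReal.ofReal (mis (r*s) (e r) (2*t)) with hI2
  have hmm : Measurable (fun p : ℝ × ℝ => ENNReal.ofReal (mis (p.2*s) (e p.2) p.1)) :=
    (meas_mis (by fun_prop) (by fun_prop) (by fun_prop)).ennreal_ofReal
  have hmm2 : Measurable (fun p : ℝ × ℝ => ENNReal.ofReal (mis (p.2*s) (e p.2) (2*p.1))) :=
    (meas_mis (by fun_prop) (by fun_prop) (by fun_prop)).ennreal_ofReal
  have hI1m : Measurable I1 := Measurable.lintegral_prod_right' hmm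
  have hI2m : Measurable I2 := Measurable.lintegral_prod_right' hmm2
  have hpt : ∀ t ∈ Ioc (l/4) (l/2), ENNReal.ofReal (‖(∫ r in (0:ℝ)..l, kap k l (D r) r t) - lam k a‖^2)
      ≤ 3 * (ENNReal.ofReal (l * α^2) * Q + ENNReal.ofReal ((4/l)^2) * (I1 t)^2 + ENNReal.ofReal ((4/l)^2) * (I2 t)^2) := by
    intro t ht
    rw [← lam_int k hl ht a, ← intervalIntegral.integral_sub]
    rotate_left
    · exact bdd_ii (meas_kap k l hD.measurable measurable_id measurable_const) (fun r => hN _ _ _) _ _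
    · exact bdd_ii (meas_kap k l (by fun_prop) measurable_id measurable_const) (fun r => hN _ _ _) _ _
    rw [intervalIntegral.integral_of_le hl.le, ENNReal.ofReal_pow (norm_nonneg _)]
    have m1 : Measurable (fun r => ENNReal.ofReal (mis (r*s) (e r) t)) :=
      hmm.comp (measurable_const.prodMk measurable_id)
    have m2 : Measurable (fun r => ENNReal.ofReal (mis (r*s) (e r) (2*t))) :=
      hmm2.comp (measurable_const.prodMk measurable_id)
    have m3 : Measurable (fun r => ENNReal.ofReal (e r)) := by fun_prop
    have hb : ENNReal.ofReal ‖∫ r in Ioc 0 l, (kap k l (D r) r t - kap k l (r • a) r t)‖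
        ≤ ENNReal.ofReal α * (∫⁻ r in Ioc 0 l, ENNReal.ofReal (e r)) + ENNReal.ofReal (4/l) * I1 t
          + ENNReal.ofReal (4/l) * I2 t := by
      rw [ofReal_norm]
      refine (enorm_integral_le_lintegral_enorm _).trans ?_
      rw [hI1, hI2, ← lintegral_const_mul _ m1, ← lintegral_const_mul _ m2, ← lintegral_const_mul _ m3,
        ← lintegral_add_left (by fun_prop), ← lintegral_add_left (by fun_prop)]
      apply setLIntegral_mono (by fun_prop)
      intro r hr
      rw [← ofReal_norm, ← ENNReal.ofReal_mul hα0, ← ENNReal.ofReal_mul (by positivity), ← ENNReal.ofReal_mul (by positivity),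
        ← ENNReal.ofReal_add (by have := he0 r; positivity) (by have := mis_nonneg (r*s) (e r) t; positivity),
        ← ENNReal.ofReal_add (by have := mis_nonneg (r*s) (e r) t; have := he0 r; positivity)
          (by have := mis_nonneg (r*s) (e r) (2*t); positivity)]
      apply ENNReal.ofReal_le_ofReal
      have hrho : |rho r (D r) - rho r (r • a)| ≤ e r := by
        have := rho_lip r r (D r) (r • a); simpa using this
      have hd := kap_diff k l (t := t) hrho (hN _ _ _) (hN _ _ _)
      rw [rho_smul hr.1.le, ← hs] at hd
      have hG := Glip k (c := 1) (μ := l/4) (r := r) (r' := r) (m := max (rho r (D r)) (l/4))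
        (m' := max (rho r (r • a)) (l/4)) (D := D r) (D' := r • a)
        ((rho_r _ _).trans (le_max_left _ _)) ((rho_r _ _).trans (le_max_left _ _))
        (by rw [one_mul]; exact (rho_D _ _).trans (le_max_left _ _))
        (by rw [one_mul]; exact (rho_D _ _).trans (le_max_left _ _)) zero_le_one (by positivity)
        (le_max_right _ _) (le_max_right _ _)
      have hm := (abs_max_sub_max_le_abs (rho r (D r)) (rho r (r • a)) (l/4)).trans hrho
      rw [rho_smul hr.1.le, ← hs] at hG hm
      have hG2 : (‖D r - r • a‖ + 1 * (k * |r-r| + (k+2) * |max (rho r (D r)) (l/4) - max (r*s) (l/4)|)) / (l/4)^2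
          ≤ α * e r := by
        calc _ ≤ (e r + 1 * (k * |r-r| + (k+2) * e r)) / (l/4)^2 := by gcongr
          _ = _ := by rw [hα]; simp; field_simp; ring
      linarith
    refine (pow_le_pow_left₀ zero_le hb 2).trans ((ENNReal_sq3 _ _ _).trans ?_)
    gcongr
    · rw [mul_pow, ENNReal.ofReal_mul hl.le, ENNReal.ofReal_pow hα0]
      have := lsq (volume.restrict (Ioc 0 l)) m3
      simp only [Measure.restrict_apply MeasurableSet.univ, univ_inter, Real.volume_Ioc, sub_zero,
        ← ENNReal.ofReal_pow (he0 _)] at this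
      calc _ ≤ ENNReal.ofReal α ^ 2 * (ENNReal.ofReal l * Q) := by gcongr
        _ = _ := by ring
    · rw [mul_pow, ENNReal.ofReal_pow (by positivity)]
    · rw [mul_pow, ENNReal.ofReal_pow (by positivity)]
  have s1 : ∫⁻ t, (I1 t)^2 ≤ 16 * Q :=
    sharp (φ := fun t => t) hem he0 measurable_id (fun q ε hε => (lint_mis q hε).le) hs1
  have s2 : ∫⁻ t, (I2 t)^2 ≤ 16 * Q :=
    sharp (φ := fun t => 2*t) hem he0 (by fun_prop) (fun q ε hε => (lint_mis2 q hε).le.trans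
      (ENNReal.ofReal_le_ofReal (by linarith))) hs1
  calc _ ≤ _ := setLIntegral_mono (by fun_prop) hpt
    _ = 3 * (ENNReal.ofReal (l * α^2) * Q * ENNReal.ofReal (l/2 - l/4)
        + ENNReal.ofReal ((4/l)^2) * (∫⁻ t in Ioc (l/4) (l/2), (I1 t)^2)
        + ENNReal.ofReal ((4/l)^2) * (∫⁻ t in Ioc (l/4) (l/2), (I2 t)^2)) := by
      rw [lintegral_const_mul _ (by fun_prop), lintegral_add_left (by fun_prop), lintegral_add_left (by fun_prop),
        lintegral_const, Measure.restrict_apply MeasurableSet.univ, univ_inter, Real.volume_Ioc,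
        lintegral_const_mul _ (by fun_prop), lintegral_const_mul _ (by fun_prop)]
    _ ≤ 3 * (ENNReal.ofReal (l * α^2) * Q * ENNReal.ofReal (l/2 - l/4)
        + ENNReal.ofReal ((4/l)^2) * (16 * Q)
        + ENNReal.ofReal ((4/l)^2) * (16 * Q)) := by
      gcongr
      · exact (setLIntegral_le_lintegral _ _).trans s1
      · exact (setLIntegral_le_lintegral _ _).trans s2
    _ = ENNReal.ofReal (3 * (l * α^2 * (l/2-l/4) + (4/l)^2*16 + (4/l)^2*16)) * Q := by
      have h4 : 0 ≤ l/2 - l/4 := by linarith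
      have h16 : (16:ℝ≥0∞) = ENNReal.ofReal 16 := by simp
      have h3 : (3:ℝ≥0∞) = ENNReal.ofReal 3 := by simp
      rw [ENNReal.ofReal_mul (p := 3) (by norm_num), ENNReal.ofReal_add (by positivity) (by positivity),
        ENNReal.ofReal_add (by positivity) (by positivity), ENNReal.ofReal_mul (q := l/2-l/4) (by positivity),
        ENNReal.ofReal_mul (q := 16) (by positivity), h16, h3]
      ring
    _ = _ := by
      rw [← hii, ← ENNReal.ofReal_mul]
      · congr 1
        change _ = _ * l * ((l^3)⁻¹ * ∫ r in (0:ℝ)..l, (e r)^2)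
        rw [hα]
        generalize (∫ r in (0:ℝ)..l, (e r)^2) = Z
        field_simp
        ring
      · have h4 : 0 ≤ l/2 - l/4 := by linarith
        positivity
end Ker2

section ErrS
variable {E V : Type*} [NormedAddCommGroup E] [NormedSpace ℝ E] [MeasurableSpace E] [BorelSpace E]
  [SecondCountableTopology E]
  [NormedAddCommGroup V] [InnerProductSpace ℝ V] [MeasurableSpace V] [BorelSpace V]
  [SecondCountableTopology V] [CompleteSpace V]

/-- difference quotient -/
def bq (A : E → V) (w : E) (l : ℝ) (x : E) : V := l⁻¹ • (A (x + l • w) - A x)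

lemma bq_smul (A : E → V) (w : E) {l : ℝ} (hl : l ≠ 0) (x : E) : l • bq A w l x = A (x + l • w) - A x := by
  unfold bq; rw [smul_smul, mul_inv_cancel₀ hl, one_smul]

lemma bq_norm {A : E → V} {L : ℝ} (hA : ∀ x y, ‖A x - A y‖ ≤ L * ‖x - y‖) {w : E} (hw : ‖w‖ = 1) {l : ℝ}
    (hl : 0 < l) (x : E) : ‖bq A w l x‖ ≤ L := by
  unfold bq
  rw [norm_smul, norm_inv, Real.norm_of_nonneg hl.le, inv_mul_le_iff₀ hl]
  have := hA (x + l • w) x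
  rwa [add_sub_cancel_left, norm_smul, hw, Real.norm_of_nonneg hl.le, mul_one, mul_comm] at this

lemma bq_double (A : E → V) (w : E) {l : ℝ} (x : E) :
    bq A w (l*2) x = (1/2:ℝ) • (bq A w l x + bq A w l (x + l • w)) := by
  unfold bq
  have : x + l • w + l • w = x + (l*2) • w := by module
  rw [this, mul_inv]
  module

lemma bq_neg (A : E → V) (w : E) (l : ℝ) (x : E) : bq A (-w) l x = - bq A w l (x - l • w) := by
  unfold bq
  rw [sub_add_cancel, smul_neg, ← sub_eq_add_neg]; module

lemma meas_bq {A : E → V} (hA : Continuous A) (w : E) (l : ℝ) : Measurable (bq A w l) := by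
  unfold bq; exact Continuous.measurable (by fun_prop)

/-- squared deviation from the chord -/
def Err (A : E → V) (w : E) (l : ℝ) (x : E) : ℝ :=
  (l^3)⁻¹ * ∫ r in (0:ℝ)..l, ‖(A (x + r • w) - A x) - r • bq A w l x‖^2

lemma Err_nonneg (A : E → V) (w : E) {l : ℝ} (hl : 0 < l) (x : E) : 0 ≤ Err A w l x := by
  unfold Err
  have := intervalIntegral.integral_nonneg (f := fun r => ‖(A (x + r • w) - A x) - r • bq A w l x‖^2)
    (μ := volume) hl.le (fun r _ => sq_nonneg _)
  positivity

lemma meas_Err {A : E → V} (hA : Continuous A) (w : E) (l : ℝ) : Measurable (Err A w l) := by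
  unfold Err
  apply Measurable.const_mul
  apply meas_ii (fun x r => ‖(A (x + r • w) - A x) - r • bq A w l x‖^2)
  simp only [Function.uncurry_def]
  have := meas_bq hA w l
  have := hA.measurable
  fun_prop

lemma Err_le {A : E → V} {L : ℝ} (hA : ∀ x y, ‖A x - A y‖ ≤ L * ‖x - y‖) (hAc : Continuous A) {w : E} (hw : ‖w‖ = 1) {l : ℝ}
    (hl : 0 < l) (x : E) : Err A w l x ≤ 4 * L^2 := by
  have hL : 0 ≤ L := (norm_nonneg _).trans (bq_norm hA hw hl x)
  unfold Err
  rw [inv_mul_le_iff₀ (by positivity)]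
  have h : ∫ r in (0:ℝ)..l, ‖(A (x + r • w) - A x) - r • bq A w l x‖^2 ≤ ∫ r in (0:ℝ)..l, (2*l*L)^2 := by
    apply intervalIntegral.integral_mono_on hl.le
    · exact Continuous.intervalIntegrable (by fun_prop) _ _
    · simp
    · intro r hr
      have h1 := hA (x + r • w) x
      rw [add_sub_cancel_left, norm_smul, hw, Real.norm_of_nonneg hr.1, mul_one] at h1
      have h2 : ‖r • bq A w l x‖ ≤ r * L := by
        rw [norm_smul, Real.norm_of_nonneg hr.1]; exact mul_le_mul_of_nonneg_left (bq_norm hA hw hl x) hr.1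
      apply pow_le_pow_left₀ (norm_nonneg _)
      refine (norm_sub_le _ _).trans ?_
      nlinarith [hr.2]
  refine h.trans (le_of_eq ?_)
  simp; ring

lemma sq43 (a b : V) : ‖a + b‖^2 ≤ 4/3 * ‖a‖^2 + 4 * ‖b‖^2 := by
  have h := pow_le_pow_left₀ (norm_nonneg _) (norm_add_le a b) 2
  nlinarith [sq_nonneg (‖a‖ - 3*‖b‖)]

lemma Err_double {A : E → V} (hA : Continuous A) (w : E) {l : ℝ} (hl : 0 < l) (x : E) :
    Err A w (l*2) x ≤ 1/6 * (Err A w l x + Err A w l (x + l • w))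
      + 1/4 * ‖bq A w l (x + l • w) - bq A w l x‖^2 := by
  set b := bq A w l x with hb
  set b' := bq A w l (x + l • w) with hb'
  set b2 := bq A w (l*2) x with hb2
  have hb2e : b2 = (1/2:ℝ) • (b + b') := bq_double A w x
  have hlb : l • b = A (x + l • w) - A x := bq_smul A w hl.ne' x
  have i1 : ∀ (y : E) (b : V) (p q : ℝ), IntervalIntegrable (fun r => ‖(A (y + r • w) - A x) - r • b‖^2) volume p q :=
    fun y b p q => Continuous.intervalIntegrable (by fun_prop) _ _
  have h0 : ∫ r in (0:ℝ)..(l*2), ‖(A (x + r • w) - A x) - r • b2‖^2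
      = (∫ r in (0:ℝ)..l, ‖(A (x + r • w) - A x) - r • b2‖^2)
        + ∫ r in (0:ℝ)..l, ‖(A (x + l • w + r • w) - A x) - (r + l) • b2‖^2 := by
    rw [← intervalIntegral.integral_add_adjacent_intervals (i1 x b2 0 l) (i1 x b2 l (l*2))]
    congr 1
    have := intervalIntegral.integral_comp_add_right (a := 0) (b := l) (fun r => ‖(A (x + r • w) - A x) - r • b2‖^2) l
    rw [zero_add, ← mul_two] at this
    rw [← this]
    congr 1; ext r; congr 4; rw [add_smul]; abel_nf
  have h1 : ∫ r in (0:ℝ)..l, ‖(A (x + r • w) - A x) - r • b2‖^2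
      ≤ 4/3 * (∫ r in (0:ℝ)..l, ‖(A (x + r • w) - A x) - r • b‖^2) + l * (l^2 * ‖b' - b‖^2) := by
    have : l * (l^2 * ‖b' - b‖^2) = ∫ r in (0:ℝ)..l, l^2 * ‖b' - b‖^2 := by simp; ring
    rw [this, ← intervalIntegral.integral_const_mul, ← intervalIntegral.integral_add
      (Continuous.intervalIntegrable (by fun_prop) _ _) (by simp)]
    apply intervalIntegral.integral_mono_on hl.le (Continuous.intervalIntegrable (by fun_prop) _ _)
      (Continuous.intervalIntegrable (by fun_prop) _ _)
    intro r hr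
    have e : (A (x + r • w) - A x) - r • b2 = ((A (x + r • w) - A x) - r • b) + (-(r/2)) • (b' - b) := by
      rw [hb2e]; module
    rw [e]
    refine (sq43 _ _).trans ?_
    rw [norm_smul, mul_pow]
    refine add_le_add le_rfl ?_
    rw [norm_neg, Real.norm_of_nonneg (by linarith [hr.1])]
    have : r^2 ≤ l^2 := pow_le_pow_left₀ hr.1 hr.2 2
    nlinarith [sq_nonneg ‖b'-b‖]
  have h2 : ∫ r in (0:ℝ)..l, ‖(A (x + l • w + r • w) - A x) - (r + l) • b2‖^2
      ≤ 4/3 * (∫ r in (0:ℝ)..l, ‖(A (x + l • w + r • w) - A (x + l • w)) - r • b'‖^2) + l * (l^2 * ‖b' - b‖^2) := by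
    have : l * (l^2 * ‖b' - b‖^2) = ∫ r in (0:ℝ)..l, l^2 * ‖b' - b‖^2 := by simp; ring
    rw [this, ← intervalIntegral.integral_const_mul, ← intervalIntegral.integral_add
      (Continuous.intervalIntegrable (by fun_prop) _ _) (by simp)]
    apply intervalIntegral.integral_mono_on hl.le (Continuous.intervalIntegrable (by fun_prop) _ _)
      (Continuous.intervalIntegrable (by fun_prop) _ _)
    intro r hr
    have e : (A (x + l • w + r • w) - A x) - (r+l) • b2
        = ((A (x + l • w + r • w) - A (x + l • w)) - r • b') + (-((l-r)/2)) • (b' - b) := by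
      have : A (x + l • w) = A x + l • b := by rw [hlb]; abel
      rw [hb2e, this]; module
    rw [e]
    refine (sq43 _ _).trans ?_
    rw [norm_smul, mul_pow]
    refine add_le_add le_rfl ?_
    rw [norm_neg, Real.norm_of_nonneg (by linarith [hr.2])]
    have : (l-r)^2 ≤ l^2 := pow_le_pow_left₀ (by linarith [hr.2]) (by linarith [hr.1]) 2
    nlinarith [sq_nonneg ‖b'-b‖]
  unfold Err
  rw [← hb, ← hb', ← hb2, h0]
  set X := ∫ r in (0:ℝ)..l, ‖(A (x + r • w) - A x) - r • b‖^2
  set Y := ∫ r in (0:ℝ)..l, ‖(A (x + l • w + r • w) - A (x + l • w)) - r • b'‖^2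
  calc _ ≤ ((l*2)^3)⁻¹ * ((4/3 * X + l * (l^2 * ‖b' - b‖^2)) + (4/3 * Y + l * (l^2 * ‖b' - b‖^2))) := by
        gcongr
    _ = _ := by field_simp; ring

variable (μ : Measure E) [μ.IsAddRightInvariant] [SFinite μ]

lemma sum_beta {A : E → V} {L : ℝ} (hL : 0 ≤ L) (hA : ∀ x y, ‖A x - A y‖ ≤ L * ‖x - y‖) (hAc : Continuous A)
    {f : E → ℝ} (hf : Measurable f) {M : ℝ} (hM : ∀ x, |f x| ≤ M) {w : E} (hw : ‖w‖ = 1) {l0 : ℝ} (hl : 0 < l0) (I : ℕ) :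
    ∑ i ∈ Finset.range I, ∫⁻ x, ENNReal.ofReal (‖bq A w (l0*2^i) (x + (l0*2^i) • w) - bq A w (l0*2^i) x‖^2
        * (av f w (l0*2^i*2) x)^2) ∂μ
      ≤ ENNReal.ofReal (72*L^2) * ∫⁻ x, ENNReal.ofReal ((f x)^2) ∂μ := by
  have h := sum_X μ (fun i => av f w (l0*2^i)) (fun i => bq A w (l0*2^i)) (fun i => (l0*2^i) • w) L hL
    (fun i => meas_av hf _ _) (fun i => meas_bq hAc _ _)
    (fun i x => by rw [pow_succ, ← mul_assoc]; exact av_double hf hM w _ x)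
    (fun i x => by rw [pow_succ, ← mul_assoc]; exact bq_double A w x)
    (fun i x => bq_norm hA hw (by positivity) x) I
  have e : ∀ i : ℕ, l0*2^(i+1) = l0*2^i*2 := fun i => by ring
  simp only [e] at h
  refine h.trans ?_
  rw [ENNReal.ofReal_mul (p := 72) (by norm_num), show ENNReal.ofReal 72 = 72 by simp, mul_assoc]
  gcongr 72 * (_ * ?_)
  exact lint_av_le μ hf hM w (by positivity)

lemma sum_W {A : E → V} {L : ℝ} (hL : 0 ≤ L) (hA : ∀ x y, ‖A x - A y‖ ≤ L * ‖x - y‖) (hAc : Continuous A)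
    {f : E → ℝ} (hf : Measurable f) {M : ℝ} (hM : ∀ x, |f x| ≤ M) {w : E} (hw : ‖w‖ = 1) {l0 : ℝ} (hl : 0 < l0) (I : ℕ) :
    ∑ i ∈ Finset.range I, ∫⁻ x, ENNReal.ofReal ((av f w (l0*2^i) x)^2 * Err A w (l0*2^i) x) ∂μ
      ≤ ENNReal.ofReal (336*L^2) * ∫⁻ x, ENNReal.ofReal ((f x)^2) ∂μ := by
  set F2 := ∫⁻ x, ENNReal.ofReal ((f x)^2) ∂μ with hF2
  have h := geo_sum (fun i => ∫⁻ x, ENNReal.ofReal ((av f w (l0*2^i) x)^2 * Err A w (l0*2^i) x) ∂μ)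
    (fun i => ENNReal.ofReal (2*L^2) * (∫⁻ x, ENNReal.ofReal ((av f w (l0*2^i) (x + (l0*2^i) • w) - av f w (l0*2^i) x)^2) ∂μ)
      + ∫⁻ x, ENNReal.ofReal (‖bq A w (l0*2^i) (x + (l0*2^i) • w) - bq A w (l0*2^i) x‖^2
        * (av f w (l0*2^i*2) x)^2) ∂μ) ?_ I
  · refine (le_self_add.trans h).trans ?_
    rw [Finset.sum_add_distrib, ← Finset.mul_sum]
    have h0 : ∫⁻ x, ENNReal.ofReal ((av f w (l0*2^0) x)^2 * Err A w (l0*2^0) x) ∂μ ≤ ENNReal.ofReal (4*L^2) * F2 := by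
      calc _ ≤ ∫⁻ x, ENNReal.ofReal (4*L^2) * ENNReal.ofReal ((av f w (l0*2^0) x)^2) ∂μ := by
            refine lintegral_mono fun x => ?_
            rw [← ENNReal.ofReal_mul (by positivity)]
            apply ENNReal.ofReal_le_ofReal
            rw [mul_comm]
            gcongr
            exact Err_le hA hAc hw (by positivity) x
        _ = ENNReal.ofReal (4*L^2) * ∫⁻ x, ENNReal.ofReal ((av f w (l0*2^0) x)^2) ∂μ := by
            have := meas_av hf w (l0*2^0)
            rw [lintegral_const_mul _ (by fun_prop)]
        _ ≤ _ := by gcongr; exact lint_av_le μ hf hM w (by positivity)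
    calc _ ≤ 4 * (ENNReal.ofReal (4*L^2) * F2) + 4 * (ENNReal.ofReal (2*L^2) * (4 * F2) + ENNReal.ofReal (72*L^2) * F2) := by
          gcongr
          · exact sum_dav μ hf hM w hl I
          · exact sum_beta μ hL hA hAc hf hM hw hl I
      _ = _ := by
          rw [ENNReal.ofReal_mul (by norm_num), ENNReal.ofReal_mul (by norm_num), ENNReal.ofReal_mul (by norm_num),
            ENNReal.ofReal_mul (by norm_num)]
          simp only [ENNReal.ofReal_ofNat]
          ring
  · intro i
    set l := l0*2^i with hl'
    have hlp : 0 < l := by positivity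
    have hll : l0*2^(i+1) = l*2 := by rw [hl']; ring
    simp only [hll]
    have ma := meas_av hf w l
    have ma2 := meas_av hf w (l*2)
    have me := meas_Err hAc w l
    have mb := meas_bq hAc w l
    set Φ : E → ℝ≥0∞ := fun x => ENNReal.ofReal ((av f w l x)^2 * Err A w l x) with hΦ
    have mΦ : Measurable Φ := by fun_prop
    have hpt : ∀ x, ENNReal.ofReal ((av f w (l*2) x)^2 * Err A w (l*2) x) ≤
        ENNReal.ofReal (2/9) * Φ x + ENNReal.ofReal (2/9) * Φ (x + l • w)
        + ENNReal.ofReal (2*L^2) * ENNReal.ofReal ((av f w l (x + l • w) - av f w l x)^2)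
        + ENNReal.ofReal (‖bq A w l (x + l • w) - bq A w l x‖^2 * (av f w (l*2) x)^2) := by
      intro x
      have e1 := Err_nonneg A w hlp x
      have e2 := Err_nonneg A w hlp (x + l • w)
      have e1' := Err_le hA hAc hw hlp x
      have e2' := Err_le hA hAc hw hlp (x + l • w)
      have e3 := Err_double hAc w hlp x
      simp only [hΦ]
      rw [← ENNReal.ofReal_mul (by norm_num), ← ENNReal.ofReal_mul (by norm_num), ← ENNReal.ofReal_mul (by positivity),
        ← ENNReal.ofReal_add (by positivity) (by positivity), ← ENNReal.ofReal_add (by positivity) (by positivity),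
        ← ENNReal.ofReal_add (by positivity) (by positivity)]
      apply ENNReal.ofReal_le_ofReal
      have hd := av_double hf hM w l x
      set p := av f w l x
      set q := av f w l (x + l • w)
      set c := av f w (l*2) x
      set X := Err A w l x
      set Y := Err A w l (x + l • w)
      set β := ‖bq A w l (x + l • w) - bq A w l x‖^2
      have hβ : 0 ≤ β := sq_nonneg _
      have c1 : c^2 ≤ 4/3*p^2 + (q-p)^2 := by rw [hd]; nlinarith [sq_nonneg (p/3 - (q-p)/2)]
      have c2 : c^2 ≤ 4/3*q^2 + (q-p)^2 := by rw [hd]; nlinarith [sq_nonneg (q/3 + (q-p)/2)]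
      have c3 : c^2 * Err A w (l*2) x ≤ c^2 * (1/6*(X+Y) + 1/4*β) := by gcongr
      have c4 : c^2 * X ≤ (4/3*p^2 + (q-p)^2) * X := by gcongr
      have c5 : c^2 * Y ≤ (4/3*q^2 + (q-p)^2) * Y := by gcongr
      have c6 : (q-p)^2 * X ≤ (q-p)^2 * (4*L^2) := by gcongr
      have c7 : (q-p)^2 * Y ≤ (q-p)^2 * (4*L^2) := by gcongr
      have c8 : 0 ≤ c^2*β := by positivity
      have c9 : 0 ≤ (q-p)^2*L^2 := by positivity
      nlinarith
    calc _ ≤ _ := lintegral_mono hpt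
      _ = ENNReal.ofReal (2/9) * (∫⁻ x, Φ x ∂μ) + ENNReal.ofReal (2/9) * (∫⁻ x, Φ (x + l • w) ∂μ)
        + ENNReal.ofReal (2*L^2) * (∫⁻ x, ENNReal.ofReal ((av f w l (x + l • w) - av f w l x)^2) ∂μ)
        + (∫⁻ x, ENNReal.ofReal (‖bq A w l (x + l • w) - bq A w l x‖^2 * (av f w (l*2) x)^2) ∂μ) := by
        rw [lintegral_add_left (by fun_prop), lintegral_add_left (by fun_prop), lintegral_add_left (by fun_prop),
          lintegral_const_mul _ (by fun_prop), lintegral_const_mul _ (by fun_prop), lintegral_const_mul _ (by fun_prop)]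
      _ ≤ _ := by
        rw [lintegral_add_right_eq_self Φ (l • w), ← add_mul, ← ENNReal.ofReal_add (by norm_num) (by norm_num), add_assoc]
        gcongr
        norm_num
end ErrS

section Lev
variable {E V : Type*} [NormedAddCommGroup E] [NormedSpace ℝ E] [MeasurableSpace E] [BorelSpace E]
  [SecondCountableTopology E]
  [NormedAddCommGroup V] [InnerProductSpace ℝ V] [MeasurableSpace V] [BorelSpace V]
  [SecondCountableTopology V] [CompleteSpace V]

/-- Kernel without the regularizing maximum. -/
def kap0 (k : ℕ) (D : V) (r t : ℝ) : V :=
  open Classical in if t < rho r D ∧ rho r D ≤ 2*t then Gk k r D (rho r D) else 0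

lemma meas_kap0 {X : Type*} [MeasurableSpace X] (k : ℕ) {D : X → V} {r t : X → ℝ} (hD : Measurable D)
    (hr : Measurable r) (ht : Measurable t) : Measurable (fun x => kap0 k (D x) (r x) (t x)) := by
  have h := meas_rho hr hD
  unfold kap0
  refine Measurable.ite ?_ ?_ measurable_const
  · exact (measurableSet_lt ht h).inter (measurableSet_le h (by fun_prop))
  · unfold Gk; fun_prop

/-- One-directional truncated integral. -/
def Pk (k : ℕ) (A : E → V) (f : E → ℝ) (w x : E) (t : ℝ) : V :=
  ∫ r in Ioi (0:ℝ), f (x + r • w) • kap0 k (A (x + r • w) - A x) r t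

lemma Pk_eq (k : ℕ) (A : E → V) (f : E → ℝ) (w x : E) {l t : ℝ} (hl : 0 < l) (ht : t ∈ Ioc (l/4) (l/2)) :
    Pk k A f w x t = ∫ r in (0:ℝ)..l, f (x + r • w) • kap k l (A (x + r • w) - A x) r t := by
  unfold Pk
  rw [intervalIntegral.integral_of_le hl.le]
  have : ∀ r, kap k l (A (x + r • w) - A x) r t = kap0 k (A (x + r • w) - A x) r t := fun r => kap_eq k _ _ ht.1.le
  simp_rw [this]
  apply setIntegral_eq_of_subset_of_forall_sdiff_eq_zero measurableSet_Ioi (fun r hr => hr.1)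
  rintro r ⟨hr, hr2⟩
  have hr3 : l < r := by
    by_contra h; exact hr2 ⟨hr, not_lt.1 h⟩
  unfold kap0
  rw [if_neg, smul_zero]
  rintro ⟨-, h⟩
  have := rho_r r (A (x + r • w) - A x)
  have := le_abs_self r
  linarith [ht.2]

lemma two_sq (a b : V) : ‖a + b‖^2 ≤ 2 * (‖a‖^2 + ‖b‖^2) := by
  have h := pow_le_pow_left₀ (norm_nonneg _) (norm_add_le a b) 2
  nlinarith [sq_nonneg (‖a‖ - ‖b‖)]

/-- Constants. -/
def C1 (k : ℕ) : ℝ := 128*(3*k+5)^2 + 384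
def C2 (k : ℕ) : ℝ := 192*(k+3)^2 + 1536
lemma C1_pos (k : ℕ) : 0 < C1 k := by unfold C1; positivity
lemma C2_pos (k : ℕ) : 0 < C2 k := by unfold C2; positivity

lemma half_level (k : ℕ) {A : E → V} {L : ℝ} (hL : 0 ≤ L) (hA : ∀ x y, ‖A x - A y‖ ≤ L * ‖x - y‖) (hAc : Continuous A)
    {f : E → ℝ} (hf : Measurable f) {M : ℝ} (hM : ∀ x, |f x| ≤ M) {w : E} (hw : ‖w‖ = 1) {l0 : ℝ} (hl0 : 0 < l0) (i : ℕ)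
    {l : ℝ} (hl : l = l0*2^i) (x : E) :
    ∫⁻ t in Ioc (l/4) (l/2), ENNReal.ofReal (‖Pk k A f w x t - av f w l x • lam k (bq A w l x)‖^2)
      ≤ ENNReal.ofReal (2 * C1 k * L^2 * l) * NN f w l0 i x
        + ENNReal.ofReal (2 * C2 k * l) * ENNReal.ofReal ((av f w l x)^2 * Err A w l x) := by
  have hlp : 0 < l := by rw [hl]; positivity
  have c1 := C1_pos k
  have c2 := C2_pos k
  set D : ℝ → V := fun r => A (x + r • w) - A x with hD
  have hDc : Continuous D := by fun_prop
  have hD0 : D 0 = 0 := by simp [hD]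
  have hDl : ∀ r r', ‖D r - D r'‖ ≤ L * |r - r'| := by
    intro r r'
    have := hA (x + r • w) (x + r' • w)
    have e : x + r • w - (x + r' • w) = (r - r') • w := by module
    rw [e, norm_smul, hw, mul_one, Real.norm_eq_abs] at this
    simpa [hD] using this
  have hN : ∀ r t, ‖kap k l (D r) r t‖ ≤ 4/l := by
    intro r t
    have := kap_norm k hlp (c := 1) zero_le_one (D := D r) (r := r) (by simpa using rho_D r (D r)) t
    linarith
  have hkm : Measurable (Function.uncurry (fun r t => kap k l (D r) r t)) :=
    meas_kap k l (hDc.measurable.comp measurable_fst) measurable_fst measurable_snd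
  have hR := R_bound hf hM w hl0 (volume.restrict (Ioc (l/4) (l/2))) (H := C1 k * L^2 / l^2) (B := 4/l) (by positivity) i
    (fun r t => kap k l (D r) r t) hkm hN (by
      rw [← hl]; intro r hr r' hr'; exact K1 k hlp hL D hD0 hDl hr hr') x
  rw [← hl] at hR
  have hK := K2 k hlp D hDc (bq A w l x)
  set a := av f w l x with ha
  set R : ℝ → V := fun t => ∫ r in (0:ℝ)..l, (f (x + r • w) - a) • kap k l (D r) r t with hRdef
  set K : ℝ → V := fun t => (∫ r in (0:ℝ)..l, kap k l (D r) r t) - lam k (bq A w l x) with hKdef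
  have mR : Measurable R := by
    apply meas_ii (fun t r => (f (x + r • w) - a) • kap k l (D r) r t)
    have h1 : Measurable (fun p : ℝ × ℝ => f (x + p.2 • w) - a) := by fun_prop
    exact h1.smul (hkm.comp measurable_swap)
  have mK : Measurable K := by
    refine Measurable.sub_const (meas_ii (fun t r => kap k l (D r) r t) (hkm.comp measurable_swap) _ _) _
  have hpt : ∀ t ∈ Ioc (l/4) (l/2), ENNReal.ofReal (‖Pk k A f w x t - a • lam k (bq A w l x)‖^2)
      ≤ 2 * (ENNReal.ofReal (‖R t‖^2) + ENNReal.ofReal (a^2) * ENNReal.ofReal (‖K t‖^2)) := by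
    intro t ht
    have e : Pk k A f w x t - a • lam k (bq A w l x) = R t + a • K t := by
      rw [Pk_eq k A f w x hlp ht]
      simp only [hRdef, hKdef]
      have mk : Measurable (fun r => kap k l (D r) r t) := hkm.comp (measurable_id.prodMk measurable_const)
      simp_rw [sub_smul]
      rw [intervalIntegral.integral_sub, intervalIntegral.integral_smul]
      · module
      · refine bdd_ii (B := M * (4/l)) ?_ ?_ _ _
        · have h1 : Measurable (fun r : ℝ => f (x + r • w)) := by fun_prop
          exact h1.smul mk
        · intro r; rw [norm_smul]
          exact mul_le_mul (hM _) (hN _ _) (norm_nonneg _) ((abs_nonneg _).trans (hM x))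
      · refine bdd_ii (B := |a| * (4/l)) (mk.const_smul a) ?_ _ _
        intro r; rw [Pi.smul_apply, norm_smul]
        exact mul_le_mul le_rfl (hN _ _) (norm_nonneg _) (abs_nonneg _)
    rw [e, ← ENNReal.ofReal_mul (sq_nonneg a), ← ENNReal.ofReal_add (by positivity) (by positivity),
      show (2:ℝ≥0∞) = ENNReal.ofReal 2 by simp, ← ENNReal.ofReal_mul (by norm_num)]
    apply ENNReal.ofReal_le_ofReal
    refine (two_sq _ _).trans (le_of_eq ?_)
    rw [norm_smul, mul_pow, Real.norm_eq_abs, sq_abs]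
  calc _ ≤ _ := setLIntegral_mono (by fun_prop) hpt
    _ = 2 * ((∫⁻ t in Ioc (l/4) (l/2), ENNReal.ofReal (‖R t‖^2))
        + ENNReal.ofReal (a^2) * ∫⁻ t in Ioc (l/4) (l/2), ENNReal.ofReal (‖K t‖^2)) := by
      rw [lintegral_const_mul _ (by fun_prop), lintegral_add_left (by fun_prop), lintegral_const_mul _ (by fun_prop)]
    _ ≤ 2 * (ENNReal.ofReal (C1 k * L^2 / l^2 * l^3) * NN f w l0 i x
        + ENNReal.ofReal (a^2) * ENNReal.ofReal (C2 k * l * Err A w l x)) := by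
      gcongr
      exact hK
    _ = _ := by
      have := Err_nonneg A w hlp x
      have e1 : 2 * (ENNReal.ofReal (C1 k * L^2 / l^2 * l^3) * NN f w l0 i x)
          = ENNReal.ofReal (2 * C1 k * L^2 * l) * NN f w l0 i x := by
        rw [← mul_assoc, show (2:ℝ≥0∞) = ENNReal.ofReal 2 by simp, ← ENNReal.ofReal_mul (by norm_num)]
        congr 2; field_simp
      have e2 : 2 * (ENNReal.ofReal (a^2) * ENNReal.ofReal (C2 k * l * Err A w l x))
          = ENNReal.ofReal (2 * C2 k * l) * ENNReal.ofReal (a^2 * Err A w l x) := by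
        rw [← ENNReal.ofReal_mul (by positivity), ← ENNReal.ofReal_mul (by positivity),
          show (2:ℝ≥0∞) = ENNReal.ofReal 2 by simp, ← ENNReal.ofReal_mul (by norm_num)]
        congr 1; ring
      rw [mul_add, e1, e2]

/-- The majorant at one scale. -/
def UU (k : ℕ) (A : E → V) (L : ℝ) (f : E → ℝ) (w : E) (l0 : ℝ) (i : ℕ) (x : E) : ℝ≥0∞ :=
  12 * ((ENNReal.ofReal (2 * C1 k * L^2) * NN f w l0 i x
      + ENNReal.ofReal (2 * C2 k) * ENNReal.ofReal ((av f w (l0*2^i) x)^2 * Err A w (l0*2^i) x))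
    + (ENNReal.ofReal (2 * C1 k * L^2) * NN f (-w) l0 i x
      + ENNReal.ofReal (2 * C2 k) * ENNReal.ofReal ((av f (-w) (l0*2^i) x)^2 * Err A (-w) (l0*2^i) x))
    + (ENNReal.ofReal ((k+3)^2) * ENNReal.ofReal (‖bq A w (l0*2^i) (x + -((l0*2^i) • w) + (l0*2^i) • w) - bq A w (l0*2^i) (x + -((l0*2^i) • w))‖^2
        * (av f w (l0*2^i*2) (x + -((l0*2^i) • w)))^2)
      + ENNReal.ofReal (L^2) * ENNReal.ofReal ((av f w (l0*2^i) (x + -((l0*2^i) • w) + (l0*2^i) • w) - av f w (l0*2^i) (x + -((l0*2^i) • w)))^2)))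

lemma level (k : ℕ) {A : E → V} {L : ℝ} (hL : 0 ≤ L) (hA : ∀ x y, ‖A x - A y‖ ≤ L * ‖x - y‖) (hAc : Continuous A)
    {f : E → ℝ} (hf : Measurable f) {M : ℝ} (hM : ∀ x, |f x| ≤ M) {w : E} (hw : ‖w‖ = 1) {l0 : ℝ} (hl0 : 0 < l0) (i : ℕ) (x : E)
    (hPm : ∀ w, Measurable (fun t => Pk k A f w x t)) :
    ∫⁻ t in Ioc (l0*2^i/4) (l0*2^i/2), ENNReal.ofReal (‖Pk k A f w x t + Pk k A f (-w) x t‖^2 / t)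
      ≤ UU k A L f w l0 i x := by
  unfold UU
  set l := l0*2^i with hl
  have hlp : 0 < l := by rw [hl]; positivity
  have c1 := C1_pos k
  have c2 := C2_pos k
  have h1 := half_level k hL hA hAc hf hM hw hl0 i hl x
  have h2 := half_level k hL hA hAc hf hM (w := -w) (by rw [norm_neg, hw]) hl0 i hl x
  have e1 : av f (-w) l x = av f w l (x - l • w) := av_neg f w l x
  have e2 : bq A (-w) l x = - bq A w l (x - l • w) := bq_neg A w l x
  rw [e1, e2] at h2
  rw [e1]
  rw [← sub_eq_add_neg, sub_add_cancel]
  set y := x - l • w with hy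
  have hyx : y + l • w = x := by rw [hy]; abel
  have ead : av f w (l*2) y = (av f w l y + av f w l x)/2 := by rw [av_double hf hM w l y, hyx]
  set p := av f w l x
  set q := av f w l y
  set b := bq A w l x with hb
  set b' := bq A w l y with hb'
  set H1 : ℝ → V := fun t => Pk k A f w x t - p • lam k b with hH1
  set H2 : ℝ → V := fun t => Pk k A f (-w) x t - q • lam k (-b') with hH2
  set Z : V := p • lam k b + q • lam k (-b') with hZ
  have hZn : ‖Z‖^2 ≤ 2*((k+3)^2 * (‖b - b'‖^2 * (av f w (l*2) y)^2)) + 2*(L^2 * (p-q)^2) := by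
    have eZ : Z = ((q+p)/2) • (lam k b - lam k b') + (p - q) • ((1/2:ℝ) • (lam k b + lam k b')) := by
      rw [hZ, lam_neg]; module
    rw [eZ, ead]
    refine (two_sq _ _).trans ?_
    rw [norm_smul, norm_smul, mul_pow, mul_pow, Real.norm_eq_abs, Real.norm_eq_abs, sq_abs, sq_abs]
    have n1 : ‖lam k b - lam k b'‖^2 ≤ ((k+3)*‖b-b'‖)^2 := pow_le_pow_left₀ (norm_nonneg _) (lam_lip k b b') 2
    have n2 : ‖(1/2:ℝ) • (lam k b + lam k b')‖^2 ≤ L^2 := by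
      apply pow_le_pow_left₀ (norm_nonneg _)
      rw [norm_smul]
      have s1 := (lam_norm k b).trans (bq_norm hA hw hlp x)
      have s2 := (lam_norm k b').trans (bq_norm hA hw hlp y)
      have s3 := norm_add_le (lam k b) (lam k b')
      norm_num
      linarith
    have n3 : ((q+p)/2)^2 * ‖lam k b - lam k b'‖^2 ≤ ((q+p)/2)^2 * ((k+3)*‖b-b'‖)^2 := by gcongr
    have n4 : (p-q)^2 * ‖(1/2:ℝ) • (lam k b + lam k b')‖^2 ≤ (p-q)^2 * L^2 := by gcongr
    linarith
  have mH1 : Measurable H1 := (hPm w).sub_const _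
  have mH2 : Measurable H2 := (hPm (-w)).sub_const _
  have hpt : ∀ t ∈ Ioc (l/4) (l/2), ENNReal.ofReal (‖Pk k A f w x t + Pk k A f (-w) x t‖^2 / t)
      ≤ ENNReal.ofReal (12/l) * (ENNReal.ofReal (‖H1 t‖^2) + ENNReal.ofReal (‖H2 t‖^2) + ENNReal.ofReal (‖Z‖^2)) := by
    intro t ht
    rw [← ENNReal.ofReal_add (by positivity) (by positivity), ← ENNReal.ofReal_add (by positivity) (by positivity),
      ← ENNReal.ofReal_mul (by positivity)]
    apply ENNReal.ofReal_le_ofReal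
    have e : Pk k A f w x t + Pk k A f (-w) x t = H1 t + H2 t + Z := by simp only [hH1, hH2, hZ]; abel
    rw [e]
    calc _ ≤ (3 * (‖H1 t‖^2 + ‖H2 t‖^2 + ‖Z‖^2)) / (l/4) := by
          gcongr
          · exact three_sq
          · exact ht.1.le
      _ = _ := by field_simp; ring
  calc _ ≤ _ := setLIntegral_mono (by fun_prop) hpt
    _ = ENNReal.ofReal (12/l) * ((∫⁻ t in Ioc (l/4) (l/2), ENNReal.ofReal (‖H1 t‖^2))
        + (∫⁻ t in Ioc (l/4) (l/2), ENNReal.ofReal (‖H2 t‖^2)) + ENNReal.ofReal (‖Z‖^2) * ENNReal.ofReal (l/2-l/4)) := by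
      rw [lintegral_const_mul _ (by fun_prop), lintegral_add_left (by fun_prop), lintegral_add_left (by fun_prop),
        lintegral_const, Measure.restrict_apply MeasurableSet.univ, univ_inter, Real.volume_Ioc]
    _ ≤ ENNReal.ofReal (12/l) * ((ENNReal.ofReal (2 * C1 k * L^2 * l) * NN f w l0 i x
        + ENNReal.ofReal (2 * C2 k * l) * ENNReal.ofReal (p^2 * Err A w l x))
        + (ENNReal.ofReal (2 * C1 k * L^2 * l) * NN f (-w) l0 i x
        + ENNReal.ofReal (2 * C2 k * l) * ENNReal.ofReal (q^2 * Err A (-w) l x))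
        + ENNReal.ofReal (2*((k+3)^2 * (‖b - b'‖^2 * (av f w (l*2) y)^2)) + 2*(L^2 * (p-q)^2)) * ENNReal.ofReal (l/2)) := by
      gcongr
      linarith
    _ = ENNReal.ofReal (12/l) * ENNReal.ofReal l * ((ENNReal.ofReal (2 * C1 k * L^2) * NN f w l0 i x
        + ENNReal.ofReal (2 * C2 k) * ENNReal.ofReal (p^2 * Err A w l x))
        + (ENNReal.ofReal (2 * C1 k * L^2) * NN f (-w) l0 i x
        + ENNReal.ofReal (2 * C2 k) * ENNReal.ofReal (q^2 * Err A (-w) l x))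
        + (ENNReal.ofReal ((k+3)^2) * ENNReal.ofReal (‖b - b'‖^2 * (av f w (l*2) y)^2) + ENNReal.ofReal (L^2) * ENNReal.ofReal ((p-q)^2))) := by
      have e3 : ENNReal.ofReal (2*((k+3)^2 * (‖b - b'‖^2 * (av f w (l*2) y)^2)) + 2*(L^2 * (p-q)^2)) * ENNReal.ofReal (l/2)
        = ENNReal.ofReal l * (ENNReal.ofReal ((k+3)^2) * ENNReal.ofReal (‖b - b'‖^2 * (av f w (l*2) y)^2) + ENNReal.ofReal (L^2) * ENNReal.ofReal ((p-q)^2)) := by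
        rw [← ENNReal.ofReal_mul (by positivity), ← ENNReal.ofReal_mul (by positivity), ← ENNReal.ofReal_mul (by positivity),
          ← ENNReal.ofReal_add (by positivity) (by positivity), ← ENNReal.ofReal_mul (by positivity)]
        congr 1; ring
      rw [e3, ENNReal.ofReal_mul (q := l) (by positivity), ENNReal.ofReal_mul (q := l) (by positivity)]
      ring
    _ = _ := by
      rw [← ENNReal.ofReal_mul (by positivity), show 12/l*l = 12 by field_simp, show ENNReal.ofReal 12 = 12 by simp]

variable (μ : Measure E) [μ.IsAddRightInvariant] [SFinite μ]

lemma meas_UU (k : ℕ) {A : E → V} (L : ℝ) (hAc : Continuous A) {f : E → ℝ} (hf : Measurable f) (w : E) (l0 : ℝ) (i : ℕ) :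
    Measurable (UU k A L f w l0 i) := by
  have m1 := meas_NN hf w l0 i
  have m2 := meas_NN hf (-w) l0 i
  have m3 := meas_av hf w (l0*2^i)
  have m4 := meas_av hf (-w) (l0*2^i)
  have m5 := meas_av hf w (l0*2^i*2)
  have m6 := meas_Err hAc w (l0*2^i)
  have m7 := meas_Err hAc (-w) (l0*2^i)
  have m8 := meas_bq hAc w (l0*2^i)
  unfold UU
  fun_prop

/-- The final one-directional constant. -/
def C3 (k : ℕ) : ℝ := 12 * (2 * (2 * C1 k * 20 + 2 * C2 k * 336) + (72*(k+3)^2 + 4))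

lemma C3_pos (k : ℕ) : 0 < C3 k := by
  have c1 := C1_pos k
  have c2 := C2_pos k
  unfold C3; positivity

lemma sum_UU (k : ℕ) {A : E → V} {L : ℝ} (hL : 0 ≤ L) (hA : ∀ x y, ‖A x - A y‖ ≤ L * ‖x - y‖) (hAc : Continuous A)
    {f : E → ℝ} (hf : Measurable f) {M : ℝ} (hM : ∀ x, |f x| ≤ M) {w : E} (hw : ‖w‖ = 1) {l0 : ℝ} (hl0 : 0 < l0) (I : ℕ) :
    ∑ i ∈ Finset.range I, ∫⁻ x, UU k A L f w l0 i x ∂μ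
      ≤ ENNReal.ofReal (C3 k * L^2) * ∫⁻ x, ENNReal.ofReal ((f x)^2) ∂μ := by
  have c1 := C1_pos k
  have c2 := C2_pos k
  have hw' : ‖-w‖ = 1 := by rw [norm_neg, hw]
  set F2 := ∫⁻ x, ENNReal.ofReal ((f x)^2) ∂μ with hF2
  have e : ∀ i, ∫⁻ x, UU k A L f w l0 i x ∂μ =
    12 * ((ENNReal.ofReal (2 * C1 k * L^2) * (∫⁻ x, NN f w l0 i x ∂μ)
      + ENNReal.ofReal (2 * C2 k) * (∫⁻ x, ENNReal.ofReal ((av f w (l0*2^i) x)^2 * Err A w (l0*2^i) x) ∂μ))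
    + (ENNReal.ofReal (2 * C1 k * L^2) * (∫⁻ x, NN f (-w) l0 i x ∂μ)
      + ENNReal.ofReal (2 * C2 k) * (∫⁻ x, ENNReal.ofReal ((av f (-w) (l0*2^i) x)^2 * Err A (-w) (l0*2^i) x) ∂μ))
    + (ENNReal.ofReal ((k+3)^2) * (∫⁻ x, ENNReal.ofReal (‖bq A w (l0*2^i) (x + (l0*2^i) • w) - bq A w (l0*2^i) x‖^2
        * (av f w (l0*2^i*2) x)^2) ∂μ)
      + ENNReal.ofReal (L^2) * (∫⁻ x, ENNReal.ofReal ((av f w (l0*2^i) (x + (l0*2^i) • w) - av f w (l0*2^i) x)^2) ∂μ))) := by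
    intro i
    have m1 := meas_NN hf w l0 i
    have m2 := meas_NN hf (-w) l0 i
    have m3 := meas_av hf w (l0*2^i)
    have m4 := meas_av hf (-w) (l0*2^i)
    have m5 := meas_av hf w (l0*2^i*2)
    have m6 := meas_Err hAc w (l0*2^i)
    have m7 := meas_Err hAc (-w) (l0*2^i)
    have m8 := meas_bq hAc w (l0*2^i)
    unfold UU
    rw [lintegral_const_mul _ (by fun_prop), lintegral_add_left (by fun_prop), lintegral_add_left (by fun_prop),
      lintegral_add_left (by fun_prop), lintegral_add_left (by fun_prop), lintegral_add_left (by fun_prop),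
      lintegral_const_mul _ (by fun_prop), lintegral_const_mul _ (by fun_prop), lintegral_const_mul _ (by fun_prop),
      lintegral_const_mul _ (by fun_prop), lintegral_const_mul _ (by fun_prop), lintegral_const_mul _ (by fun_prop)]
    rw [lintegral_add_right_eq_self (fun x => ENNReal.ofReal (‖bq A w (l0*2^i) (x + (l0*2^i) • w) - bq A w (l0*2^i) x‖^2
        * (av f w (l0*2^i*2) x)^2)) (-((l0*2^i) • w)),
      lintegral_add_right_eq_self (fun x => ENNReal.ofReal ((av f w (l0*2^i) (x + (l0*2^i) • w) - av f w (l0*2^i) x)^2)) (-((l0*2^i) • w))]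
  simp_rw [e]
  rw [← Finset.mul_sum, Finset.sum_add_distrib, Finset.sum_add_distrib, Finset.sum_add_distrib, Finset.sum_add_distrib,
    Finset.sum_add_distrib, ← Finset.mul_sum, ← Finset.mul_sum, ← Finset.mul_sum, ← Finset.mul_sum, ← Finset.mul_sum, ← Finset.mul_sum]
  calc _ ≤ 12 * ((ENNReal.ofReal (2 * C1 k * L^2) * (20 * F2) + ENNReal.ofReal (2 * C2 k) * (ENNReal.ofReal (336*L^2) * F2))
    + (ENNReal.ofReal (2 * C1 k * L^2) * (20 * F2) + ENNReal.ofReal (2 * C2 k) * (ENNReal.ofReal (336*L^2) * F2))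
    + (ENNReal.ofReal ((k+3)^2) * (ENNReal.ofReal (72*L^2) * F2) + ENNReal.ofReal (L^2) * (4 * F2))) := by
        gcongr
        · exact sum_NN μ hf hM w hl0 I
        · exact sum_W μ hL hA hAc hf hM hw hl0 I
        · exact sum_NN μ hf hM (-w) hl0 I
        · exact sum_W μ hL hA hAc hf hM hw' hl0 I
        · exact sum_beta μ hL hA hAc hf hM hw hl0 I
        · exact sum_dav μ hf hM w hl0 I
    _ = _ := by
      unfold C3
      rw [show 12 * (2 * (2 * C1 k * 20 + 2 * C2 k * 336) + (72*((k:ℝ)+3)^2 + 4)) * L^2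
        = 12 * ((2 * C1 k * L^2 * 20 + 2 * C2 k * (336 * L^2)) + (2 * C1 k * L^2 * 20 + 2 * C2 k * (336 * L^2))
          + (((k:ℝ)+3)^2 * (72 * L^2) + L^2 * 4)) by ring]
      rw [ENNReal.ofReal_mul (p := 12) (by norm_num), ENNReal.ofReal_add (by positivity) (by positivity),
        ENNReal.ofReal_add (by positivity) (by positivity), ENNReal.ofReal_add (by positivity) (by positivity),
        ENNReal.ofReal_add (by positivity) (by positivity),
        ENNReal.ofReal_mul (p := 2 * C1 k * L^2) (by positivity), ENNReal.ofReal_mul (p := 2 * C2 k) (by positivity),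
        ENNReal.ofReal_mul (p := ((k:ℝ)+3)^2) (by positivity), ENNReal.ofReal_mul (p := L^2) (by positivity)]
      simp only [ENNReal.ofReal_ofNat]
      ring

lemma cover (l0 : ℝ) (hl0 : 0 < l0) : Ioi (l0/4) ⊆ ⋃ i : ℕ, Ioc (l0*2^i/4) (l0*2^i/2) := by
  intro t ht
  have ht' : l0/4 < t := ht
  have hex : ∃ i : ℕ, t ≤ l0*2^i/2 := by
    obtain ⟨i, hi⟩ := pow_unbounded_of_one_lt (2*t/l0) (one_lt_two)
    rw [div_lt_iff₀ hl0] at hi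
    exact ⟨i, by linarith⟩
  classical
  rw [mem_iUnion]
  refine ⟨Nat.find hex, ?_, Nat.find_spec hex⟩
  rcases h : Nat.find hex with _ | j
  · simpa using ht'
  · have := Nat.find_min hex (m := j) (by omega)
    push Not at this
    rw [pow_succ]; linarith

lemma dir_bound0 (k : ℕ) {A : E → V} {L : ℝ} (hL : 0 ≤ L) (hA : ∀ x y, ‖A x - A y‖ ≤ L * ‖x - y‖) (hAc : Continuous A)
    {f : E → ℝ} (hf : Measurable f) {M : ℝ} (hM : ∀ x, |f x| ≤ M) {w : E} (hw : ‖w‖ = 1) {l0 : ℝ} (hl0 : 0 < l0)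
    (hPm : ∀ x w, Measurable (fun t => Pk k A f w x t)) :
    ∫⁻ x, ∫⁻ t in Ioi (l0/4), ENNReal.ofReal (‖Pk k A f w x t + Pk k A f (-w) x t‖^2 / t) ∂volume ∂μ
      ≤ ENNReal.ofReal (C3 k * L^2) * ∫⁻ x, ENNReal.ofReal ((f x)^2) ∂μ := by
  calc _ ≤ ∫⁻ x, ∑' i, UU k A L f w l0 i x ∂μ := by
        refine lintegral_mono fun x => ?_
        refine (lintegral_mono_set (cover l0 hl0)).trans ((lintegral_iUnion_le _ _).trans ?_)
        exact ENNReal.tsum_le_tsum fun i => level k hL hA hAc hf hM hw hl0 i x (hPm x)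
    _ = ∑' i, ∫⁻ x, UU k A L f w l0 i x ∂μ := lintegral_tsum fun i => (meas_UU k L hAc hf w l0 i).aemeasurable
    _ ≤ _ := ENNReal.tsum_le_of_sum_range_le fun I => sum_UU μ k hL hA hAc hf hM hw hl0 I

lemma meas_Pk {X : Type*} [MeasurableSpace X] (k : ℕ) {A : E → V} (hAc : Continuous A) {f : E → ℝ} (hf : Measurable f)
    {w x : X → E} {t : X → ℝ} (hw : Measurable w) (hx : Measurable x) (ht : Measurable t) :
    Measurable (fun z => Pk k A f (w z) (x z) (t z)) := by
  unfold Pk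
  refine (StronglyMeasurable.integral_prod_right
    (f := fun z r => f (x z + r • w z) • kap0 k (A (x z + r • w z) - A (x z)) r (t z)) ?_).measurable
  apply Measurable.stronglyMeasurable
  have hA := hAc.measurable
  have h1 : Measurable (fun p : X × ℝ => f (x p.1 + p.2 • w p.1)) := by fun_prop
  refine h1.smul (meas_kap0 k ?_ measurable_snd (ht.comp measurable_fst))
  fun_prop

/-- The one-directional square function bound. -/
lemma dir_bound (k : ℕ) {A : E → V} {L : ℝ} (hL : 0 ≤ L) (hA : ∀ x y, ‖A x - A y‖ ≤ L * ‖x - y‖) (hAc : Continuous A)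
    {f : E → ℝ} (hf : Measurable f) {M : ℝ} (hM : ∀ x, |f x| ≤ M) {w : E} (hw : ‖w‖ = 1) :
    ∫⁻ x, ∫⁻ t in Ioi (0:ℝ), ENNReal.ofReal (‖Pk k A f w x t + Pk k A f (-w) x t‖^2 / t) ∂volume ∂μ
      ≤ ENNReal.ofReal (C3 k * L^2) * ∫⁻ x, ENNReal.ofReal ((f x)^2) ∂μ := by
  set l : ℕ → ℝ := fun n => 1/((n:ℝ)+1) with hl
  have hl0 : ∀ n, 0 < l n := fun n => by simp only [hl]; positivity
  have hanti : Antitone l := fun m n h => by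
    simp only [hl]; gcongr
  have hU : Ioi (0:ℝ) = ⋃ n, Ioi (l n/4) := by
    ext t; simp only [mem_Ioi, mem_iUnion]
    constructor
    · intro ht
      obtain ⟨n, hn⟩ := exists_nat_one_div_lt (show 0 < 4*t by linarith)
      exact ⟨n, by simp only [hl]; linarith⟩
    · rintro ⟨n, hn⟩; have := hl0 n; linarith
  have hmon : Monotone (fun n => Ioi (l n/4)) := fun m n h => Ioi_subset_Ioi (by have := hanti h; linarith)
  have e : ∀ x, ∫⁻ t in Ioi (0:ℝ), ENNReal.ofReal (‖Pk k A f w x t + Pk k A f (-w) x t‖^2 / t)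
      = ⨆ n, ∫⁻ t in Ioi (l n/4), ENNReal.ofReal (‖Pk k A f w x t + Pk k A f (-w) x t‖^2 / t) := by
    intro x
    rw [hU, setLIntegral_iUnion_of_directed _ hmon.directed_le]
  simp_rw [e]
  rw [lintegral_iSup]
  · refine iSup_le fun n => ?_
    exact dir_bound0 μ k hL hA hAc hf hM hw (hl0 n) (fun x w => meas_Pk k hAc hf measurable_const measurable_const measurable_id)
  · intro n
    have h1 : Measurable (fun p : E × ℝ => Pk k A f w p.1 p.2) := meas_Pk k hAc hf measurable_const measurable_fst measurable_snd
    have h2 : Measurable (fun p : E × ℝ => Pk k A f (-w) p.1 p.2) := meas_Pk k hAc hf measurable_const measurable_fst measurable_snd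
    have h3 : Measurable (fun p : E × ℝ => ENNReal.ofReal (‖Pk k A f w p.1 p.2 + Pk k A f (-w) p.1 p.2‖^2 / p.2)) := by
      fun_prop
    exact h3.lintegral_prod_right'
  · intro m n h x
    exact lintegral_mono_set (hmon h)
end Lev

section Polar
variable {E V : Type*} [NormedAddCommGroup E] [NormedSpace ℝ E] [MeasurableSpace E] [BorelSpace E]
  [FiniteDimensional ℝ E] [Nontrivial E]
  [NormedAddCommGroup V] [NormedSpace ℝ V] [CompleteSpace V]

lemma polar (μ : Measure E) [μ.IsAddHaarMeasure] {F : E → V} (hF : Integrable F μ) :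
    Integrable (fun θ : sphere (0:E) 1 => ∫ r in Ioi (0:ℝ), r^(Module.finrank ℝ E - 1) • F (r • (θ:E))) μ.toSphere ∧
    ∫ z, F z ∂μ = ∫ θ : sphere (0:E) 1, ∫ r in Ioi (0:ℝ), r^(Module.finrank ℝ E - 1) • F (r • (θ:E)) ∂volume ∂μ.toSphere := by
  have hmp := μ.measurePreserving_homeomorphUnitSphereProd
  have hemb := (homeomorphUnitSphereProd E).measurableEmbedding
  set G : sphere (0:E) 1 × Ioi (0:ℝ) → V := fun p => F (p.2.1 • (p.1:E)) with hG
  have hGF : ∀ z : ({0}ᶜ : Set E), G (homeomorphUnitSphereProd E z) = F z := by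
    intro z
    have : ‖(z:E)‖ ≠ 0 := norm_ne_zero_iff.2 z.2
    simp [hG, smul_smul, this]
  have hIntg : Integrable G (μ.toSphere.prod (.volumeIoiPow (Module.finrank ℝ E - 1))) := by
    rw [← hmp.integrable_comp_emb hemb]
    have : G ∘ (homeomorphUnitSphereProd E) = fun z : ({0}ᶜ : Set E) => F z := funext hGF
    rw [this]
    have h2 := integrableOn_iff_comap_subtypeVal (μ := μ) (f := F) (measurableSet_singleton (0:E)).compl
    exact h2.1 hF.integrableOn
  have hin : ∀ θ : sphere (0:E) 1, ∫ r, G (θ, r) ∂(Measure.volumeIoiPow (Module.finrank ℝ E - 1))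
      = ∫ r in Ioi (0:ℝ), r^(Module.finrank ℝ E - 1) • F (r • (θ:E)) := by
    intro θ
    simp only [Measure.volumeIoiPow, ENNReal.ofReal]
    rw [integral_withDensity_eq_integral_smul]
    · simp only [hG]
      rw [integral_subtype_comap measurableSet_Ioi fun a : ℝ ↦ Real.toNNReal (a ^ (Module.finrank ℝ E - 1)) • F (a • (θ:E)),
        setIntegral_congr_fun measurableSet_Ioi fun x hx ↦ ?_]
      rw [NNReal.smul_def, Real.coe_toNNReal _ (pow_nonneg hx.out.le _)]
    · exact (measurable_subtype_coe.pow_const _).real_toNNReal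
  have e : ∫ z, F z ∂μ = ∫ p, G p ∂(μ.toSphere.prod (.volumeIoiPow (Module.finrank ℝ E - 1))) := by
    rw [← hmp.integral_comp hemb]
    simp_rw [hGF]
    rw [integral_subtype_comap (measurableSet_singleton _).compl fun x ↦ F x, restrict_compl_singleton]
  constructor
  · have := hIntg.integral_prod_left
    simp_rw [hin] at this
    exact this
  · rw [e, integral_prod _ hIntg]
    simp_rw [hin]
end Polar

section Full
variable {E V : Type*} [NormedAddCommGroup E] [NormedSpace ℝ E] [MeasurableSpace E] [BorelSpace E]
  [FiniteDimensional ℝ E] [Nontrivial E]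
  [NormedAddCommGroup V] [InnerProductSpace ℝ V] [MeasurableSpace V] [BorelSpace V]
  [SecondCountableTopology V] [CompleteSpace V]

/-- Kernel on the full space. -/
def kE (k : ℕ) (D : V) (s t : ℝ) : V :=
  open Classical in if t < rho s D ∧ rho s D ≤ 2*t then ((rho s D)^(k+2))⁻¹ • D else 0

lemma meas_kE {X : Type*} [MeasurableSpace X] (k : ℕ) {D : X → V} {r t : X → ℝ} (hD : Measurable D)
    (hr : Measurable r) (ht : Measurable t) : Measurable (fun x => kE k (D x) (r x) (t x)) := by
  have h := meas_rho hr hD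
  unfold kE
  refine Measurable.ite ?_ ?_ measurable_const
  · exact (measurableSet_lt ht h).inter (measurableSet_le h (by fun_prop))
  · fun_prop

lemma kE_kap0 (k : ℕ) (D : V) (s t : ℝ) : s^k • kE k D s t = kap0 k D s t := by
  unfold kE kap0 Gk
  split_ifs
  · rw [smul_smul, div_eq_mul_inv]
  · simp

lemma kE_norm (k : ℕ) (D : V) (s : ℝ) {t : ℝ} (ht : 0 < t) : ‖kE k D s t‖ ≤ (t^(k+1))⁻¹ := by
  unfold kE
  split_ifs with h
  · have h0 : 0 < rho s D := ht.trans h.1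
    have h1 := rho_D s D
    rw [norm_smul, norm_inv, norm_pow, Real.norm_of_nonneg h0.le]
    calc _ ≤ (rho s D ^ (k+2))⁻¹ * rho s D := by gcongr
      _ = (rho s D ^ (k+1))⁻¹ := by field_simp; ring
      _ ≤ _ := by
        have := h.1.le
        gcongr
  · simp; positivity

/-- Full truncated operator. -/
def TT (μ : Measure E) (k : ℕ) (A : E → V) (f : E → ℝ) (x : E) (t : ℝ) : V :=
  ∫ z, f (x + z) • kE k (A (x + z) - A x) ‖z‖ t ∂μ

lemma TT_int (μ : Measure E) [μ.IsAddHaarMeasure] (k : ℕ) {A : E → V} (hAc : Continuous A)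
    {f : E → ℝ} (hf : Measurable f) {M : ℝ} (hM : ∀ x, |f x| ≤ M) (x : E) {t : ℝ} (ht : 0 < t) :
    Integrable (fun z => f (x + z) • kE k (A (x + z) - A x) ‖z‖ t) μ := by
  have hA := hAc.measurable
  have hm : Measurable (fun z => f (x + z) • kE k (A (x + z) - A x) ‖z‖ t) := by
    have h1 : Measurable (fun z => f (x + z)) := by fun_prop
    exact h1.smul (meas_kE k (by fun_prop) measurable_norm measurable_const)
  have hs : Function.support (fun z => f (x + z) • kE k (A (x + z) - A x) ‖z‖ t) ⊆ closedBall 0 (2*t) := by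
    intro z hz
    by_contra hc
    apply hz
    have hc : 2*t < ‖z‖ := by simpa using hc
    simp only [kE]
    rw [if_neg, smul_zero]
    rintro ⟨-, h⟩
    have := rho_r ‖z‖ (A (x+z) - A x)
    rw [abs_norm] at this
    linarith
  rw [← integrableOn_iff_integrable_of_support_subset hs]
  refine Measure.integrableOn_of_bounded (M := M * (t^(k+1))⁻¹) ?_ hm.aestronglyMeasurable ?_
  · exact (isCompact_closedBall (0:E) (2*t)).measure_lt_top.ne
  · refine Filter.Eventually.of_forall fun z => ?_
    rw [norm_smul]
    exact mul_le_mul (hM _) (kE_norm k _ _ ht) (norm_nonneg _) ((abs_nonneg _).trans (hM x))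

lemma TT_polar (μ : Measure E) [μ.IsAddHaarMeasure] {k : ℕ} (hk : k = Module.finrank ℝ E - 1) {A : E → V} (hAc : Continuous A)
    {f : E → ℝ} (hf : Measurable f) {M : ℝ} (hM : ∀ x, |f x| ≤ M) (x : E) {t : ℝ} (ht : 0 < t) :
    TT μ k A f x t = (1/2:ℝ) • ∫ θ : sphere (0:E) 1, (Pk k A f θ x t + Pk k A f (-θ) x t) ∂μ.toSphere := by
  have h := TT_int μ k hAc hf hM x ht
  have p1 := polar μ h
  have p2 := polar μ h.comp_neg
  have e1 : ∀ θ : sphere (0:E) 1, ∫ r in Ioi (0:ℝ), r^(Module.finrank ℝ E - 1) •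
      (f (x + r • (θ:E)) • kE k (A (x + r • (θ:E)) - A x) ‖r • (θ:E)‖ t) = Pk k A f θ x t := by
    intro θ
    refine setIntegral_congr_fun measurableSet_Ioi fun r hr => ?_
    have hr : 0 < r := hr
    have : ‖r • (θ:E)‖ = r := by simp [norm_smul, abs_of_pos hr]
    beta_reduce
    rw [this, smul_comm, ← hk, kE_kap0]
  have e2 : ∀ θ : sphere (0:E) 1, ∫ r in Ioi (0:ℝ), r^(Module.finrank ℝ E - 1) •
      (f (x + -(r • (θ:E))) • kE k (A (x + -(r • (θ:E))) - A x) ‖-(r • (θ:E))‖ t) = Pk k A f (-θ) x t := by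
    intro θ
    refine setIntegral_congr_fun measurableSet_Ioi fun r hr => ?_
    have hr : 0 < r := hr
    have : ‖-(r • (θ:E))‖ = r := by simp [norm_smul, abs_of_pos hr]
    beta_reduce
    rw [this, smul_comm, ← hk, kE_kap0, smul_neg]
  simp_rw [e1] at p1
  simp_rw [e2] at p2
  have e3 := integral_neg_eq_self (fun z => f (x + z) • kE k (A (x + z) - A x) ‖z‖ t) μ
  rw [p2.2] at e3
  rw [integral_add p1.1 p2.1, e3, ← p1.2, ← two_smul ℝ, smul_smul]
  norm_num [TT]

lemma meas_TT {X : Type*} [MeasurableSpace X] (μ : Measure E) [SFinite μ] (k : ℕ) {A : E → V} (hAc : Continuous A) {f : E → ℝ} (hf : Measurable f)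
    {x : X → E} {t : X → ℝ} (hx : Measurable x) (ht : Measurable t) :
    Measurable (fun z => TT μ k A f (x z) (t z)) := by
  unfold TT
  refine (StronglyMeasurable.integral_prod_right
    (f := fun z y => f (x z + y) • kE k (A (x z + y) - A (x z)) ‖y‖ (t z)) ?_).measurable
  apply Measurable.stronglyMeasurable
  have hA := hAc.measurable
  have h1 : Measurable (fun p : X × E => f (x p.1 + p.2)) := by fun_prop
  refine h1.smul (meas_kE k ?_ measurable_snd.norm (ht.comp measurable_fst))
  fun_prop

lemma TT_bound (μ : Measure E) [μ.IsAddHaarMeasure] {k : ℕ} (hk : k = Module.finrank ℝ E - 1) {A : E → V} {L : ℝ} (hL : 0 ≤ L)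
    (hA : ∀ x y, ‖A x - A y‖ ≤ L * ‖x - y‖) (hAc : Continuous A)
    {f : E → ℝ} (hf : Measurable f) {M : ℝ} (hM : ∀ x, |f x| ≤ M) :
    ∫⁻ x, ∫⁻ t in Ioi (0:ℝ), ENNReal.ofReal (‖TT μ k A f x t‖^2 / t) ∂volume ∂μ
      ≤ (μ.toSphere univ)^2 * (ENNReal.ofReal (C3 k * L^2) * ∫⁻ x, ENNReal.ofReal ((f x)^2) ∂μ) := by
  set σ := μ.toSphere
  set P : E → ℝ → sphere (0:E) 1 → V := fun x t θ => Pk k A f θ x t + Pk k A f (-θ) x t with hP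
  have hPm : Measurable (fun p : (E × ℝ) × sphere (0:E) 1 => P p.1.1 p.1.2 p.2) := by
    refine Measurable.add ?_ ?_
    · exact meas_Pk k hAc hf (measurable_subtype_coe.comp measurable_snd) (by fun_prop) (by fun_prop)
    · exact meas_Pk k hAc hf (measurable_subtype_coe.comp measurable_snd).neg (by fun_prop) (by fun_prop)
  set Q : E → ℝ → sphere (0:E) 1 → ℝ≥0∞ := fun x t θ => ENNReal.ofReal (‖P x t θ‖^2 / t) with hQ
  have hQm : Measurable (fun p : (E × ℝ) × sphere (0:E) 1 => Q p.1.1 p.1.2 p.2) := by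
    exact ENNReal.measurable_ofReal.comp ((hPm.norm.pow_const 2).div (by fun_prop))
  have hpt : ∀ x, ∀ t ∈ Ioi (0:ℝ), ENNReal.ofReal (‖TT μ k A f x t‖^2 / t) ≤ σ univ * ∫⁻ θ, Q x t θ ∂σ := by
    intro x t ht
    have ht : 0 < t := ht
    have hPm' : Measurable (P x t) := hPm.comp (f := fun θ : sphere (0:E) 1 => ((x, t), θ)) (by fun_prop)
    have h1 := cs_vec σ (fun _ => 1) (P x t) measurable_const hPm'
    simp only [one_smul, one_pow, ENNReal.ofReal_one, lintegral_const, one_mul] at h1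
    have h2 : ‖TT μ k A f x t‖^2 ≤ ‖∫ θ, P x t θ ∂σ‖^2 := by
      rw [TT_polar μ hk hAc hf hM x ht, norm_smul, mul_pow]
      have := sq_nonneg ‖∫ θ, P x t θ ∂σ‖
      norm_num
      linarith
    calc _ ≤ ENNReal.ofReal (‖∫ θ, P x t θ ∂σ‖^2 / t) := by gcongr
      _ = ENNReal.ofReal (‖∫ θ, P x t θ ∂σ‖^2) * ENNReal.ofReal (t⁻¹) := by
        rw [← ENNReal.ofReal_mul (by positivity), div_eq_mul_inv]
      _ ≤ (σ univ * ∫⁻ θ, ENNReal.ofReal (‖P x t θ‖^2) ∂σ) * ENNReal.ofReal (t⁻¹) := by gcongr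
      _ = σ univ * ∫⁻ θ, Q x t θ ∂σ := by
        rw [mul_assoc, ← lintegral_mul_const _ (by fun_prop)]
        congr 2; ext θ
        rw [← ENNReal.ofReal_mul (by positivity), ← div_eq_mul_inv]
  calc _ ≤ ∫⁻ x, ∫⁻ t in Ioi (0:ℝ), σ univ * ∫⁻ θ, Q x t θ ∂σ ∂volume ∂μ := by
        refine lintegral_mono fun x => setLIntegral_mono' measurableSet_Ioi (hpt x)
    _ = σ univ * ∫⁻ x, ∫⁻ t in Ioi (0:ℝ), ∫⁻ θ, Q x t θ ∂σ ∂volume ∂μ := by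
        have hm := hQm.lintegral_prod_right' (ν := σ)
        have hm2 : Measurable (fun x => ∫⁻ t in Ioi (0:ℝ), ∫⁻ θ, Q x t θ ∂σ) := hm.lintegral_prod_right'
        rw [← lintegral_const_mul _ hm2]
        congr 1; ext x
        rw [lintegral_const_mul]
        exact hm.comp (f := fun t : ℝ => (x, t)) (by fun_prop)
    _ = σ univ * ∫⁻ θ, ∫⁻ x, ∫⁻ t in Ioi (0:ℝ), Q x t θ ∂volume ∂μ ∂σ := by
        congr 1
        have : ∀ x, ∫⁻ t in Ioi (0:ℝ), ∫⁻ θ, Q x t θ ∂σ = ∫⁻ θ, ∫⁻ t in Ioi (0:ℝ), Q x t θ ∂volume ∂σ := by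
          intro x
          apply lintegral_lintegral_swap
          exact (hQm.comp (f := fun q : ℝ × sphere (0:E) 1 => ((x, q.1), q.2)) (by fun_prop)).aemeasurable
        simp_rw [this]
        apply lintegral_lintegral_swap
        have : Measurable (fun q : (E × sphere (0:E) 1) × ℝ => Q q.1.1 q.2 q.1.2) :=
          hQm.comp (f := fun q : (E × sphere (0:E) 1) × ℝ => ((q.1.1, q.2), q.1.2)) (by fun_prop)
        exact (this.lintegral_prod_right' (ν := volume.restrict (Ioi 0))).aemeasurable
    _ ≤ σ univ * ∫⁻ θ, (ENNReal.ofReal (C3 k * L^2) * ∫⁻ x, ENNReal.ofReal ((f x)^2) ∂μ) ∂σ := by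
        gcongr with θ
        exact dir_bound μ k hL hA hAc hf hM (by simp)
    _ = _ := by
        rw [lintegral_const]; ring
end Full

/-- First coordinates. -/
def headP (n d : ℕ) (hnd : n ≤ d) : EuclideanSpace ℝ (Fin d) →ₗ[ℝ] EuclideanSpace ℝ (Fin n) where
  toFun z := WithLp.toLp 2 (fun i : Fin n => z ⟨i, by have := i.isLt; omega⟩)
  map_add' x y := by ext i; simp
  map_smul' c x := by ext i; simp

/-- Last coordinates. -/
def tailP (n d : ℕ) : EuclideanSpace ℝ (Fin d) →ₗ[ℝ] EuclideanSpace ℝ (Fin (d - n)) where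
  toFun z := WithLp.toLp 2 (fun i : Fin (d-n) => z ⟨n + i, by have := i.isLt; omega⟩)
  map_add' x y := by ext i; simp
  map_smul' c x := by ext i; simp

lemma sum_split (n m d : ℕ) (h : d = n + m) (g : Fin d → ℝ) :
    ∑ i, g i = ∑ i : Fin n, g ⟨i, by have := i.isLt; omega⟩ + ∑ j : Fin m, g ⟨n + j, by have := j.isLt; omega⟩ := by
  subst h
  rw [Fin.sum_univ_add]; rfl

lemma norm_split (n d : ℕ) (hnd : n ≤ d) (z : EuclideanSpace ℝ (Fin d)) :
    ‖z‖^2 = ‖headP n d hnd z‖^2 + ‖tailP n d z‖^2 := by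
  rw [EuclideanSpace.real_norm_sq_eq, EuclideanSpace.real_norm_sq_eq, EuclideanSpace.real_norm_sq_eq,
    sum_split n (d-n) d (by omega)]
  rfl

lemma head_graph (n d : ℕ) (hnd : n ≤ d) (A : EuclideanSpace ℝ (Fin n) → EuclideanSpace ℝ (Fin (d - n))) (x) :
    headP n d hnd (graphMap n d hnd A x) = x := by
  ext i; simp [headP, graphMap]

lemma tail_graph (n d : ℕ) (hnd : n ≤ d) (A : EuclideanSpace ℝ (Fin n) → EuclideanSpace ℝ (Fin (d - n))) (x) :
    tailP n d (graphMap n d hnd A x) = A x := by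
  ext i; simp [tailP, graphMap]

lemma norm_projPerp (n d : ℕ) (hnd : n ≤ d) (z : EuclideanSpace ℝ (Fin d)) : ‖projPerp n d z‖ = ‖tailP n d z‖ := by
  have h1 : headP n d hnd (projPerp n d z) = 0 := by ext i; simp [headP, projPerp]
  have h2 : tailP n d (projPerp n d z) = tailP n d z := by ext i; simp [tailP, projPerp]
  have := norm_split n d hnd (projPerp n d z)
  rw [h1, h2] at this
  rw [← sq_eq_sq₀ (norm_nonneg _) (norm_nonneg _)]
  simpa using this

section Tr
variable {n d : ℕ} (hnd : n ≤ d) {A : EuclideanSpace ℝ (Fin n) → EuclideanSpace ℝ (Fin (d - n))}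

lemma dist_graph (x z : EuclideanSpace ℝ (Fin n)) :
    ‖graphMap n d hnd A x - graphMap n d hnd A (x + z)‖ = rho ‖z‖ (A (x + z) - A x) := by
  have := norm_split n d hnd (graphMap n d hnd A x - graphMap n d hnd A (x + z))
  rw [map_sub, map_sub, head_graph, head_graph, tail_graph, tail_graph, norm_sub_rev x, norm_sub_rev (A x),
    add_sub_cancel_left] at this
  rw [rho, ← this, Real.sqrt_sq (norm_nonneg _)]

lemma graph_cont (hAc : Continuous A) : Continuous (graphMap n d hnd A) := by
  unfold graphMap
  refine (PiLp.continuous_toLp 2 _).comp (continuous_pi fun i => ?_)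
  split_ifs
  · fun_prop
  · fun_prop

lemma graph_emb (hAc : Continuous A) : MeasurableEmbedding (graphMap n d hnd A) := by
  refine (graph_cont hnd hAc).measurableEmbedding fun x y h => ?_
  rw [← head_graph n d hnd A x, h, head_graph]

lemma tr_int (hAc : Continuous A)
    {f : EuclideanSpace ℝ (Fin n) → ℝ} (hf : Measurable f) {M : ℝ} (hM : ∀ x, |f x| ≤ M) (x) {t : ℝ} (ht : 0 < t) :
    Integrable (fun z => open Classical in if t < rho ‖z‖ (A (x + z) - A x) ∧ rho ‖z‖ (A (x + z) - A x) ≤ 2*t then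
      f (x + z) • rieszKernel d n (graphMap n d hnd A x) (graphMap n d hnd A (x + z)) else 0) volume := by
  set F := (fun z => open Classical in if t < rho ‖z‖ (A (x + z) - A x) ∧ rho ‖z‖ (A (x + z) - A x) ≤ 2*t then
      f (x + z) • rieszKernel d n (graphMap n d hnd A x) (graphMap n d hnd A (x + z)) else 0) with hF
  have hA := hAc.measurable
  have hG := (graph_cont hnd hAc).measurable
  have hD : Measurable (fun z => A (x + z) - A x) := by fun_prop
  have h := meas_rho measurable_norm hD
  have hm : Measurable F := by
    refine Measurable.ite ?_ ?_ measurable_const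
    · exact (measurableSet_lt measurable_const h).inter (measurableSet_le h (by fun_prop))
    · have h1 : Measurable (fun z => f (x + z)) := by fun_prop
      refine h1.smul ?_
      unfold rieszKernel
      fun_prop
  have hs : Function.support F ⊆ closedBall 0 (2*t) := by
    intro z hz
    by_contra hc
    apply hz
    have hc : 2*t < ‖z‖ := by simpa using hc
    simp only [hF]
    rw [if_neg]
    rintro ⟨-, h⟩
    have := rho_r ‖z‖ (A (x+z) - A x)
    rw [abs_norm] at this
    linarith
  rw [← integrableOn_iff_integrable_of_support_subset hs]
  refine Measure.integrableOn_of_bounded (M := M * (t^n)⁻¹) ?_ hm.aestronglyMeasurable ?_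
  · exact (isCompact_closedBall _ (2*t)).measure_lt_top.ne
  · refine Filter.Eventually.of_forall fun z => ?_
    have hM0 : 0 ≤ M := (abs_nonneg _).trans (hM x)
    simp only [hF]
    split_ifs with hc
    · rw [norm_smul, rieszKernel, norm_smul, dist_graph]
      have h0 : 0 < rho ‖z‖ (A (x + z) - A x) := ht.trans hc.1
      have hc1 := hc.1.le
      set ρ := rho ‖z‖ (A (x + z) - A x)
      have e : ‖ρ ^ (-((n:ℝ)+1))‖ * ρ = (ρ^n)⁻¹ := by
        rw [Real.norm_of_nonneg (by positivity), Real.rpow_neg h0.le]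
        have : ρ ^ ((n:ℝ)+1) = ρ^(n+1) := by exact_mod_cast Real.rpow_natCast ρ (n+1)
        rw [this]; field_simp; ring
      rw [e]
      exact mul_le_mul (hM _) (by gcongr) (by positivity) hM0
    · simp; positivity

lemma tr_eq (hn : 0 < n) (hAc : Continuous A) {f0 : EuclideanSpace ℝ (Fin d) → ℝ} (hf : Measurable f0) {M : ℝ}
    (hM : ∀ x, |f0 (graphMap n d hnd A x)| ≤ M) (x) {t : ℝ} (ht : 0 < t) :
    tailP n d (truncRieszF d n (Measure.map (graphMap n d hnd A) volume) f0 (graphMap n d hnd A x) t (2*t))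
      = - TT volume (n-1) A (fun y => f0 (graphMap n d hnd A y)) x t := by
  classical
  set G := graphMap n d hnd A with hG
  have hGm := (graph_cont hnd hAc).measurable
  have hIntg := tr_int hnd hAc (hf.comp hGm) hM x ht
  have e1 : truncRieszF d n (Measure.map G volume) f0 (G x) t (2*t)
      = ∫ z, (if t < rho ‖z‖ (A (x + z) - A x) ∧ rho ‖z‖ (A (x + z) - A x) ≤ 2*t then
      f0 (G (x + z)) • rieszKernel d n (G x) (G (x + z)) else 0) := by
    unfold truncRieszF
    rw [(graph_emb hnd hAc).setIntegral_map, ← integral_indicator]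
    · rw [← integral_add_left_eq_self _ x]
      congr 1; ext1 z
      simp only [indicator, mem_preimage, mem_ofPred_eq, dist_eq_norm]
      rw [dist_graph]
    · apply hGm
      have hd : Measurable (fun y : EuclideanSpace ℝ (Fin d) => dist (G x) y) := by fun_prop
      exact (measurableSet_lt measurable_const hd).inter (measurableSet_le hd measurable_const)
  rw [e1]
  have e2 := (LinearMap.toContinuousLinearMap (tailP n d)).integral_comp_comm hIntg
  have e3 := e2.symm
  simp only [LinearMap.coe_toContinuousLinearMap'] at e3
  refine (Eq.trans ?_ e3).trans ?_
  · rfl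
  rw [TT, ← integral_neg]
  congr 1; ext1 z
  unfold kE
  split_ifs with hc
  · have h0 : 0 < rho ‖z‖ (A (x + z) - A x) := ht.trans hc.1
    rw [map_smul, rieszKernel, map_smul, dist_graph, map_sub, tail_graph, tail_graph, Real.rpow_neg h0.le]
    set ρ := rho ‖z‖ (A (x + z) - A x)
    have : ρ ^ ((n:ℝ)+1) = ρ^(n-1+2) := by
      rw [show n - 1 + 2 = n + 1 by omega]; exact_mod_cast Real.rpow_natCast ρ (n+1)
    rw [this, ← smul_neg, ← smul_neg, neg_sub]
    rfl
  · simp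

/-- The double integral. -/
def DD (A : EuclideanSpace ℝ (Fin n) → EuclideanSpace ℝ (Fin (d - n))) (f : EuclideanSpace ℝ (Fin n) → ℝ) : ℝ≥0∞ :=
  ∫⁻ x, ∫⁻ t in Ioi (0:ℝ), ENNReal.ofReal (‖TT volume (n-1) A f x t‖^2 / t)

lemma l2_eq (hn : 0 < n) (hAc : Continuous A) {f0 : EuclideanSpace ℝ (Fin d) → ℝ} (hf : Measurable f0) {M : ℝ}
    (hM : ∀ x, |f0 (graphMap n d hnd A x)| ≤ M) :
    l2Norm (Measure.map (graphMap n d hnd A) volume) (sqFnPerpF n d (Measure.map (graphMap n d hnd A) volume) f0)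
      = (DD A (fun y => f0 (graphMap n d hnd A y))) ^ (1/2:ℝ) := by
  unfold l2Norm DD
  rw [(graph_emb hnd hAc).lintegral_map]
  congr 1
  refine lintegral_congr fun x => ?_
  unfold sqFnPerpF
  rw [← ENNReal.rpow_natCast, ← ENNReal.rpow_mul]
  norm_num
  refine setLIntegral_congr_fun measurableSet_Ioi fun t ht => ?_
  beta_reduce
  rw [norm_projPerp n d hnd, tr_eq hnd hn hAc hf hM x ht, norm_neg]

/-- Measure dt/t. -/
def nuT : Measure ℝ := (volume.restrict (Ioi (0:ℝ))).withDensity (fun t => ENNReal.ofReal (t⁻¹))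

instance : SFinite nuT := by unfold nuT; infer_instance

lemma DD_eq (hn : 0 < n) (hAc : Continuous A) {f : EuclideanSpace ℝ (Fin n) → ℝ} (hf : Measurable f) :
    (DD A f)^(1/2:ℝ) = eLpNorm (fun p : EuclideanSpace ℝ (Fin n) × ℝ => TT volume (n-1) A f p.1 p.2) 2 (volume.prod nuT) := by
  have : NeZero n := ⟨hn.ne'⟩
  have hm : Measurable (fun p : EuclideanSpace ℝ (Fin n) × ℝ => TT volume (n-1) A f p.1 p.2) :=
    meas_TT volume _ hAc hf measurable_fst measurable_snd
  rw [eLpNorm_eq_lintegral_rpow_enorm_toReal (by norm_num) (by norm_num)]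
  simp only [ENNReal.toReal_ofNat]
  congr 1
  rw [lintegral_prod _ (by fun_prop)]
  unfold DD
  refine lintegral_congr fun x => ?_
  have hm2 : Measurable (fun t => TT volume (n-1) A f x t) := meas_TT volume _ hAc hf measurable_const measurable_id
  rw [nuT, lintegral_withDensity_eq_lintegral_mul _ (by fun_prop) (by fun_prop)]
  refine setLIntegral_congr_fun measurableSet_Ioi fun t ht => ?_
  have ht : 0 < t := ht
  simp only [Pi.mul_apply]
  rw [← ofReal_norm, ENNReal.ofReal_rpow_of_nonneg (norm_nonneg _) (by norm_num), ← ENNReal.ofReal_mul (by positivity)]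
  congr 1
  rw [Real.rpow_two]; ring

lemma nuT_pos : ∀ᵐ p : EuclideanSpace ℝ (Fin n) × ℝ ∂(volume.prod nuT), 0 < p.2 := by
  have h : ∀ᵐ t ∂nuT, 0 < t := by
    unfold nuT
    exact (withDensity_absolutelyContinuous _ _).ae_le (ae_restrict_mem measurableSet_Ioi)
  exact Measure.quasiMeasurePreserving_snd.ae h

lemma mink (hn : 0 < n) (hAc : Continuous A) {f g h : EuclideanSpace ℝ (Fin n) → ℝ} (hf : Measurable f) (hg : Measurable g) (hh : Measurable h)
    {M : ℝ} (hfM : ∀ x, |f x| ≤ M) (hgM : ∀ x, |g x| ≤ M) (c : ℝ) (hc : |c| = 1) (hfg : ∀ x, h x = f x + c * g x) :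
    (DD A h)^(1/2:ℝ) ≤ (DD A f)^(1/2:ℝ) + (DD A g)^(1/2:ℝ) := by
  have : NeZero n := ⟨hn.ne'⟩
  rw [DD_eq hn hAc hf, DD_eq hn hAc hg, DD_eq hn hAc hh]
  have hmf : Measurable (fun p : EuclideanSpace ℝ (Fin n) × ℝ => TT volume (n-1) A f p.1 p.2) :=
    meas_TT volume _ hAc hf measurable_fst measurable_snd
  have hmg : Measurable (fun p : EuclideanSpace ℝ (Fin n) × ℝ => TT volume (n-1) A g p.1 p.2) :=
    meas_TT volume _ hAc hg measurable_fst measurable_snd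
  have e : (fun p : EuclideanSpace ℝ (Fin n) × ℝ => TT volume (n-1) A h p.1 p.2) =ᵐ[volume.prod nuT]
      (fun p => TT volume (n-1) A f p.1 p.2) + (c • fun p => TT volume (n-1) A g p.1 p.2) := by
    filter_upwards [nuT_pos] with p hp
    simp only [Pi.add_apply, Pi.smul_apply, TT]
    have i2 : Integrable (fun z => c • g (p.1 + z) • kE (n-1) (A (p.1 + z) - A p.1) ‖z‖ p.2) volume :=
      (TT_int volume _ hAc hg hgM p.1 hp).smul c
    rw [← integral_smul, ← integral_add (TT_int volume _ hAc hf hfM p.1 hp) i2]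
    congr 1; ext1 z
    rw [hfg, add_smul, mul_smul]
  rw [eLpNorm_congr_ae e]
  refine (eLpNorm_add_le hmf.aestronglyMeasurable (hmg.const_smul c).aestronglyMeasurable (by norm_num)).trans ?_
  rw [eLpNorm_const_smul]
  gcongr
  rw [← ofReal_norm, Real.norm_eq_abs, hc]; simp

end Tr

lemma sqrt_step (S : ℝ≥0∞) (hS : S ≠ ∞) {c L : ℝ} (hc : 0 ≤ c) (hL : 0 ≤ L) (I : ℝ≥0∞) :
    (S^2 * (ENNReal.ofReal (c * L^2) * I))^(1/2:ℝ) ≤ ENNReal.ofReal (S.toReal * √c + 1) * ENNReal.ofReal L * I^(1/2:ℝ) := by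
  rw [ENNReal.mul_rpow_of_nonneg _ _ (by norm_num), ENNReal.mul_rpow_of_nonneg _ _ (by norm_num), ← mul_assoc]
  refine mul_le_mul_left ?_ _
  have e1 : (S^2)^(1/2:ℝ) = ENNReal.ofReal S.toReal := by
    rw [ENNReal.ofReal_toReal hS, ← ENNReal.rpow_natCast, ← ENNReal.rpow_mul]; norm_num
  have e2 : (ENNReal.ofReal (c*L^2))^(1/2:ℝ) = ENNReal.ofReal (√c * L) := by
    rw [ENNReal.ofReal_rpow_of_nonneg (by positivity) (by norm_num), ← Real.sqrt_eq_rpow, Real.sqrt_mul hc, Real.sqrt_sq hL]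
  rw [e1, e2, ← ENNReal.ofReal_mul (by positivity), ← ENNReal.ofReal_mul (by positivity)]
  apply ENNReal.ofReal_le_ofReal
  rw [← mul_assoc]
  gcongr
  linarith

theorem stmt8 (n d : ℕ) (hn : 0 < n) (hnd : n ≤ d) :
    ∃ C : ℝ, 0 < C ∧
      ∀ (A : EuclideanSpace ℝ (Fin n) → EuclideanSpace ℝ (Fin (d - n))) (L : ℝ≥0),
        HasCompactSupport A →
        LipschitzWith L A →
        ∀ (h : EuclideanSpace ℝ (Fin d) → ℝ) (M : ℝ),
          Measurable h →
          (∀ z ∈ graphSet n d hnd A, 0 ≤ h z) →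
          (∀ z ∈ graphSet n d hnd A, h z ≤ M) →
          -- `μ₀ = Ã_♯(Lebesgue)` and `μ = h dμ₀`
          (l2Norm (Measure.map (graphMap n d hnd A) volume)
              (sqFnPerp n d (Measure.map (graphMap n d hnd A) volume))
            ≤ l2Norm (Measure.map (graphMap n d hnd A) volume)
                (sqFnPerpF n d (Measure.map (graphMap n d hnd A) volume) h)
              + l2Norm (Measure.map (graphMap n d hnd A) volume)
                  (sqFnPerpF n d (Measure.map (graphMap n d hnd A) volume) (fun y => h y - 1)) ∧
           l2Norm (Measure.map (graphMap n d hnd A) volume)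
              (sqFnPerpF n d (Measure.map (graphMap n d hnd A) volume) h)
            ≤ l2Norm (Measure.map (graphMap n d hnd A) volume)
                (sqFnPerp n d (Measure.map (graphMap n d hnd A) volume))
              + l2Norm (Measure.map (graphMap n d hnd A) volume)
                  (sqFnPerpF n d (Measure.map (graphMap n d hnd A) volume) (fun y => h y - 1)) ∧
           l2Norm (Measure.map (graphMap n d hnd A) volume)
              (sqFnPerpF n d (Measure.map (graphMap n d hnd A) volume) (fun y => h y - 1))
            ≤ ENNReal.ofReal C * (L : ℝ≥0∞) *
              eLpNorm (fun y => h y - 1) 2 (Measure.map (graphMap n d hnd A) volume)) := by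
  have : NeZero n := ⟨hn.ne'⟩
  set S := (volume : Measure (EuclideanSpace ℝ (Fin n))).toSphere univ with hS
  have hSf : S ≠ ∞ := measure_ne_top _ _
  refine ⟨S.toReal * √(C3 (n-1)) + 1, by positivity, ?_⟩
  intro A L _ hA h M hh h0 h1
  have hAc := hA.continuous
  have hAl : ∀ x y, ‖A x - A y‖ ≤ L * ‖x - y‖ := fun x y => by
    simpa [dist_eq_norm] using hA.dist_le_mul x y
  set G := graphMap n d hnd A with hG
  have hGm : Measurable G := (graph_cont hnd hAc).measurable
  have b0 : ∀ x, 0 ≤ h (G x) := fun x => h0 _ ⟨x, rfl⟩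
  have b1 : ∀ x, h (G x) ≤ M := fun x => h1 _ ⟨x, rfl⟩
  have hM0 : 0 ≤ M := (b0 0).trans (b1 0)
  have bh : ∀ x, |h (G x)| ≤ M + 1 := fun x => abs_le.2 ⟨by linarith [b0 x], by linarith [b1 x]⟩
  have bh1 : ∀ x, |h (G x) - 1| ≤ M + 1 := fun x => abs_le.2 ⟨by linarith [b0 x], by linarith [b1 x]⟩
  have bo : ∀ x : EuclideanSpace ℝ (Fin n), |(1:ℝ)| ≤ M + 1 := fun x => by rw [abs_one]; linarith
  have mh1 : Measurable (fun y => h y - 1) := hh.sub_const 1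
  have e0 : sqFnPerp n d (Measure.map G volume) = sqFnPerpF n d (Measure.map G volume) (fun _ => 1) := by
    ext x; simp only [sqFnPerp, sqFnPerpF, truncRiesz, truncRieszF, one_smul]
  rw [e0, l2_eq hnd hn hAc measurable_const bo, l2_eq hnd hn hAc hh bh, l2_eq hnd hn hAc mh1 bh1]
  refine ⟨?_, ?_, ?_⟩
  · exact mink hn hAc (hh.comp hGm) (mh1.comp hGm) measurable_const bh bh1 (-1) (by simp) (fun x => by simp)
  · exact mink hn hAc measurable_const (mh1.comp hGm) (hh.comp hGm) bo bh1 1 (by simp) (fun x => by simp)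
  · have hb := TT_bound (volume : Measure (EuclideanSpace ℝ (Fin n))) (k := n-1) (by simp) L.2 hAl hAc (mh1.comp hGm) bh1
    have e1 : eLpNorm (fun y => h y - 1) 2 (Measure.map G volume)
        = (∫⁻ x, ENNReal.ofReal ((h (G x) - 1)^2))^(1/2:ℝ) := by
      rw [eLpNorm_eq_lintegral_rpow_enorm_toReal (by norm_num) (by norm_num), (graph_emb hnd hAc).lintegral_map]
      simp only [ENNReal.toReal_ofNat]
      congr 1
      refine lintegral_congr fun x => ?_
      rw [← ofReal_norm, ENNReal.ofReal_rpow_of_nonneg (norm_nonneg _) (by norm_num), Real.rpow_two, Real.norm_eq_abs, sq_abs]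
    rw [e1]
    calc _ ≤ _ := ENNReal.rpow_le_rpow hb (by norm_num)
      _ ≤ _ := sqrt_step S hSf (C3_pos _).le L.2 _
      _ = _ := by
        congr 2
        exact ENNReal.ofReal_coe_nnreal
end
end

section
/- Let n ≤ d be positive integers and let μ be a positive finite Radon measure on ℝ^d such that 0 < θ^{n,*}_μ(x) < ∞ for μ-a.e. x and Sμ(x) < ∞ for μ-a.e. x. Then for every δ > 0 there exist a constant M = M(δ), a constant C(δ), and an open set H ⊂ ℝ^d with μ(H) ≤ δ such that: every ball B(x,r) with μ(B(x,r)) > M r^n is contained in H, and for every x ∈ ℝ^d and every ε > dist(x, ℝ^d \ H) one has S_ε μ(x) ≤ C(δ). -/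
open MeasureTheory Metric Set
open scoped ENNReal NNReal

noncomputable section

/-- Upper `s`-dimensional density. -/
def upperDensity (d : ℕ) (s : ℝ) (μ : Measure (EuclideanSpace ℝ (Fin d)))
    (x : EuclideanSpace ℝ (Fin d)) : ℝ≥0∞ :=
  Filter.limsup (fun r : ℝ => μ (closedBall x r) / ENNReal.ofReal (r ^ s))
    (nhdsWithin 0 (Ioi 0))

/-- The square function `S(f dμ)(x)`, as a value in `ℝ≥0∞`. -/
def sqFnF (d : ℕ) (s : ℝ) (μ : Measure (EuclideanSpace ℝ (Fin d)))
    (f : EuclideanSpace ℝ (Fin d) → ℝ) (x : EuclideanSpace ℝ (Fin d)) : ℝ≥0∞ :=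
  (∫⁻ t in Ioi (0:ℝ), ENNReal.ofReal (‖truncRieszF d s μ f x t (2*t)‖^2 / t)) ^ (1/2 : ℝ)

/-- The truncated square function `S_ε μ(x)`. -/
def sqFnTrunc (d : ℕ) (s : ℝ) (ε : ℝ) (μ : Measure (EuclideanSpace ℝ (Fin d)))
    (x : EuclideanSpace ℝ (Fin d)) : ℝ≥0∞ :=
  (∫⁻ t in Ioi ε, ENNReal.ofReal (‖truncRiesz d s μ x t (2*t)‖^2 / t)) ^ (1/2 : ℝ)


abbrev EE (d : ℕ) := EuclideanSpace ℝ (Fin d)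

lemma aux_kernel_eq (d n : ℕ) (x y : EE d) :
    rieszKernel d n x y = (‖x - y‖ ^ (n+1))⁻¹ • (x - y) := by
  unfold rieszKernel
  rw [Real.rpow_neg (norm_nonneg _)]
  congr 2
  rw [← Real.rpow_natCast]
  push_cast
  rfl

lemma aux_kernel_norm (d n : ℕ) (x y : EE d) (t : ℝ) (ht : 0 < t) (h : t < dist x y) :
    ‖rieszKernel d n x y‖ ≤ (t ^ n)⁻¹ := by
  rw [aux_kernel_eq, norm_smul, norm_inv, norm_pow, norm_norm]
  rw [dist_eq_norm] at h
  have h0 : 0 < ‖x - y‖ := ht.trans h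
  have : (‖x - y‖ ^ (n+1))⁻¹ * ‖x - y‖ = (‖x - y‖ ^ n)⁻¹ := by
    field_simp
    ring
  rw [this]
  gcongr

lemma aux_kernel_diff (d n : ℕ) (u v : EE d) (t ε : ℝ) (ht : 0 < t)
    (hu : t < ‖u‖) (hu2 : ‖u‖ ≤ 2 * t) (hv : t < ‖v‖) (hv2 : ‖v‖ ≤ 2 * t) (huv : ‖u - v‖ ≤ ε) :
    ‖(‖u‖ ^ (n+1))⁻¹ • u - (‖v‖ ^ (n+1))⁻¹ • v‖ ≤ (1 + (n+1) * 2^n) * (ε * (t ^ (n+1))⁻¹) := by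
  have hε : 0 ≤ ε := (norm_nonneg _).trans huv
  have h1 : (‖u‖ ^ (n+1))⁻¹ • u - (‖v‖ ^ (n+1))⁻¹ • v
    = (‖u‖ ^ (n+1))⁻¹ • (u - v) + ((‖u‖ ^ (n+1))⁻¹ - (‖v‖ ^ (n+1))⁻¹) • v := by
    module
  rw [h1]
  refine (norm_add_le _ _).trans ?_
  rw [norm_smul, norm_smul, norm_inv, norm_pow, norm_norm]
  set p := ‖u‖
  set q := ‖v‖
  have hp : 0 < p := ht.trans hu
  have hq : 0 < q := ht.trans hv
  have hpq : |q - p| ≤ ε := by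
    have := abs_norm_sub_norm_le v u
    rw [norm_sub_rev] at this
    exact this.trans huv
  have a1 : (p ^ (n+1))⁻¹ * ‖u - v‖ ≤ (t ^ (n+1))⁻¹ * ε := by
    gcongr
  have a2 : ‖(p ^ (n+1))⁻¹ - (q ^ (n+1))⁻¹‖ * q ≤ ((n+1) * 2^n) * (ε * (t ^ (n+1))⁻¹) := by
    have e1 : (p ^ (n+1))⁻¹ - (q ^ (n+1))⁻¹ = (q^(n+1) - p^(n+1)) * (p ^ (n+1))⁻¹ * (q ^ (n+1))⁻¹ := by
      field_simp
    have e2 := abs_pow_sub_pow_le q p (n+1)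
    have e3 : max |q| |p| ≤ 2 * t := by
      rw [abs_of_pos hp, abs_of_pos hq]; exact max_le hv2 hu2
    have e4 : |q^(n+1) - p^(n+1)| ≤ ε * (n+1) * (2*t)^n := by
      refine e2.trans ?_
      push_cast
      gcongr
    rw [e1, Real.norm_eq_abs, abs_mul, abs_mul, abs_of_pos (a := (p ^ (n+1))⁻¹) (by positivity), abs_of_pos (a := (q ^ (n+1))⁻¹) (by positivity)]
    have e5 : |q^(n+1) - p^(n+1)| * (p ^ (n+1))⁻¹ * (q ^ (n+1))⁻¹ * q = |q^(n+1) - p^(n+1)| * (p ^ (n+1))⁻¹ * (q ^ n)⁻¹ := by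
      field_simp
      ring
    rw [e5]
    calc _ ≤ (ε * (n+1) * (2*t)^n) * (t ^ (n+1))⁻¹ * (t ^ n)⁻¹ := by gcongr
      _ = _ := by
        field_simp
        ring
  calc _ ≤ _ := add_le_add a1 a2
    _ = _ := by ring

lemma aux_lint (m : ℕ) (hm : 0 < m) (c : ℝ) (hc : 0 < c) :
    ∫⁻ s in Ioi c, ENNReal.ofReal ((s ^ (m+1))⁻¹) = ENNReal.ofReal ((m * c ^ m)⁻¹) := by
  have hm1 : (1:ℝ) ≤ m := by exact_mod_cast hm
  have hlt : (-(m+1) : ℝ) < -1 := by linarith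
  have e : ∀ s ∈ Ioi c, (s ^ (m+1))⁻¹ = s ^ (-(m+1) : ℝ) := by
    intro s hs
    rw [Real.rpow_neg (hc.trans hs).le]
    congr 1
    rw [← Real.rpow_natCast]; push_cast; rfl
  rw [setLIntegral_congr_fun measurableSet_Ioi (fun s hs => by rw [e s hs])]
  rw [← ofReal_integral_eq_lintegral_ofReal (integrableOn_Ioi_rpow_of_lt hlt hc)]
  · rw [integral_Ioi_rpow_of_lt hlt hc]
    congr 1
    have : (-(m+1) + 1 : ℝ) = -(m:ℝ) := by ring
    rw [this, Real.rpow_neg hc.le, Real.rpow_natCast]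
    field_simp
  · filter_upwards [ae_restrict_mem measurableSet_Ioi] with s hs
    exact Real.rpow_nonneg (hc.trans hs).le _

/-- Points all of whose balls have bounded density. -/
def goodF (d n : ℕ) (μ : Measure (EE d)) (M : ℝ) : Set (EE d) :=
  {y | ∀ z r, 0 < r → y ∈ closedBall z r → μ (closedBall z r) ≤ ENNReal.ofReal (M * r^n)}

lemma aux_goodF_closed (d n : ℕ) (μ : Measure (EE d)) (M : ℝ) : IsClosed (goodF d n μ M) := by
  rw [← closure_subset_iff_isClosed]
  intro y hy z r hr hyz
  have key : ∀ η : ℝ, 0 < η → μ (closedBall z r) ≤ ENNReal.ofReal (M * (r + η)^n) := by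
    intro η hη
    obtain ⟨w, hw, hwy⟩ := Metric.mem_closure_iff.1 hy η hη
    refine (measure_mono (closedBall_subset_closedBall (by linarith : r ≤ r + η))).trans
      (hw z (r+η) (by linarith) ?_)
    rw [mem_closedBall] at hyz ⊢
    have := dist_triangle w y z
    rw [dist_comm] at hwy
    linarith
  have ht : Filter.Tendsto (fun η : ℝ => ENNReal.ofReal (M * (r + η)^n)) (nhdsWithin 0 (Ioi 0))
      (nhds (ENNReal.ofReal (M * r^n))) := by
    have hcont : Continuous (fun η : ℝ => ENNReal.ofReal (M * (r + η)^n)) := ENNReal.continuous_ofReal.comp (by fun_prop)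
    have := (hcont.tendsto 0).mono_left (nhdsWithin_le_nhds (s := Ioi 0))
    simpa using this
  refine ge_of_tendsto ht ?_
  filter_upwards [self_mem_nhdsWithin] with η hη using key η hη

lemma aux_goodF_of_dens (d n : ℕ) (μ : Measure (EE d)) [IsFiniteMeasure μ] (y : EE d)
    (h : upperDensity d n μ y < ⊤) : ∃ M : ℕ, y ∈ goodF d n μ M := by
  obtain ⟨K, hK1, hK2⟩ := ENNReal.lt_iff_exists_nnreal_btwn.1 h
  have h1 := Filter.eventually_lt_of_limsup_lt hK1
  obtain ⟨r0, hr0, h2⟩ := mem_nhdsGT_iff_exists_Ioo_subset.1 h1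
  have hr0 : 0 < r0 := hr0
  set L : ℝ := max K (μ.real univ / r0^n) with hL
  have hL0 : 0 ≤ L := le_max_of_le_left K.2
  have h3 : ∀ r, 0 < r → μ (closedBall y r) ≤ ENNReal.ofReal (L * r^n) := by
    intro r hr
    rcases lt_or_ge r r0 with hlt | hge
    · have h4 : μ (closedBall y r) / ENNReal.ofReal (r ^ (n:ℝ)) < K := h2 ⟨hr, hlt⟩
      rw [Real.rpow_natCast] at h4
      have hpos : 0 < r^n := by positivity
      rw [ENNReal.div_lt_iff (Or.inl (by simpa using hpos)) (Or.inl (by simp))] at h4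
      refine h4.le.trans ?_
      rw [ENNReal.ofReal_mul hL0]
      gcongr
      rw [← ENNReal.ofReal_coe_nnreal]
      exact ENNReal.ofReal_le_ofReal (le_max_left _ _)
    · refine (measure_mono (subset_univ _)).trans ?_
      rw [← ofReal_measureReal]
      apply ENNReal.ofReal_le_ofReal
      calc μ.real univ = μ.real univ / r0^n * r0^n := by field_simp
        _ ≤ L * r^n := by
          gcongr
          exact le_max_right _ _
  obtain ⟨M, hM⟩ := exists_nat_ge (L * 2^n)
  refine ⟨M, fun z r hr hyz => ?_⟩
  have hsub : closedBall z r ⊆ closedBall y (2*r) := by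
    apply closedBall_subset_closedBall'
    rw [mem_closedBall, dist_comm] at hyz
    linarith
  refine (measure_mono hsub).trans ((h3 (2*r) (by linarith)).trans ?_)
  apply ENNReal.ofReal_le_ofReal
  rw [mul_pow, ← mul_assoc]
  gcongr

/-- Neighbourhood of the boundary of the annulus. -/
def bdN (d : ℕ) (y : EE d) (ε t : ℝ) : Set (EE d) :=
  {z | |dist y z - t| ≤ ε ∨ |dist y z - 2 * t| ≤ ε}

lemma aux_bdN_meas (d : ℕ) (y : EE d) (ε t : ℝ) : MeasurableSet (bdN d y ε t) := by
  have h1 : IsClosed {z : EE d | |dist y z - t| ≤ ε} := isClosed_le (by fun_prop) (by fun_prop)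
  have h2 : IsClosed {z : EE d | |dist y z - 2 * t| ≤ ε} :=
    isClosed_le (by fun_prop) (by fun_prop)
  exact (h1.union h2).measurableSet

lemma aux_bdN_sub (d : ℕ) (y : EE d) (ε t : ℝ) (hεt : ε < t) (hε : 0 < ε) :
    bdN d y ε t ⊆ closedBall y (3 * t) := by
  intro z hz
  rw [mem_closedBall, dist_comm]
  rcases hz with h | h <;> linarith [(abs_le.1 h).2]

lemma aux_ann_meas (d : ℕ) (x : EE d) (t u : ℝ) :
    MeasurableSet {y : EE d | t < dist x y ∧ dist x y ≤ u} := by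
  have h1 : IsOpen {y : EE d | t < dist x y} := isOpen_lt (by fun_prop) (by fun_prop)
  have h2 : IsClosed {y : EE d | dist x y ≤ u} := isClosed_le (by fun_prop) (by fun_prop)
  exact h1.measurableSet.inter h2.measurableSet

lemma aux_kernel_integrable (d n : ℕ) (μ : Measure (EE d)) [IsFiniteMeasure μ] (x : EE d) (t : ℝ)
    (ht : 0 < t) : IntegrableOn (rieszKernel d n x) {y | t < dist x y ∧ dist x y ≤ 2 * t} μ := by
  have hm : Measurable (rieszKernel d n x) := by
    have : rieszKernel d n x = fun y => (‖x - y‖ ^ (n+1))⁻¹ • (x - y) := by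
      ext1 y; exact aux_kernel_eq d n x y
    rw [this]
    fun_prop
  refine Measure.integrableOn_of_bounded (M := (t^n)⁻¹) (measure_ne_top _ _)
    hm.aestronglyMeasurable ?_
  filter_upwards [ae_restrict_mem (aux_ann_meas d x t (2*t))] with y hy
  exact aux_kernel_norm d n x y t ht hy.1

lemma aux_diff (d n : ℕ) (μ : Measure (EE d)) [IsFiniteMeasure μ] (x y : EE d) (t ε : ℝ)
    (hε : 0 < ε) (hεt : ε < t) (hxy : dist x y < ε) :
    ‖truncRiesz d n μ x t (2*t) - truncRiesz d n μ y t (2*t)‖ ≤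
      (1 + (n+1) * 2^n) * (ε * (t ^ (n+1))⁻¹) * μ.real (closedBall y (3*t))
        + (t^n)⁻¹ * μ.real (bdN d y ε t) := by
  have ht : 0 < t := hε.trans hεt
  unfold truncRiesz
  rw [← integral_indicator (aux_ann_meas d x t (2*t)), ← integral_indicator (aux_ann_meas d y t (2*t)),
    ← integral_sub ((integrable_indicator_iff (aux_ann_meas d x t (2*t))).2 (aux_kernel_integrable d n μ x t ht))
     ((integrable_indicator_iff (aux_ann_meas d y t (2*t))).2 (aux_kernel_integrable d n μ y t ht))]
  set c : ℝ := (1 + (n+1) * 2^n) * (ε * (t ^ (n+1))⁻¹) with hc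
  have hc0 : 0 ≤ c := by positivity
  have i1 : Integrable ((closedBall y (3*t)).indicator (fun _ : EE d => c)) μ :=
    (integrable_const c).indicator measurableSet_closedBall
  have i2 : Integrable ((bdN d y ε t).indicator (fun _ : EE d => (t^n)⁻¹)) μ :=
    (integrable_const _).indicator (aux_bdN_meas d y ε t)
  refine (norm_integral_le_of_norm_le (i1.add i2) (Filter.Eventually.of_forall fun z => ?_)).trans ?_
  · have hd1 : dist x z ≤ dist x y + dist y z := dist_triangle _ _ _
    have hd2 : dist y z ≤ dist x y + dist x z := by
      rw [dist_comm x y]; exact dist_triangle _ _ _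
    have n1 : 0 ≤ (closedBall y (3*t)).indicator (fun _ : EE d => c) z :=
      indicator_nonneg (fun _ _ => hc0) _
    have n2 : 0 ≤ (bdN d y ε t).indicator (fun _ : EE d => (t^n)⁻¹) z :=
      indicator_nonneg (fun _ _ => by positivity) _
    by_cases hx : t < dist x z ∧ dist x z ≤ 2 * t <;> by_cases hy : t < dist y z ∧ dist y z ≤ 2 * t
    · have hz : z ∈ closedBall y (3*t) := by
        rw [mem_closedBall, dist_comm]; linarith
      rw [indicator_of_mem (show z ∈ {y | t < dist x y ∧ dist x y ≤ 2 * t} from hx),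
        indicator_of_mem (show z ∈ {y_1 | t < dist y y_1 ∧ dist y y_1 ≤ 2 * t} from hy)]
      rw [Pi.add_apply, indicator_of_mem hz]
      refine le_trans ?_ (le_add_of_nonneg_right n2)
      rw [aux_kernel_eq, aux_kernel_eq]
      simp only [dist_eq_norm] at hx hy hxy
      refine aux_kernel_diff d n _ _ t ε ht hx.1 hx.2 hy.1 hy.2 ?_
      rw [sub_sub_sub_cancel_right]; exact hxy.le
    · have hz : z ∈ bdN d y ε t := by
        rw [not_and_or, not_lt, not_le] at hy
        rcases hy with h | h
        · left; rw [abs_le]; constructor <;> linarith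
        · right; rw [abs_le]; constructor <;> linarith
      rw [indicator_of_mem (show z ∈ {y | t < dist x y ∧ dist x y ≤ 2 * t} from hx),
        indicator_of_notMem (show z ∉ {y_1 | t < dist y y_1 ∧ dist y y_1 ≤ 2 * t} from hy), sub_zero]
      rw [Pi.add_apply, indicator_of_mem hz]
      exact le_trans (aux_kernel_norm d n x z t ht hx.1) (le_add_of_nonneg_left n1)
    · have hz : z ∈ bdN d y ε t := by
        rw [not_and_or, not_lt, not_le] at hx
        rcases hx with h | h
        · left; rw [abs_le]; constructor <;> linarith
        · right; rw [abs_le]; constructor <;> linarith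
      rw [indicator_of_notMem (show z ∉ {y | t < dist x y ∧ dist x y ≤ 2 * t} from hx),
        indicator_of_mem (show z ∈ {y_1 | t < dist y y_1 ∧ dist y y_1 ≤ 2 * t} from hy), zero_sub,
        norm_neg]
      rw [Pi.add_apply, indicator_of_mem hz]
      exact le_trans (aux_kernel_norm d n y z t ht hy.1) (le_add_of_nonneg_left n1)
    · rw [indicator_of_notMem (show z ∉ {y | t < dist x y ∧ dist x y ≤ 2 * t} from hx),
        indicator_of_notMem (show z ∉ {y_1 | t < dist y y_1 ∧ dist y y_1 ≤ 2 * t} from hy), sub_zero,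
        norm_zero]
      exact add_nonneg n1 n2
  · simp only [Pi.add_apply]
    rw [integral_add i1 i2, integral_indicator measurableSet_closedBall,
      integral_indicator (aux_bdN_meas d y ε t), setIntegral_const, setIntegral_const]
    simp only [smul_eq_mul]
    apply le_of_eq; ring

lemma aux_J2 (d n : ℕ) (μ : Measure (EE d)) [IsFiniteMeasure μ] (y : EE d) (ε A : ℝ) (hA : 0 ≤ A)
    (hε : 0 < ε) (hgrow : ∀ s, 0 < s → μ (closedBall y (3*s)) ≤ ENNReal.ofReal (A * s^n)) :
    ∫⁻ z, ENNReal.ofReal (((max ε (dist y z / 3)) ^ (n+1))⁻¹) ∂μ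
      ≤ ENNReal.ofReal ((n+1) * A / ε) := by
  have hmeas : MeasurableSet {p : EE d × ℝ | dist y p.1 ≤ 3 * p.2} :=
    (isClosed_le (by fun_prop) (by fun_prop)).measurableSet
  have step1 : ∀ z, ENNReal.ofReal (((max ε (dist y z / 3)) ^ (n+1))⁻¹) ≤
      ENNReal.ofReal (n+1) * ∫⁻ s in Ioi ε, {p : EE d × ℝ | dist y p.1 ≤ 3 * p.2}.indicator
        (fun p => ENNReal.ofReal ((p.2 ^ (n+1+1))⁻¹)) (z, s) := by
    intro z
    set c := max ε (dist y z / 3) with hc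
    have hc0 : 0 < c := lt_max_of_lt_left hε
    have h1 := aux_lint (n+1) (by omega) c hc0
    have h2 : ENNReal.ofReal ((c ^ (n+1))⁻¹) =
        ENNReal.ofReal (n+1) * ENNReal.ofReal ((((n+1:ℕ):ℝ) * c ^ (n+1))⁻¹) := by
      rw [← ENNReal.ofReal_mul (by positivity)]
      congr 1
      push_cast
      field_simp
    rw [h2, ← h1]
    refine mul_le_mul_right ?_ _
    calc _ ≤ ∫⁻ s in Ioi c, {p : EE d × ℝ | dist y p.1 ≤ 3 * p.2}.indicator
            (fun p => ENNReal.ofReal ((p.2 ^ (n+1+1))⁻¹)) (z, s) := by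
          apply setLIntegral_mono' measurableSet_Ioi
          intro s hs
          rw [indicator_of_mem]
          have h3 : dist y z / 3 ≤ c := le_max_right _ _
          have : c < s := hs
          show dist y z ≤ 3 * s
          linarith
      _ ≤ _ := lintegral_mono_set (Ioi_subset_Ioi (le_max_left _ _))
  have hF : Measurable ({p : EE d × ℝ | dist y p.1 ≤ 3 * p.2}.indicator
        (fun p => ENNReal.ofReal ((p.2 ^ (n+1+1))⁻¹))) :=
    Measurable.indicator (by fun_prop) hmeas
  refine (lintegral_mono step1).trans ?_
  rw [lintegral_const_mul' _ _ ENNReal.ofReal_ne_top]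
  rw [lintegral_lintegral_swap (f := fun z s => {p : EE d × ℝ | dist y p.1 ≤ 3 * p.2}.indicator
        (fun p => ENNReal.ofReal ((p.2 ^ (n+1+1))⁻¹)) (z, s)) hF.aemeasurable]
  have step2 : ∫⁻ s in Ioi ε, ∫⁻ z, {p : EE d × ℝ | dist y p.1 ≤ 3 * p.2}.indicator
        (fun p => ENNReal.ofReal ((p.2 ^ (n+1+1))⁻¹)) (z, s) ∂μ
      ≤ ∫⁻ s in Ioi ε, ENNReal.ofReal A * ENNReal.ofReal ((s ^ (1+1))⁻¹) := by
    apply setLIntegral_mono' measurableSet_Ioi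
    intro s hs
    have hs0 : 0 < s := hε.trans hs
    have : (fun z => {p : EE d × ℝ | dist y p.1 ≤ 3 * p.2}.indicator
        (fun p => ENNReal.ofReal ((p.2 ^ (n+1+1))⁻¹)) (z, s)) =
        (closedBall y (3*s)).indicator (fun _ => ENNReal.ofReal ((s ^ (n+1+1))⁻¹)) := by
      ext z
      simp only [indicator, mem_ofPred_eq, mem_closedBall, dist_comm]
    rw [this, lintegral_indicator measurableSet_closedBall, setLIntegral_const]
    calc _ ≤ ENNReal.ofReal ((s ^ (n+1+1))⁻¹) * ENNReal.ofReal (A * s^n) := by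
            gcongr; exact hgrow s hs0
      _ = _ := by
        rw [← ENNReal.ofReal_mul (by positivity), ← ENNReal.ofReal_mul (by positivity)]
        congr 1
        field_simp
        ring
  calc _ ≤ ENNReal.ofReal (n+1) * ∫⁻ s in Ioi ε, ENNReal.ofReal A * ENNReal.ofReal ((s ^ (1+1))⁻¹) := by
        gcongr
    _ = _ := by
      rw [lintegral_const_mul' _ _ ENNReal.ofReal_ne_top, aux_lint 1 (by norm_num) ε hε,
        ← ENNReal.ofReal_mul (by positivity), ← ENNReal.ofReal_mul (by positivity)]
      congr 1
      push_cast
      field_simp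

lemma aux_J (d n : ℕ) (μ : Measure (EE d)) [IsFiniteMeasure μ] (y : EE d) (ε A : ℝ) (hA : 0 ≤ A)
    (hε : 0 < ε) (hgrow : ∀ s, 0 < s → μ (closedBall y (3*s)) ≤ ENNReal.ofReal (A * s^n)) :
    ∫⁻ t in Ioi ε, ENNReal.ofReal ((t ^ (n+1))⁻¹) * μ (bdN d y ε t)
      ≤ ENNReal.ofReal (3 * (n+1) * A) := by
  set P : Set (ℝ × EE d) := {p | |dist y p.2 - p.1| ≤ ε ∨ |dist y p.2 - 2 * p.1| ≤ ε} with hP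
  have hmeas : MeasurableSet P := by
    have h1 : IsClosed {p : ℝ × EE d | |dist y p.2 - p.1| ≤ ε} :=
      isClosed_le (by fun_prop) (by fun_prop)
    have h2 : IsClosed {p : ℝ × EE d | |dist y p.2 - 2 * p.1| ≤ ε} :=
      isClosed_le (by fun_prop) (by fun_prop)
    exact (h1.union h2).measurableSet
  have hF : Measurable (P.indicator (fun p => ENNReal.ofReal ((p.1 ^ (n+1))⁻¹))) :=
    Measurable.indicator (by fun_prop) hmeas
  have e1 : ∀ t, ENNReal.ofReal ((t ^ (n+1))⁻¹) * μ (bdN d y ε t) =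
      ∫⁻ z, P.indicator (fun p => ENNReal.ofReal ((p.1 ^ (n+1))⁻¹)) (t, z) ∂μ := by
    intro t
    have : (fun z => P.indicator (fun p => ENNReal.ofReal ((p.1 ^ (n+1))⁻¹)) (t, z)) =
        (bdN d y ε t).indicator (fun _ => ENNReal.ofReal ((t ^ (n+1))⁻¹)) := by
      ext z
      have hiff : (t, z) ∈ P ↔ z ∈ bdN d y ε t := Iff.rfl
      by_cases h : z ∈ bdN d y ε t
      · rw [indicator_of_mem h, indicator_of_mem (hiff.2 h)]
      · rw [indicator_of_notMem h, indicator_of_notMem (fun h' => h (hiff.1 h'))]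
    rw [this, lintegral_indicator (aux_bdN_meas d y ε t), setLIntegral_const]
  simp_rw [e1]
  rw [lintegral_lintegral_swap (f := fun t z => P.indicator
    (fun p => ENNReal.ofReal ((p.1 ^ (n+1))⁻¹)) (t, z)) hF.aemeasurable]
  have inner : ∀ z, ∫⁻ t in Ioi ε, P.indicator (fun p => ENNReal.ofReal ((p.1 ^ (n+1))⁻¹)) (t, z)
      ≤ ENNReal.ofReal (3 * ε) * ENNReal.ofReal (((max ε (dist y z / 3)) ^ (n+1))⁻¹) := by
    intro z
    set c := max ε (dist y z / 3) with hc
    have hc0 : 0 < c := lt_max_of_lt_left hε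
    set U : Set ℝ := Icc (dist y z - ε) (dist y z + ε) ∪ Icc ((dist y z - ε)/2) ((dist y z + ε)/2) with hU
    have hUm : MeasurableSet U := measurableSet_Icc.union measurableSet_Icc
    calc _ ≤ ∫⁻ t in Ioi ε, U.indicator (fun _ => ENNReal.ofReal ((c ^ (n+1))⁻¹)) t := by
          apply setLIntegral_mono' measurableSet_Ioi
          intro t ht
          have ht : ε < t := ht
          by_cases h : (t, z) ∈ P
          · have h' : |dist y z - t| ≤ ε ∨ |dist y z - 2 * t| ≤ ε := h
            have hct : c ≤ t := by
              apply max_le ht.le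
              rcases h' with h | h <;> linarith [(abs_le.1 h).2]
            have htU : t ∈ U := by
              rcases h' with h | h
              · left; constructor <;> linarith [(abs_le.1 h).2, (abs_le.1 h).1]
              · right; constructor <;> linarith [(abs_le.1 h).2, (abs_le.1 h).1]
            rw [indicator_of_mem h, indicator_of_mem htU]
            apply ENNReal.ofReal_le_ofReal
            gcongr
          · rw [indicator_of_notMem h]; exact zero_le
      _ ≤ ∫⁻ t, U.indicator (fun _ => ENNReal.ofReal ((c ^ (n+1))⁻¹)) t := setLIntegral_le_lintegral _ _
      _ = ENNReal.ofReal ((c ^ (n+1))⁻¹) * volume U := by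
          rw [lintegral_indicator hUm, setLIntegral_const]
      _ ≤ ENNReal.ofReal ((c ^ (n+1))⁻¹) * ENNReal.ofReal (3 * ε) := by
          gcongr
          refine (measure_union_le _ _).trans ?_
          rw [Real.volume_Icc, Real.volume_Icc, ← ENNReal.ofReal_add (by linarith) (by linarith)]
          apply ENNReal.ofReal_le_ofReal
          linarith
      _ = _ := mul_comm _ _
  refine (lintegral_mono inner).trans ?_
  rw [lintegral_const_mul' _ _ ENNReal.ofReal_ne_top]
  calc _ ≤ ENNReal.ofReal (3 * ε) * ENNReal.ofReal ((n+1) * A / ε) := by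
        gcongr; exact aux_J2 d n μ y ε A hA hε hgrow
    _ = _ := by
      rw [← ENNReal.ofReal_mul (by positivity)]
      congr 1
      field_simp

lemma aux_main (d n : ℕ) (μ : Measure (EE d)) [IsFiniteMeasure μ] (x y : EE d) (ε k : ℝ)
    (hk : 0 ≤ k) (hε : 0 < ε) (hxy : dist x y < ε) (hy : y ∈ goodF d n μ k)
    (hS : ∫⁻ t in Ioi (0:ℝ), ENNReal.ofReal (‖truncRiesz d n μ y t (2*t)‖^2 / t)
      ≤ ENNReal.ofReal (k^2)) :
    ∫⁻ t in Ioi ε, ENNReal.ofReal (‖truncRiesz d n μ x t (2*t)‖^2 / t) ≤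
      ENNReal.ofReal (2 * k^2 + (2 * (1 + (n+1) * 2^n)^2 * (k*3^n)^2 + 12 * (n+1) * (k*3^n)^2)) := by
  set A : ℝ := k * 3^n with hA
  have hA0 : 0 ≤ A := by positivity
  set c : ℝ := 1 + (n+1) * 2^n with hc
  have hc0 : 0 ≤ c := by positivity
  have hgrow : ∀ s, 0 < s → μ (closedBall y (3*s)) ≤ ENNReal.ofReal (A * s^n) := by
    intro s hs
    have := hy y (3*s) (by positivity) (mem_closedBall_self (by positivity))
    rwa [mul_pow, ← mul_assoc] at this
  have pt : ∀ t ∈ Ioi ε, ENNReal.ofReal (‖truncRiesz d n μ x t (2*t)‖^2 / t) ≤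
      ENNReal.ofReal 2 * ENNReal.ofReal (‖truncRiesz d n μ y t (2*t)‖^2 / t) +
      (ENNReal.ofReal (4 * c^2 * A^2 * ε^2) * ENNReal.ofReal ((t^(2+1))⁻¹) +
       ENNReal.ofReal (4 * A) * (ENNReal.ofReal ((t ^ (n+1))⁻¹) * μ (bdN d y ε t))) := by
    intro t ht
    have ht : ε < t := ht
    have ht0 : 0 < t := hε.trans ht
    have hD := aux_diff d n μ x y t ε hε ht hxy
    set ν := μ.real (bdN d y ε t) with hν
    have hB : μ.real (closedBall y (3*t)) ≤ A * t^n :=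
      ENNReal.toReal_le_of_le_ofReal (by positivity) (hgrow t ht0)
    have hν0 : 0 ≤ ν := measureReal_nonneg
    have hνB : ν ≤ A * t^n :=
      (measureReal_mono (aux_bdN_sub d y ε t ht hε)).trans hB
    set X := truncRiesz d n μ x t (2*t)
    set Y := truncRiesz d n μ y t (2*t)
    have hD2 : ‖X - Y‖ ≤ c * A * (ε / t) + (t^n)⁻¹ * ν := by
      refine hD.trans ?_
      gcongr ?_ + _
      calc _ ≤ c * (ε * (t ^ (n+1))⁻¹) * (A * t^n) := by gcongr
        _ = _ := by field_simp; ring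
    have hD3 : ‖X‖ ≤ ‖Y‖ + ‖X - Y‖ := by
      have := norm_add_le Y (X - Y); simpa using this
    have hν2 : ((t^n)⁻¹ * ν)^2 ≤ A * ((t^n)⁻¹ * ν) := by
      rw [sq]
      gcongr
      calc _ ≤ (t^n)⁻¹ * (A * t^n) := by gcongr
        _ = A := by field_simp
    have hsq : ‖X‖^2 ≤ 2 * ‖Y‖^2 + (4 * (c * A * (ε / t))^2 + 4 * A * ((t^n)⁻¹ * ν)) := by
      have h1 : ‖X‖^2 ≤ (‖Y‖ + (c * A * (ε / t) + (t^n)⁻¹ * ν))^2 := by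
        gcongr; linarith
      nlinarith [sq_nonneg (‖Y‖ - (c * A * (ε / t) + (t^n)⁻¹ * ν)),
        sq_nonneg (c * A * (ε / t) - (t^n)⁻¹ * ν)]
    have hfin : ‖X‖^2 / t ≤ 2 * (‖Y‖^2 / t) + (4 * c^2 * A^2 * ε^2 * (t^(2+1))⁻¹
        + 4 * A * ((t^(n+1))⁻¹ * ν)) := by
      calc _ ≤ (2 * ‖Y‖^2 + (4 * (c * A * (ε / t))^2 + 4 * A * ((t^n)⁻¹ * ν))) / t := by gcongr
        _ = _ := by field_simp; ring
    refine (ENNReal.ofReal_le_ofReal hfin).trans ?_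
    rw [ENNReal.ofReal_add (by positivity) (by positivity),
      ENNReal.ofReal_add (by positivity) (by positivity),
      ENNReal.ofReal_mul (p := 2) (by positivity), ENNReal.ofReal_mul (p := 4 * A) (by positivity),
      ENNReal.ofReal_mul (p := 4 * c^2 * A^2 * ε^2) (by positivity),
      ENNReal.ofReal_mul (p := (t^(n+1))⁻¹) (by positivity), hν, ofReal_measureReal]
  refine (setLIntegral_mono' measurableSet_Ioi pt).trans ?_
  have hmeasN : Measurable (fun t : ℝ => μ (bdN d y ε t)) := by
    have h1 : IsClosed {p : ℝ × EE d | |dist y p.2 - p.1| ≤ ε} :=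
      isClosed_le (by fun_prop) (by fun_prop)
    have h2 : IsClosed {p : ℝ × EE d | |dist y p.2 - 2 * p.1| ≤ ε} :=
      isClosed_le (by fun_prop) (by fun_prop)
    exact measurable_measure_prodMk_left (h1.union h2).measurableSet
  have hm1 : Measurable (fun t : ℝ => ENNReal.ofReal (4 * c^2 * A^2 * ε^2) *
      ENNReal.ofReal ((t^(2+1))⁻¹)) := by fun_prop
  have hm2 : Measurable (fun t : ℝ => ENNReal.ofReal (4 * A) *
      (ENNReal.ofReal ((t ^ (n+1))⁻¹) * μ (bdN d y ε t))) := by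
    refine Measurable.const_mul (Measurable.mul ?_ hmeasN) _
    fun_prop
  have hm12 : Measurable (fun t : ℝ => ENNReal.ofReal (4 * c^2 * A^2 * ε^2) *
      ENNReal.ofReal ((t^(2+1))⁻¹) + ENNReal.ofReal (4 * A) *
      (ENNReal.ofReal ((t ^ (n+1))⁻¹) * μ (bdN d y ε t))) := hm1.add hm2
  rw [lintegral_add_right _ hm12, lintegral_add_right _ hm2,
    lintegral_const_mul' _ _ ENNReal.ofReal_ne_top, lintegral_const_mul' _ _ ENNReal.ofReal_ne_top,
    lintegral_const_mul' _ _ ENNReal.ofReal_ne_top, aux_lint 2 (by norm_num) ε hε]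
  have b1 := (lintegral_mono_set (μ := volume)
    (f := fun t => ENNReal.ofReal (‖truncRiesz d n μ y t (2*t)‖^2 / t))
    (Ioi_subset_Ioi hε.le)).trans hS
  have b2 := aux_J d n μ y ε A hA0 hε hgrow
  calc _ ≤ ENNReal.ofReal 2 * ENNReal.ofReal (k^2) + (ENNReal.ofReal (4 * c^2 * A^2 * ε^2) *
          ENNReal.ofReal ((((2:ℕ):ℝ) * ε^2)⁻¹) +
          ENNReal.ofReal (4 * A) * ENNReal.ofReal (3 * (n+1) * A)) := by gcongr
    _ = _ := by
      rw [← ENNReal.ofReal_mul (by positivity), ← ENNReal.ofReal_mul (by positivity),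
        ← ENNReal.ofReal_mul (by positivity), ← ENNReal.ofReal_add (by positivity) (by positivity),
        ← ENNReal.ofReal_add (by positivity) (by positivity)]
      congr 1
      push_cast
      field_simp
      ring

/-- The set of good points at level `k`. -/
def goodG (d n : ℕ) (μ : Measure (EE d)) (k : ℕ) : Set (EE d) :=
  goodF d n μ k ∩ {y | sqFn d n μ y ≤ (k : ℝ≥0∞)}

lemma aux_G_mono (d n : ℕ) (μ : Measure (EE d)) : Monotone (goodG d n μ) := by
  intro k l hkl y hy
  have hkl' : (k:ℝ) ≤ l := by exact_mod_cast hkl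
  refine ⟨fun z r hr hz => (hy.1 z r hr hz).trans (ENNReal.ofReal_le_ofReal (by gcongr)), ?_⟩
  have h2 : sqFn d n μ y ≤ (k : ℝ≥0∞) := hy.2
  show sqFn d n μ y ≤ (l : ℝ≥0∞)
  exact h2.trans (by exact_mod_cast hkl)

theorem stmt12 (n d : ℕ) (hn : 0 < n) (hnd : n ≤ d)
    (μ : Measure (EuclideanSpace ℝ (Fin d))) [IsFiniteMeasure μ]
    (hdens : ∀ᵐ x ∂μ, 0 < upperDensity d n μ x ∧ upperDensity d n μ x < ⊤)
    (hsq : ∀ᵐ x ∂μ, sqFn d n μ x < ⊤) :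
    ∀ δ : ℝ, 0 < δ →
      ∃ (M C : ℝ) (H : Set (EuclideanSpace ℝ (Fin d))),
        0 < M ∧ 0 < C ∧ IsOpen H ∧ μ H ≤ ENNReal.ofReal δ ∧
        (∀ (x : EuclideanSpace ℝ (Fin d)) (r : ℝ), 0 < r →
          ENNReal.ofReal (M * r^n) < μ (closedBall x r) → closedBall x r ⊆ H) ∧
        (∀ (x : EuclideanSpace ℝ (Fin d)) (ε : ℝ),
          Metric.infDist x Hᶜ < ε → sqFnTrunc d n ε μ x ≤ ENNReal.ofReal C) := by
  intro δ hδ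
  by_cases hμ : μ = 0
  · subst hμ
    refine ⟨1, 1, ∅, one_pos, one_pos, isOpen_empty, by simp, ?_, ?_⟩
    · intro x r _ h; simp at h
    · intro x ε _
      simp [sqFnTrunc, truncRiesz]
  have hU : μ (⋃ k, goodG d n μ k) = μ univ := by
    apply measure_congr
    rw [Filter.eventuallyEq_univ]
    filter_upwards [hdens, hsq] with y h1 h2
    obtain ⟨M, hM⟩ := aux_goodF_of_dens d n μ y h1.2
    obtain ⟨N, hN⟩ := ENNReal.exists_nat_gt h2.ne
    refine mem_iUnion.2 ⟨max M N, ?_, ?_⟩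
    · have hMM : (M:ℝ) ≤ ((max M N : ℕ) : ℝ) := by exact_mod_cast le_max_left M N
      exact fun z r hr hz => (hM z r hr hz).trans (ENNReal.ofReal_le_ofReal (by gcongr))
    · show sqFn d n μ y ≤ ((max M N : ℕ) : ℝ≥0∞)
      exact hN.le.trans (by exact_mod_cast le_max_right M N)
  have ht := tendsto_measure_iUnion_atTop (μ := μ) (aux_G_mono d n μ)
  rw [hU] at ht
  have hpos : 0 < μ univ := by simpa [pos_iff_ne_zero] using hμ
  have hlt : μ univ - ENNReal.ofReal δ < μ univ :=
    ENNReal.sub_lt_self (measure_ne_top _ _) hpos.ne' (by simpa using hδ)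
  obtain ⟨k, ⟨hk1, hk2⟩, hk3⟩ := (((ht.eventually (lt_mem_nhds hlt)).and
    (ht.eventually (lt_mem_nhds hpos))).and (Filter.eventually_ge_atTop 1)).exists
  simp only [Function.comp_apply] at hk1 hk2
  have hne : (goodG d n μ k).Nonempty := nonempty_of_measure_ne_zero hk2.ne'
  have hk0 : (0:ℝ) < k := by exact_mod_cast hk3
  set T : ℝ := 2 * (k:ℝ)^2 + (2 * (1 + (n+1) * 2^n)^2 * ((k:ℝ)*3^n)^2 + 12 * (n+1) * ((k:ℝ)*3^n)^2) with hT
  have hT0 : 0 < T := by positivity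
  refine ⟨k, T ^ (1/2 : ℝ), (closure (goodG d n μ k))ᶜ, hk0, by positivity,
    isClosed_closure.isOpen_compl, ?_, ?_, ?_⟩
  · rw [measure_compl isClosed_closure.measurableSet (measure_ne_top _ _)]
    rw [tsub_le_iff_left, ← tsub_le_iff_right]
    exact hk1.le.trans (measure_mono subset_closure)
  · intro x r hr hx
    rw [subset_compl_iff_disjoint_right, Set.disjoint_left]
    intro z hz hzG
    have hz2 : z ∈ goodF d n μ k :=
      closure_minimal inter_subset_left (aux_goodF_closed d n μ k) hzG
    exact absurd (hz2 x r hr hz) (not_le.2 hx)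
  · intro x ε hxε
    rw [compl_compl, infDist_closure] at hxε
    have hε : 0 < ε := infDist_nonneg.trans_lt hxε
    obtain ⟨y, hy, hxy⟩ := (infDist_lt_iff hne).1 hxε
    have hSy : sqFn d n μ y ≤ (k : ℝ≥0∞) := hy.2
    unfold sqFn at hSy
    unfold sqFnTrunc
    rw [← ENNReal.ofReal_rpow_of_pos hT0]
    refine ENNReal.rpow_le_rpow ?_ (by norm_num)
    refine aux_main d n μ x y ε k hk0.le hε hxy hy.1 ?_
    have h2 := ENNReal.rpow_le_rpow hSy (by norm_num : (0:ℝ) ≤ 2)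
    rw [← ENNReal.rpow_mul] at h2
    norm_num at h2
    rw [ENNReal.ofReal_pow hk0.le, ENNReal.ofReal_natCast]
    exact h2
end
end
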